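/- arXiv:1301.1512 — 2 statements merged into one kernel-verified Lean document; each statement's English description precedes it below -/
import Mathlib

section
/- Let S be one of the graphs P_4, Z_1 or Z_2, and let G be a 2-connected graph which is not a cycle. If G is K_{1,3}-f_1-heavy and S-f_1-heavy, then G is pancyclic. -/
open SimpleGraph

/-- `G` contains a cycle of length `k`. -/
def HasCycleLength {V : Type} (G : SimpleGraph V) (k : ℕ) : Prop :=
  ∃ (v : V) (c : G.Walk v v), c.IsCycle ∧ c.length = k

/-- A graph on `n` vertices is pancyclic if it contains cycles of every length from 3 to `n`. -/
def IsPancyclic {V : Type} [Fintype V] (G : SimpleGraph V) : Prop :=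
  ∀ k : ℕ, 3 ≤ k → k ≤ Fintype.card V → HasCycleLength G k

/-- A graph is Hamiltonian if it contains a spanning cycle. -/
def IsHamiltonianGraph {V : Type} (G : SimpleGraph V) : Prop :=
  ∃ (v : V) (c : G.Walk v v), c.IsCycle ∧ ∀ u : V, u ∈ c.support

/-- A graph is 2-connected if it has at least 3 vertices and deleting any single
vertex leaves a connected graph. -/
def TwoConnected {V : Type} [Fintype V] (G : SimpleGraph V) : Prop :=
  3 ≤ Fintype.card V ∧ ∀ v : V, (G.induce {u : V | u ≠ v}).Connected

/-- A (finite) graph is a cycle iff it is connected and 2-regular. -/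
def IsCycleGraph {V : Type} [Fintype V] (G : SimpleGraph V) [DecidableRel G.Adj] : Prop :=
  G.Connected ∧ ∀ v : V, G.degree v = 2

/-- `G` is `R`-f₁-heavy: for every induced copy of `R` in `G` (given by a graph
embedding `f : R ↪g G`) and every pair of vertices at distance 2 in that copy,
one of them has degree at least `(n+1)/2` in `G`. -/
def F1Heavy {V W : Type} [Fintype V] (G : SimpleGraph V) [DecidableRel G.Adj]
    (R : SimpleGraph W) : Prop :=
  ∀ (f : R ↪g G) (a b : W), R.dist a b = 2 →
    Fintype.card V + 1 ≤ 2 * max (G.degree (f a)) (G.degree (f b))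

/-- `G` is `R`-f-heavy: as above but with degree at least `n/2`. -/
def FHeavy {V W : Type} [Fintype V] (G : SimpleGraph V) [DecidableRel G.Adj]
    (R : SimpleGraph W) : Prop :=
  ∀ (f : R ↪g G) (a b : W), R.dist a b = 2 →
    Fintype.card V ≤ 2 * max (G.degree (f a)) (G.degree (f b))

/-- `G` is `R`-free: no induced subgraph of `G` is isomorphic to `R`. -/
def RFree {V W : Type} (G : SimpleGraph V) (R : SimpleGraph W) : Prop :=
  IsEmpty (R ↪g G)

/-- The claw `K_{1,3}`: vertex `0` is the center, adjacent to `1`, `2`, `3`. -/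
def claw : SimpleGraph (Fin 4) := SimpleGraph.fromRel (fun a _ => a = 0)

/-- `Z_i`: the path `0 1 2 ... (i+2)` together with the chord `{0,2}`,
i.e. a triangle `0 1 2` with a path of `i` edges attached at vertex `2`. -/
def Zgraph (i : ℕ) : SimpleGraph (Fin (i + 3)) :=
  SimpleGraph.fromRel (fun a b => b.val = a.val + 1 ∨ (a.val = 0 ∧ b.val = 2))

/-- The net `N`: triangle `0 1 2` with pendant edges `0-3`, `1-4`, `2-5`. -/
def netGraph : SimpleGraph (Fin 6) :=
  SimpleGraph.fromRel (fun a b =>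
    (a.val = 0 ∧ b.val = 1) ∨ (a.val = 1 ∧ b.val = 2) ∨ (a.val = 0 ∧ b.val = 2) ∨
    (a.val = 0 ∧ b.val = 3) ∨ (a.val = 1 ∧ b.val = 4) ∨ (a.val = 2 ∧ b.val = 5))

/-- The wounded `W`: triangle `0 1 2` with a pendant edge `0-3` and a pendant
path `1-4-5` of two edges. -/
def woundedGraph : SimpleGraph (Fin 6) :=
  SimpleGraph.fromRel (fun a b =>
    (a.val = 0 ∧ b.val = 1) ∨ (a.val = 1 ∧ b.val = 2) ∨ (a.val = 0 ∧ b.val = 2) ∨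
    (a.val = 0 ∧ b.val = 3) ∨ (a.val = 1 ∧ b.val = 4) ∨ (a.val = 4 ∧ b.val = 5))

namespace Panc
open scoped Classical

section Paths
variable {V : Type} {A B : V → V → Prop}

/-- `l` is a list chained by `A`, from `a` to `b`. -/
def Pth (A : V → V → Prop) (a : V) (l : List V) (b : V) : Prop :=
  l.IsChain A ∧ l.head? = some a ∧ l.getLast? = some b

theorem Pth.single (a : V) : Pth A a [a] a := by simp [Pth]

theorem Pth.append {a b c d : V} {l m : List V} (h : Pth A a l b) (hbc : A b c)
    (h' : Pth A c m d) : Pth A a (l ++ m) d := by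
  obtain ⟨h1, h2, h3⟩ := h
  obtain ⟨h4, h5, h6⟩ := h'
  refine ⟨?_, ?_, ?_⟩
  · rw [List.isChain_append]
    refine ⟨h1, h4, ?_⟩
    intro x hx y hy
    rw [h3] at hx; rw [h5] at hy
    cases hx; cases hy; exact hbc
  · simp [h2]
  · simp [h6]

theorem Pth.cons {a c d : V} {m : List V} (hac : A a c) (h' : Pth A c m d) :
    Pth A a (a :: m) d := (Pth.single a).append hac h'

theorem Pth.ne_nil {a b : V} {l : List V} (h : Pth A a l b) : l ≠ [] := by
  rintro rfl; simp [Pth] at h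

theorem Pth.reverse (hs : ∀ x y, A x y → A y x) {a b : V} {l : List V} (h : Pth A a l b) :
    Pth A b l.reverse a := by
  obtain ⟨h1, h2, h3⟩ := h
  refine ⟨?_, by simp [h3], by simp [h2]⟩
  rw [List.isChain_reverse]
  exact h1.imp (fun x y h => hs _ _ h)

theorem Pth.mono (hAB : ∀ x y, A x y → B x y) {a b : V} {l : List V} (h : Pth A a l b) :
    Pth B a l b := ⟨h.1.imp hAB, h.2⟩

theorem Pth.head_mem {a b : V} {l : List V} (h : Pth A a l b) : a ∈ l :=
  List.mem_of_mem_head? h.2.1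
theorem Pth.last_mem {a b : V} {l : List V} (h : Pth A a l b) : b ∈ l :=
  List.mem_of_mem_getLast? h.2.2

theorem exists_pth_of_chain {l : List V} (h : l.IsChain A) (hne : l ≠ []) :
    ∃ a b, Pth A a l b :=
  ⟨l.head hne, l.getLast hne, h, List.head?_eq_some_head hne, List.getLast?_eq_some_getLast hne⟩

theorem Pth.split {a b : V} {l m : List V} (h : Pth A a (l ++ m) b) (hl : l ≠ []) (hm : m ≠ []) :
    ∃ c d, Pth A a l c ∧ A c d ∧ Pth A d m b := by
  obtain ⟨h1, h2, h3⟩ := h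
  rw [List.isChain_append] at h1
  obtain ⟨h1, h4, h5⟩ := h1
  refine ⟨l.getLast hl, m.head hm, ⟨h1, ?_, List.getLast?_eq_some_getLast hl⟩,
    h5 _ (List.getLast?_eq_some_getLast hl) _ (List.head?_eq_some_head hm),
    ⟨h4, List.head?_eq_some_head hm, ?_⟩⟩
  · cases l with
    | nil => exact absurd rfl hl
    | cons x l => simpa using h2
  · rw [List.getLast?_append] at h3
    rw [List.getLast?_eq_some_getLast hm] at h3 ⊢
    simpa using h3

theorem Pth.head_eq {a b c : V} {l : List V} (h : Pth A a (c :: l) b) : c = a := by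
  simpa using h.2.1

theorem Pth.tail {a b c : V} {l : List V} (h : Pth A a (c :: l) b) (hl : l ≠ []) :
    ∃ d, A a d ∧ Pth A d l b := by
  have := h.head_eq
  subst this
  obtain ⟨e, d, h1, h2, h3⟩ := Pth.split (l := [c]) h (by simp) hl
  have : c = e := by simpa using h1.2.2
  subst this
  exact ⟨d, h2, h3⟩

theorem Pth.exists_cons {a b : V} {l : List V} (h : Pth A a l b) : ∃ m, l = a :: m := by
  cases l with
  | nil => exact absurd rfl h.ne_nil
  | cons x l => exact ⟨l, by rw [h.head_eq]⟩

theorem Pth.exists_concat {a b : V} {l : List V} (h : Pth A a l b) : ∃ m, l = m ++ [b] := by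
  have hne := h.ne_nil
  refine ⟨l.dropLast, ?_⟩
  have := List.dropLast_append_getLast hne
  have h3 := h.2.2
  rw [List.getLast?_eq_some_getLast hne] at h3
  rw [← this]
  simp at h3
  simp [h3]

/-- The list `l` traverses a cycle in the relation `A`. -/
def Cyc (A : V → V → Prop) (l : List V) : Prop :=
  3 ≤ l.length ∧ l.Nodup ∧ ∃ a b, Pth A a l b ∧ A b a

theorem Cyc.rot {l m : List V} (h : Cyc A (l ++ m)) : Cyc A (m ++ l) := by
  rcases eq_or_ne l [] with rfl | hl
  · simpa using h
  rcases eq_or_ne m [] with rfl | hm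
  · simpa using h
  obtain ⟨h1, h2, a, b, h3, h4⟩ := h
  obtain ⟨c, d, h5, h6, h7⟩ := h3.split hl hm
  exact ⟨by simp at h1 ⊢; omega, (List.perm_append_comm.nodup_iff).1 h2, d, c, h7.append h4 h5, h6⟩

theorem Cyc.rev (hs : ∀ x y, A x y → A y x) {l : List V} (h : Cyc A l) : Cyc A l.reverse := by
  obtain ⟨h1, h2, a, b, h3, h4⟩ := h
  exact ⟨by simpa using h1, by simpa using h2, b, a, h3.reverse hs, hs _ _ h4⟩

theorem Cyc.mono (hAB : ∀ x y, A x y → B x y) {l : List V} (h : Cyc A l) : Cyc B l := by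
  obtain ⟨h1, h2, a, b, h3, h4⟩ := h
  exact ⟨h1, h2, a, b, h3.mono hAB, hAB _ _ h4⟩

theorem Cyc.rotate_to {l : List V} (h : Cyc A l) {u : V} (hu : u ∈ l) :
    ∃ m, Cyc A (u :: m) ∧ List.Perm (u :: m) l := by
  obtain ⟨s, t, rfl⟩ := List.append_of_mem hu
  exact ⟨t ++ s, by simpa using h.rot, by
    simpa using (List.perm_append_comm : List.Perm ((u :: t) ++ s) (s ++ u :: t))⟩

theorem Cyc.toFinset_card {l : List V} (h : Cyc A l) : l.toFinset.card = l.length :=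
  List.toFinset_card_of_nodup h.2.1

/-- opening a cycle at its head -/
theorem Cyc.open_head {u : V} {m : List V} (h : Cyc A (u :: m)) :
    ∃ a b, Pth A a m b ∧ A u a ∧ A b u := by
  obtain ⟨h1, h2, a, b, h3, h4⟩ := h
  have := h3.head_eq
  subst this
  have hm : m ≠ [] := by rintro rfl; simp at h1
  obtain ⟨d, h5, h6⟩ := h3.tail hm
  exact ⟨d, b, h6, h5, h4⟩

theorem Cyc.mk' {u a b : V} {m : List V} (h : Pth A a m b) (hn : (u :: m).Nodup) (hl : 2 ≤ m.length)
    (h1 : A u a) (h2 : A b u) : Cyc A (u :: m) :=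
  ⟨by simp; omega, hn, u, b, Pth.cons h1 h, h2⟩

end Paths

section Conn
variable {V : Type} {G : SimpleGraph V}

/-- connectedness of the subgraph induced on `T` -/
def Conn (G : SimpleGraph V) (T : Finset V) : Prop :=
  ∀ A ⊆ T, A.Nonempty → (∀ a ∈ A, ∀ b ∈ T, b ∉ A → ¬ G.Adj a b) → T ⊆ A

/-- 2-connectedness of the subgraph induced on `S` -/
def TwoC (G : SimpleGraph V) (S : Finset V) : Prop :=
  3 ≤ S.card ∧ ∀ z ∈ S, Conn G (S.erase z)

theorem adj_symm' : ∀ x y, G.Adj x y → G.Adj y x := fun _ _ h => h.symm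

theorem Conn.mono_edges {T : Finset V} (h : Conn G T) {A : Finset V} {a b : V} (ha : a ∈ A)
    (haT : a ∈ T) (hb : b ∈ T) (hbA : b ∉ A) : ∃ x ∈ A, x ∈ T ∧ ∃ y ∈ T, y ∉ A ∧ G.Adj x y := by
  by_contra hcon
  push Not at hcon
  have := h (A ∩ T) Finset.inter_subset_right ⟨a, by simp [ha, haT]⟩ (by
    intro x hx y hy hyA
    simp only [Finset.mem_inter] at hx hyA
    exact hcon x hx.1 hx.2 y hy (fun h => hyA ⟨h, hy⟩))
  have := this hb
  simp at this
  exact hbA this.1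

theorem conn_singleton (a : V) : Conn G {a} := by
  intro A hA hne _
  rw [(Finset.Nonempty.subset_singleton_iff hne).1 hA]

theorem Conn.union {T U : Finset V} (hT : Conn G T) (hU : Conn G U) {x y : V} (hx : x ∈ T)
    (hy : y ∈ U) (hxy : G.Adj x y) : Conn G (T ∪ U) := by
  intro A hA hne hcl
  have key1 : ∀ a ∈ A, a ∈ T → T ⊆ A := by
    intro a ha haT t ht
    by_contra htA
    obtain ⟨p, hp, hpT, q, hq, hqA, hpq⟩ := hT.mono_edges ha haT ht htA
    exact hcl p hp q (by simp [hq]) hqA hpq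
  have key2 : ∀ a ∈ A, a ∈ U → U ⊆ A := by
    intro a ha haT t ht
    by_contra htA
    obtain ⟨p, hp, hpT, q, hq, hqA, hpq⟩ := hU.mono_edges ha haT ht htA
    exact hcl p hp q (by simp [hq]) hqA hpq
  have hxyA : x ∈ A ↔ y ∈ A := by
    constructor
    · intro h; by_contra h'; exact hcl x h y (by simp [hy]) h' hxy
    · intro h; by_contra h'; exact hcl y h x (by simp [hx]) h' hxy.symm
  obtain ⟨a, ha⟩ := hne
  have hxA : x ∈ A := by
    rcases Finset.mem_union.1 (hA ha) with h | h
    · exact key1 a ha h hx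
    · exact hxyA.2 (key2 a ha h hy)
  exact Finset.union_subset (key1 x hxA hx) (key2 y (hxyA.1 hxA) hy)

theorem conn_of_chain {l : List V} (h : l.IsChain G.Adj) : Conn G l.toFinset := by
  induction l with
  | nil => intro A hA hne; simp at hA; simp [hA] at hne
  | cons a l ih =>
    cases l with
    | nil => simpa using conn_singleton a
    | cons b l =>
      rw [List.isChain_cons_cons] at h
      have := (conn_singleton (G := G) a).union (ih h.2) (x := a) (y := b) (by simp) (by simp) h.1
      convert this using 1
      ext; simp; tauto

theorem Pth.conn {l : List V} {a b : V} (h : Pth G.Adj a l b) : Conn G l.toFinset :=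
  conn_of_chain h.1

theorem twoC_of_cyc {l : List V} (h : Cyc G.Adj l) : TwoC G l.toFinset := by
  refine ⟨by rw [h.toFinset_card]; exact h.1, ?_⟩
  intro z hz
  obtain ⟨m, h1, h2⟩ := h.rotate_to (List.mem_toFinset.1 hz)
  obtain ⟨a, b, h3, _⟩ := h1.open_head
  rw [← List.toFinset_eq_of_perm _ _ h2]
  have := h1.2.1
  rw [List.nodup_cons] at this
  convert h3.conn using 1
  ext x; simp
  intro hx h; exact this.1 (h ▸ hx)

theorem TwoC.conn {S : Finset V} (h : TwoC G S) : Conn G S := by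
  intro A hA ⟨a, ha⟩ hcl b hb
  by_contra hbA
  have : ∃ z ∈ S, z ∉ ({a, b} : Finset V) := by
    apply Finset.exists_mem_notMem_of_card_lt_card
    have := h.1
    have := Finset.card_le_two (a := a) (b := b)
    omega
  obtain ⟨z, hz, hzab⟩ := this
  simp at hzab
  obtain ⟨p, hp, hpT, q, hq, hqA, hpq⟩ := (h.2 z hz).mono_edges ha
    (Finset.mem_erase.2 ⟨fun h => hzab.1 h.symm, hA ha⟩)
    (Finset.mem_erase.2 ⟨fun h => hzab.2 h.symm, hb⟩) hbA
  exact hcl p hp q (Finset.mem_of_mem_erase hq) hqA hpq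

theorem path_in {T : Finset V} (h : Conn G T) {a b : V} (ha : a ∈ T) (hb : b ∈ T) :
    ∃ l, Pth G.Adj a l b ∧ l.Nodup ∧ ∀ x ∈ l, x ∈ T := by
  by_contra hcon
  let A := T.filter (fun b => ∃ l, Pth G.Adj a l b ∧ l.Nodup ∧ ∀ x ∈ l, x ∈ T)
  have haA : a ∈ A := by
    simp only [A, Finset.mem_filter]
    exact ⟨ha, [a], Pth.single a, by simp, by simpa using ha⟩
  obtain ⟨p, hp, hpT, q, hq, hqA, hpq⟩ := h.mono_edges haA ha hb (by
    simp only [A, Finset.mem_filter]; exact fun h => hcon h.2)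
  apply hqA
  simp only [A, Finset.mem_filter] at hp ⊢
  refine ⟨hq, ?_⟩
  obtain ⟨-, l, h1, h2, h3⟩ := hp
  by_cases hql : q ∈ l
  · obtain ⟨s, t, rfl⟩ := List.append_of_mem hql
    refine ⟨s ++ [q], ?_, ?_, ?_⟩
    · rcases eq_or_ne t [] with rfl | ht
      · obtain ⟨hh1, hh2, hh3⟩ := h1
        exact ⟨hh1, hh2, by simp⟩
      · have h1' : Pth G.Adj a ((s ++ [q]) ++ t) p := by simpa using h1
        obtain ⟨c, d, h5, h6, h7⟩ := h1'.split (by simp) ht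
        have : q = c := by simpa using h5.2.2
        rwa [← this] at h5
    · have : List.Sublist (s ++ [q]) (s ++ q :: t) := by simp
      exact h2.sublist this
    · intro x hx; apply h3; simp at hx ⊢; tauto
  · refine ⟨l ++ [q], h1.append hpq (Pth.single q), ?_, ?_⟩
    · rw [List.nodup_append]
      refine ⟨h2, by simp, ?_⟩
      intro x hx y hy
      simp at hy; subst hy; rintro rfl; exact hql hx
    · intro x hx; simp at hx; rcases hx with hx | rfl
      · exact h3 x hx
      · exact hq

theorem cut_lemma {p : List V} {a b : V} (hp : Pth G.Adj a p b) (hn : p.Nodup) (h3 : 3 ≤ p.length) :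
    TwoC G p.toFinset ∨ ∃ P x Q, p = P ++ x :: Q ∧ P ≠ [] ∧ Q ≠ [] ∧
      ∀ y ∈ P, ∀ z ∈ Q, ¬ G.Adj y z := by
  by_contra hcon
  push Not at hcon
  obtain ⟨h1, h2⟩ := hcon
  apply h1
  refine ⟨by rwa [List.toFinset_card_of_nodup hn], ?_⟩
  intro z hz
  obtain ⟨s, t, rfl⟩ := List.append_of_mem (List.mem_toFinset.1 hz)
  have hchain := hp.1
  have hE : (s ++ z :: t).toFinset.erase z = s.toFinset ∪ t.toFinset := by
    ext x
    simp [List.nodup_append] at hn ⊢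
    intro hx
    rintro rfl
    rcases hx with hx | hx
    · exact (hn.2.2 x hx).1 rfl
    · exact hn.2.1.1 hx
  rw [hE]
  rw [List.isChain_append] at hchain
  have ht : t.IsChain G.Adj := by
    have := hchain.2.1
    rw [List.isChain_cons] at this
    exact this.2
  rcases eq_or_ne s [] with rfl | hs
  · simpa using conn_of_chain ht
  rcases eq_or_ne t [] with rfl | ht'
  · simpa using conn_of_chain hchain.1
  obtain ⟨y, hy, w, hw, hyw⟩ := h2 s z t rfl hs ht'
  exact (conn_of_chain hchain.1).union (conn_of_chain ht) (by simpa using hy) (by simpa using hw) hyw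

theorem twin_conn {T : Finset V} (h : Conn G T) {q w : V} (hq : q ∈ T) (hw : w ∈ T) (hqw : q ≠ w)
    (hN : ∀ v ∈ T, v ≠ w → G.Adj q v → G.Adj w v) : Conn G (T.erase q) := by
  intro A hA ⟨a, ha⟩ hcl b hb
  have hA' : A ⊆ T := fun x hx => Finset.mem_of_mem_erase (hA hx)
  by_contra hbA
  have hqA : q ∉ A := fun h => by simpa using hA h
  by_cases hwA : w ∈ A
  · obtain ⟨x, hx, hxT, y, hy, hyA, hxy⟩ := h.mono_edges (A := insert q A) (a := a) (b := b)
      (by simp [ha]) (hA' ha) (Finset.mem_of_mem_erase hb) (by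
        simp only [Finset.mem_insert, not_or]; exact ⟨(Finset.mem_erase.1 hb).1, hbA⟩)
    simp only [Finset.mem_insert, not_or] at hyA hx
    have hyT : y ∈ T.erase q := Finset.mem_erase.2 ⟨hyA.1, hy⟩
    rcases hx with rfl | hx
    · have : y ≠ w := fun h => hyA.2 (h ▸ hwA)
      exact hcl w hwA y hyT hyA.2 (hN y hy this hxy)
    · exact hcl x hx y hyT hyA.2 hxy
  · obtain ⟨x, hx, hxT, y, hy, hyA, hxy⟩ := h.mono_edges (A := A) ha (hA' ha)
      (Finset.mem_of_mem_erase hb) hbA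
    by_cases hyq : y = q
    · subst hyq
      have : x ≠ w := fun h => hwA (h ▸ hx)
      exact hcl x hx w (Finset.mem_erase.2 ⟨hqw.symm, hw⟩) hwA (hN x hxT this hxy.symm).symm
    · exact hcl x hx y (Finset.mem_erase.2 ⟨hyq, hy⟩) hyA hxy

end Conn
end Panc

namespace Panc
open scoped Classical

section Pan
variable {V : Type} {G : SimpleGraph V}

/-- degree of `v` into `S` -/
noncomputable def dg (G : SimpleGraph V) (S : Finset V) (v : V) : ℕ := (S.filter (G.Adj v)).card

def HasCyc (G : SimpleGraph V) (S : Finset V) (k : ℕ) : Prop :=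
  ∃ l, Cyc G.Adj l ∧ (∀ x ∈ l, x ∈ S) ∧ l.length = k

def Pan (G : SimpleGraph V) (S : Finset V) : Prop := ∀ k, 3 ≤ k → k ≤ S.card → HasCyc G S k

def Ham (G : SimpleGraph V) (S : Finset V) : Prop := ∃ l, Cyc G.Adj l ∧ l.toFinset = S

theorem HasCyc.mono {S T : Finset V} {k : ℕ} (h : HasCyc G S k) (hST : S ⊆ T) : HasCyc G T k := by
  obtain ⟨l, h1, h2, h3⟩ := h
  exact ⟨l, h1, fun x hx => hST (h2 x hx), h3⟩

theorem Ham.hasCyc {S : Finset V} (h : Ham G S) : HasCyc G S S.card := by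
  obtain ⟨l, h1, rfl⟩ := h
  exact ⟨l, h1, by simp, h1.toFinset_card.symm⟩

theorem card_idx {l : List V} (hl : l.Nodup) (P : V → Prop) :
    (Finset.univ.filter (fun i : Fin l.length => P l[i])).card = (l.toFinset.filter P).card := by
  rw [← Finset.card_image_of_injective (f := fun i : Fin l.length => l[i])]
  · congr 1
    ext x
    simp only [Finset.mem_image, Finset.mem_filter, Finset.mem_univ, true_and, List.mem_toFinset]
    constructor
    · rintro ⟨i, h1, rfl⟩; exact ⟨by simp, h1⟩
    · rintro ⟨h1, h2⟩
      obtain ⟨i, hi, rfl⟩ := List.getElem_of_mem h1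
      exact ⟨⟨i, hi⟩, h2, rfl⟩
  · intro i j hij
    simp only [Fin.getElem_fin] at hij
    exact Fin.ext ((hl.getElem_inj_iff).1 hij)

theorem pigeon {l : List V} (hl : l.Nodup) (P Q : V → Prop)
    (h : l.length < (l.toFinset.filter P).card + (l.toFinset.filter Q).card) (s : ℕ) :
    ∃ j, ∃ hj : j < l.length, P l[j] ∧
      Q (l[(j + s) % l.length]'(Nat.mod_lt _ (by omega))) := by
  rw [← card_idx hl, ← card_idx hl] at h
  have hpos : 0 < l.length := by
    rcases Nat.eq_zero_or_pos l.length with h0 | h0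
    · have : l = [] := by simpa using h0
      subst this; simp at h
    · exact h0
  let σ : Fin l.length → Fin l.length := fun i => ⟨(i + s) % l.length, Nat.mod_lt _ hpos⟩
  have hσ : Function.Injective σ := by
    intro i j hij
    simp only [σ, Fin.mk.injEq] at hij
    have : (i : ℕ) ≡ j [MOD l.length] := Nat.ModEq.add_right_cancel' s hij
    have := Nat.ModEq.eq_of_lt_of_lt this i.2 j.2
    exact Fin.ext this
  set I := Finset.univ.filter (fun i : Fin l.length => P l[i])
  set J := Finset.univ.filter (fun i : Fin l.length => Q l[i])
  have hne : (I.image σ ∩ J).Nonempty := by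
    rw [← Finset.card_pos]
    have h1 := Finset.card_union_add_card_inter (I.image σ) J
    have h2 := Finset.card_le_univ (I.image σ ∪ J)
    rw [Finset.card_image_of_injective _ hσ] at h1
    simp at h2
    omega
  obtain ⟨j, hj⟩ := hne
  simp only [Finset.mem_inter, Finset.mem_image] at hj
  obtain ⟨⟨i, hi, rfl⟩, hj⟩ := hj
  simp only [I, J, Finset.mem_filter, Finset.mem_univ, true_and] at hi hj
  exact ⟨i, i.2, hi, hj⟩

theorem Pth.drop {A : V → V → Prop} {a b : V} {l : List V} (h : Pth A a l b) {j : ℕ}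
    (hj : j < l.length) : Pth A l[j] (l.drop j) b := by
  refine ⟨h.1.drop _, by simp [List.head?_drop, hj], ?_⟩
  rw [List.getLast?_drop, if_neg (by omega)]
  exact h.2.2

theorem Pth.take {A : V → V → Prop} {a b : V} {l : List V} (h : Pth A a l b) {j : ℕ}
    (hj : j < l.length) : Pth A a (l.take (j + 1)) l[j] := by
  refine ⟨h.1.take _, by simp [List.head?_take, h.2.1], ?_⟩
  simp [List.getLast?_take, hj]

/-- a contiguous segment -/
theorem Pth.seg {A : V → V → Prop} {a b : V} {l : List V} (h : Pth A a l b) {i j : ℕ}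
    (hij : i + j < l.length) : Pth A l[i] ((l.drop i).take (j + 1)) l[i + j] := by
  have h1 := h.drop (j := i) (by omega)
  have h2 := h1.take (j := j) (by simp; omega)
  simpa using h2

theorem Cyc.rotate {A : V → V → Prop} {l : List V} (h : Cyc A l) {i : ℕ} (hi : i ≤ l.length) :
    Cyc A (l.rotate i) := by
  rw [List.rotate_eq_drop_append_take hi]
  apply Cyc.rot
  simpa using h

theorem ml {c : List V} (hc : Cyc G.Adj c) {u : V} (hu : u ∉ c)
    (hd : c.length < 2 * dg G c.toFinset u) {k : ℕ} (hk : 3 ≤ k) (hk' : k ≤ c.length + 1) :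
    HasCyc G (insert u c.toFinset) k := by
  obtain ⟨j, hj, h1, h2⟩ := pigeon hc.2.1 (G.Adj u) (G.Adj u) (by unfold dg at hd; omega) (k - 2)
  obtain ⟨h3, h4, a, b, h5, h6⟩ := hc.rotate hj.le
  have h7 := h5.seg (i := 0) (j := k - 2) (by simp; omega)
  simp only [List.getElem_rotate, zero_add, Nat.mod_eq_of_lt hj, List.drop_zero] at h7
  rw [show k - 2 + j = j + (k - 2) by omega] at h7
  refine ⟨u :: (c.rotate j).take (k - 2 + 1), Cyc.mk' h7 ?_ ?_ h1 h2.symm, ?_, ?_⟩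
  · rw [List.nodup_cons]
    refine ⟨fun h => hu ?_, h4.sublist (List.take_sublist _ _)⟩
    have := List.mem_of_mem_take h
    simpa using this
  · simp; omega
  · intro x hx
    simp only [List.mem_cons] at hx
    rcases hx with rfl | hx
    · simp
    · have := List.mem_of_mem_take hx
      simp at this
      simp [this]
  · simp; omega

theorem dg_insert {S : Finset V} {u v : V} (h : v ∉ S) (huv : G.Adj u v) :
    dg G (insert v S) u = dg G S u + 1 := by
  unfold dg
  rw [Finset.filter_insert, if_pos huv, Finset.card_insert_of_notMem (by simp [h])]

theorem dg_insert_not {S : Finset V} {u v : V} (huv : ¬ G.Adj u v) :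
    dg G (insert v S) u = dg G S u := by
  unfold dg
  rw [Finset.filter_insert, if_neg huv]

theorem sh {u p : V} {R : List V} (hc : Cyc G.Adj (u :: p :: R))
    (hd : (u :: p :: R).length + 1 ≤ dg G (u :: p :: R).toFinset u + dg G (u :: p :: R).toFinset p) :
    Pan G (u :: p :: R).toFinset := by
  intro k hk3 hkn
  rw [hc.toFinset_card] at hkn
  obtain ⟨a, b, h1, h2, h3⟩ := hc.open_head
  have hR : R ≠ [] := by rintro rfl; have := hc.1; simp at this
  have := h1.head_eq
  subst this
  obtain ⟨r, hr, h4⟩ := h1.tail hR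
  have hn := hc.2.1
  simp only [List.nodup_cons, List.mem_cons, not_or] at hn
  obtain ⟨⟨hup, huR⟩, hpR, hRn⟩ := hn
  have e1 : dg G (u :: p :: R).toFinset u = dg G R.toFinset u + 1 := by
    simp only [List.toFinset_cons]
    rw [dg_insert_not (by simp), dg_insert (by simpa using hpR) h2]
  have e2 : dg G (u :: p :: R).toFinset p = dg G R.toFinset p + 1 := by
    simp only [List.toFinset_cons]
    rw [dg_insert (by simp [hup, huR]) h2.symm, dg_insert_not (by simp)]
  rw [e1, e2] at hd
  simp only [List.length_cons] at hd hkn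
  obtain ⟨j, hj, hpj, hui⟩ := pigeon hRn (G.Adj p) (G.Adj u) (by unfold dg at hd; omega) (k - 3)
  rcases lt_or_ge (j + (k - 3)) R.length with hlt | hge
  · simp only [Nat.mod_eq_of_lt hlt] at hui
    have h7 := h4.seg (i := j) (j := k - 3) hlt
    refine ⟨u :: p :: (R.drop j).take (k - 3 + 1), ?_, ?_, ?_⟩
    · refine Cyc.mk' (Pth.cons hpj h7) ?_ ?_ h2 hui.symm
      · refine hc.2.1.sublist ?_
        refine List.Sublist.cons_cons _ (List.Sublist.cons_cons _ ?_)
        exact (List.take_sublist _ _).trans (List.drop_sublist _ _)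
      · simp; omega
    · intro x hx
      simp only [List.mem_cons] at hx
      simp only [List.mem_toFinset, List.mem_cons]
      rcases hx with h | h | h
      · exact Or.inl h
      · exact Or.inr (Or.inl h)
      · exact Or.inr (Or.inr (List.mem_of_mem_drop (List.mem_of_mem_take h)))
    · simp; omega
  · have hmod : (j + (k - 3)) % R.length = j + (k - 3) - R.length := by
      rw [Nat.mod_eq_sub_mod hge, Nat.mod_eq_of_lt (by omega)]
    simp only [hmod] at hui
    set i := j + (k - 3) - R.length with hi
    have h8 := (h4.take (j := i) (by omega)).reverse adj_symm'
    have h9 := (h4.drop hj).append h3 (Pth.cons hui h8)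
    have hperm : List.Perm (R.drop j ++ u :: (R.take (i + 1)).reverse)
        (u :: (R.take (i + 1) ++ R.drop j)) := by
      rw [List.perm_iff_count]; intro a; simp [List.count_cons, List.count_append]; omega
    have hsub : List.Sublist (R.take (i + 1) ++ R.drop j) R := by
      conv_rhs => rw [← List.take_append_drop j R]
      refine List.Sublist.append ?_ (List.Sublist.refl _)
      rw [show i + 1 = min (i + 1) j by omega, ← List.take_take]
      exact List.take_sublist _ _
    refine ⟨p :: (R.drop j ++ u :: (R.take (i + 1)).reverse), ?_, ?_, ?_⟩
    · refine Cyc.mk' h9 ?_ ?_ hpj hr.symm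
      · rw [(hperm.cons p).nodup_iff]
        rw [List.nodup_cons, List.nodup_cons, List.mem_cons]
        refine ⟨?_, fun h => huR (hsub.subset h), hRn.sublist hsub⟩
        rintro (h | h)
        · exact hup h.symm
        · exact hpR (hsub.subset h)
      · simp; omega
    · intro x hx
      rw [(hperm.cons p).mem_iff] at hx
      simp only [List.mem_cons] at hx
      simp only [List.mem_toFinset, List.mem_cons]
      rcases hx with h | h | h
      · exact Or.inr (Or.inl h)
      · exact Or.inl h
      · exact Or.inr (Or.inr (hsub.subset h))
    · simp; omega

theorem pa {u x : V} {P Q : List V} (hc : Cyc G.Adj (u :: (P ++ x :: Q))) (hP : P ≠ []) (hQ : Q ≠ [])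
    (hPu : ∀ y ∈ P, G.Adj u y) (hQu : ∀ y ∈ Q, G.Adj u y)
    (hd : 3 ≤ dg G (u :: (P ++ x :: Q)).toFinset u) : Pan G (u :: (P ++ x :: Q)).toFinset := by
  intro k hk3 hkn
  rw [hc.toFinset_card] at hkn
  obtain ⟨a, b, h1, h2, h3⟩ := hc.open_head
  have hs : 0 < P.length := List.length_pos_iff.2 hP
  have ht : 0 < Q.length := List.length_pos_iff.2 hQ
  simp only [List.length_cons, List.length_append] at hkn
  have hadj : ∀ i (hi : i < (P ++ x :: Q).length), i ≠ P.length → G.Adj u (P ++ x :: Q)[i] := by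
    intro i hi hne
    rcases lt_or_gt_of_ne hne with h | h
    · rw [List.getElem_append_left h]
      exact hPu _ (by simp)
    · rw [List.getElem_append_right (by omega)]
      obtain ⟨e, he⟩ : ∃ e, i - P.length = e + 1 := ⟨i - P.length - 1, by omega⟩
      simp only [he, List.getElem_cons_succ]
      exact hQu _ (by simp)
  have hfin : ∀ a, a + (k - 2) < (P ++ x :: Q).length → a ≠ P.length →
      a + (k - 2) ≠ P.length → HasCyc G (u :: (P ++ x :: Q)).toFinset k := by
    intro a ha hn1 hn2
    have hh1 := hadj a (by omega) hn1
    have hh2 := hadj (a + (k - 2)) ha hn2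
    have h7 := h1.seg (i := a) (j := k - 2) ha
    have hsub : List.Sublist (((P ++ x :: Q).drop a).take (k - 2 + 1)) (P ++ x :: Q) :=
      (List.take_sublist _ _).trans (List.drop_sublist _ _)
    refine ⟨u :: ((P ++ x :: Q).drop a).take (k - 2 + 1), ?_, ?_, ?_⟩
    · refine Cyc.mk' h7 ?_ ?_ hh1 hh2.symm
      · exact hc.2.1.sublist (List.Sublist.cons_cons _ hsub)
      · simp at ha ⊢; omega
    · intro y hy
      rw [List.mem_toFinset]
      exact (List.Sublist.cons_cons u hsub).subset hy
    · simp at ha ⊢; omega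
  have hlen : (P ++ x :: Q).length = P.length + Q.length + 1 := by simp; omega
  by_cases h0 : (k - 2) ≠ P.length
  · exact hfin 0 (by omega) (by omega) (by omega)
  push Not at h0
  by_cases hQ1 : Q.length = 1
  · by_cases hP1 : P.length = 1
    · obtain ⟨p, rfl⟩ := List.length_eq_one_iff.1 hP1
      obtain ⟨q, rfl⟩ := List.length_eq_one_iff.1 hQ1
      have hux : G.Adj u x := by
        by_contra hux
        simp only [List.cons_append, List.nil_append, List.toFinset_cons, List.toFinset_nil] at hd
        rw [Finset.insert_comm p x, dg_insert_not (by simp), dg_insert_not hux] at hd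
        have h5 : dg G {p, q} u ≤ 2 := by
          unfold dg
          exact (Finset.card_filter_le _ _).trans Finset.card_le_two
        simp at hd
        omega
      simp only [List.cons_append, List.nil_append] at h1 hc
      have hpa := h1.head_eq
      subst hpa
      obtain ⟨d, hd1, hd2⟩ := h1.tail (by simp)
      have := hd2.head_eq
      subst this
      refine ⟨[u, p, x], ?_, ?_, ?_⟩
      · refine Cyc.mk' (Pth.cons hd1 (Pth.single x)) ?_ (by simp) h2 hux.symm
        have := hc.2.1
        simp at this ⊢
        tauto
      · simp
      · simp at h0 ⊢; omega
    · exact hfin 1 (by omega) (by omega) (by omega)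
  · rcases Nat.lt_or_ge 1 P.length with h | h
    · exact hfin 1 (by omega) (by omega) (by omega)
    · exact hfin 2 (by omega) (by omega) (by omega)
end Pan
end Panc

namespace Panc
open scoped Classical

section HT
variable {V : Type} {G : SimpleGraph V} {X : Set V}

/-- claw condition -/
def HC (G : SimpleGraph V) (X : Set V) : Prop :=
  ∀ c a b e, G.Adj c a → G.Adj c b → G.Adj c e → a ≠ b → a ≠ e → b ≠ e →
    ¬ G.Adj a b → ¬ G.Adj a e → ¬ G.Adj b e → a ∈ X ∨ b ∈ X

/-- condition coming from the second forbidden graph -/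
def HZ (G : SimpleGraph V) (X : Set V) : Prop :=
  ∀ a b c d e, G.Adj a b → G.Adj a c → G.Adj b c → G.Adj c d → G.Adj d e →
    ¬ G.Adj a d → ¬ G.Adj b d → ¬ G.Adj a e → ¬ G.Adj b e → ¬ G.Adj c e → d ∈ X ∨ a ∈ X

/-- adjacency or both heavy -/
def EE (G : SimpleGraph V) (X : Set V) (x y : V) : Prop := G.Adj x y ∨ (x ≠ y ∧ x ∈ X ∧ y ∈ X)

theorem EE.symm : ∀ x y, EE G X x y → EE G X y x := by
  rintro x y (h | ⟨h1, h2, h3⟩)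
  · exact Or.inl h.symm
  · exact Or.inr ⟨h1.symm, h3, h2⟩

theorem EE.of : ∀ x y, G.Adj x y → EE G X x y := fun _ _ h => Or.inl h

/-- number of virtual edges along a list -/
noncomputable def vl (G : SimpleGraph V) : List V → ℕ
  | [] => 0
  | [_] => 0
  | a :: b :: l => (if G.Adj a b then 0 else 1) + vl G (b :: l)

theorem vl_append {A : V → V → Prop} {a b c d : V} {l m : List V} (h : Pth A a l b) (h' : Pth A c m d) :
    vl G (l ++ m) = vl G l + vl G m + (if G.Adj b c then 0 else 1) := by
  induction l generalizing a with
  | nil => exact absurd rfl h.ne_nil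
  | cons x l ih =>
    rcases eq_or_ne l [] with rfl | hl
    · obtain ⟨m', rfl⟩ := h'.exists_cons
      have : x = b := by simpa using h.2.2
      subst this
      simp [vl]; omega
    · obtain ⟨e, _, h2⟩ := h.tail hl
      have := ih h2
      obtain ⟨l', rfl⟩ := h2.exists_cons
      simp only [List.cons_append, vl] at this ⊢
      omega

theorem vl_reverse {A : V → V → Prop} (hs : ∀ x y, A x y → A y x) {a b : V} {l : List V}
    (h : Pth A a l b) : vl G l.reverse = vl G l := by
  induction l generalizing a with
  | nil => rfl
  | cons x l ih =>
    rcases eq_or_ne l [] with rfl | hl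
    · rfl
    · obtain ⟨e, _, h2⟩ := h.tail hl
      rw [List.reverse_cons, vl_append (h2.reverse hs) (Pth.single x), ih h2]
      obtain ⟨l', rfl⟩ := h2.exists_cons
      simp only [vl, G.adj_comm e x]
      omega

theorem chain_of_vl {l : List V} (h : vl G l = 0) : l.IsChain G.Adj := by
  induction l with
  | nil => simp
  | cons x l ih =>
    cases l with
    | nil => simp
    | cons y l =>
      simp only [vl] at h
      rw [List.isChain_cons_cons]
      refine ⟨?_, ih (by omega)⟩
      by_contra hn
      simp [hn] at h

theorem split_of_vl {l : List V} (h : vl G l ≠ 0) :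
    ∃ s t x y, l = (s ++ [x]) ++ (y :: t) ∧ ¬ G.Adj x y := by
  induction l with
  | nil => simp [vl] at h
  | cons x l ih =>
    cases l with
    | nil => simp [vl] at h
    | cons y l =>
      by_cases hn : G.Adj x y
      · simp only [vl, hn, if_true, zero_add] at h
        obtain ⟨s, t, x', y', h1, h2⟩ := ih h
        exact ⟨x :: s, t, x', y', by simp [h1], h2⟩
      · exact ⟨[], l, x, y, rfl, hn⟩

theorem conv_cyc {S : Finset V}
    (hO : ∀ x ∈ S, ∀ y ∈ S, x ∈ X → y ∈ X → x ≠ y → ¬ G.Adj x y → S.card ≤ dg G S x + dg G S y)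
    (n : ℕ) : ∀ (l : List V) (a b : V), 3 ≤ l.length → l.Nodup → (∀ x ∈ l, x ∈ S) →
      Pth (EE G X) a l b → EE G X b a → vl G l + (if G.Adj b a then 0 else 1) = n →
      ∃ m, Cyc G.Adj m ∧ (∀ x ∈ m, x ∈ S) ∧ ∀ x ∈ l, x ∈ m := by
  induction n using Nat.strong_induction_on with
  | _ n IH =>
  have main : ∀ (l : List V) (a b : V), 3 ≤ l.length → l.Nodup → (∀ x ∈ l, x ∈ S) →
      Pth (EE G X) a l b → EE G X b a → ¬ G.Adj b a → vl G l + 1 = n →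
      ∃ m, Cyc G.Adj m ∧ (∀ x ∈ m, x ∈ S) ∧ ∀ x ∈ l, x ∈ m := by
    intro l a b h3 hn hS hp he hna hv
    have hX : b ≠ a ∧ b ∈ X ∧ a ∈ X := he.resolve_left hna
    have haS := hS a hp.head_mem
    have hbS := hS b hp.last_mem
    have hsum := hO b hbS a haS hX.2.1 hX.2.2 hX.1 hna
    by_cases hz : ∃ z ∈ S, z ∉ l ∧ G.Adj z a ∧ G.Adj z b
    · obtain ⟨z, hzS, hzl, hza, hzb⟩ := hz
      obtain ⟨m, h1, h2, h3⟩ := IH (vl G l) (by omega) (z :: l) z b (by simp; omega)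
        (List.nodup_cons.2 ⟨hzl, hn⟩) (by
          intro x hx; rcases List.mem_cons.1 hx with rfl | hx
          · exact hzS
          · exact hS x hx) (Pth.cons (Or.inl hza) hp) (Or.inl hzb.symm) (by
          have := vl_append (G := G) (Pth.single (A := EE G X) z) hp
          simp only [hza, if_true, List.cons_append, List.nil_append, vl] at this
          rw [this]; simp [hzb.symm])
      exact ⟨m, h1, h2, fun x hx => h3 x (List.mem_cons_of_mem _ hx)⟩
    · push Not at hz
      have hcard : l.toFinset.card = l.length := List.toFinset_card_of_nodup hn
      have hsub : l.toFinset ⊆ S := fun x hx => hS x (List.mem_toFinset.1 hx)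
      have hd : ∀ v, dg G S v = dg G l.toFinset v + dg G (S \ l.toFinset) v := by
        intro v
        unfold dg
        rw [← Finset.card_union_of_disjoint, ← Finset.filter_union]
        · congr 2
          exact (Finset.union_sdiff_of_subset hsub).symm
        · exact Finset.disjoint_filter_filter Finset.disjoint_sdiff
      have hout : dg G (S \ l.toFinset) a + dg G (S \ l.toFinset) b ≤ (S \ l.toFinset).card := by
        unfold dg
        rw [← Finset.card_union_of_disjoint]
        · apply Finset.card_le_card
          exact Finset.union_subset (Finset.filter_subset _ _) (Finset.filter_subset _ _)
        · rw [Finset.disjoint_left]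
          intro x hx hx'
          simp at hx hx'
          exact hz x hx.1.1 hx.1.2 hx.2.symm hx'.2.symm
      have hSc := Finset.card_sdiff_add_card_eq_card hsub
      have hgt : l.length < (l.toFinset.filter (fun y => G.Adj b y ∨ y = b)).card +
          (l.toFinset.filter (G.Adj a)).card := by
        have : (l.toFinset.filter (fun y => G.Adj b y ∨ y = b)).card = dg G l.toFinset b + 1 := by
          unfold dg
          rw [← Finset.card_insert_of_notMem (a := b) (s := l.toFinset.filter (G.Adj b)) (by simp)]
          congr 1
          ext x
          have := hp.last_mem
          simp only [Finset.mem_filter, List.mem_toFinset, Finset.mem_insert]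
          constructor
          · tauto
          · rintro (rfl | h)
            · exact ⟨this, Or.inr rfl⟩
            · exact ⟨h.1, Or.inl h.2⟩
        rw [this]
        have h1 := hd a
        have h2 := hd b
        unfold dg at *
        omega
      obtain ⟨j, hj, h1, h2⟩ := pigeon hn (fun y => G.Adj b y ∨ y = b) (G.Adj a) (by convert hgt) 1
      have hl0 : l[0]'(by omega) = a := by
        have := hp.2.1
        rw [List.head?_eq_getElem?, List.getElem?_eq_getElem (by omega)] at this
        simpa using this
      have hll : l[l.length - 1]'(by omega) = b := by
        have := hp.2.2
        rw [List.getLast?_eq_getElem?, List.getElem?_eq_getElem (by omega)] at this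
        simpa using this
      have hj' : j + 1 < l.length := by
        by_contra hcon
        have : (j + 1) % l.length = 0 := by
          rw [show j + 1 = l.length by omega]; simp
        simp only [this, hl0] at h2
        simp at h2
      simp only [Nat.mod_eq_of_lt hj'] at h2
      have hbj : G.Adj b l[j] := by
        rcases h1 with h1 | h1
        · exact h1
        · rw [← hll] at h1
          have := hn.getElem_inj_iff.1 h1
          omega
      have hp1 := hp.take hj
      have hp2 := hp.drop hj'
      have hp2' := hp2.reverse EE.symm
      have hvl : vl G l = vl G (l.take (j + 1)) + vl G (l.drop (j + 1)) +
          (if G.Adj l[j] l[j + 1] then 0 else 1) := by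
        rw [← vl_append hp1 hp2, List.take_append_drop]
      have hperm : List.Perm (l.take (j + 1) ++ (l.drop (j + 1)).reverse) l := by
        conv_rhs => rw [← List.take_append_drop (j + 1) l]
        exact List.Perm.append_left _ (List.reverse_perm _)
      obtain ⟨m, h1, h2, h3⟩ := IH (vl G (l.take (j + 1)) + vl G (l.drop (j + 1))) (by omega)
        (l.take (j + 1) ++ (l.drop (j + 1)).reverse) a l[j + 1]
        (by rw [hperm.length_eq]; exact h3) (hperm.nodup_iff.2 hn)
        (fun x hx => hS x (hperm.mem_iff.1 hx)) (hp1.append (Or.inl hbj.symm) hp2')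
        (Or.inl h2.symm) (by
          rw [vl_append hp1 hp2', vl_reverse EE.symm hp2]; simp [hbj.symm, h2.symm])
      exact ⟨m, h1, h2, fun x hx => h3 x (hperm.mem_iff.2 hx)⟩
  intro l a b h3 hn hS hp he hv
  by_cases hba : G.Adj b a
  · by_cases h0 : vl G l = 0
    · exact ⟨l, ⟨h3, hn, a, b, ⟨chain_of_vl h0, hp.2⟩, hba⟩, hS, fun x hx => hx⟩
    · obtain ⟨s, t, x, y, rfl, hxy⟩ := split_of_vl h0
      obtain ⟨c, d, hp1, hcd, hp2⟩ := hp.split (by simp) (by simp)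
      have := hp2.head_eq
      subst this
      have : x = c := by simpa using hp1.2.2
      subst this
      have hperm : List.Perm ((y :: t) ++ (s ++ [x])) ((s ++ [x]) ++ (y :: t)) :=
        List.perm_append_comm
      obtain ⟨m, h1, h2, h3⟩ := main ((y :: t) ++ (s ++ [x])) y x (by rw [hperm.length_eq]; exact h3)
        (hperm.nodup_iff.2 hn) (fun x hx => hS x (hperm.mem_iff.1 hx))
        (hp2.append he hp1) hcd hxy (by
          rw [vl_append hp2 hp1]
          rw [vl_append hp1 hp2] at hv
          simp only [hba, hxy, if_true, if_false] at hv ⊢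
          omega)
      exact ⟨m, h1, h2, fun x hx => h3 x (hperm.mem_iff.2 hx)⟩
  · exact main l a b h3 hn hS hp he hba (by simpa [hba] using hv)

theorem conv_cyc' {S : Finset V}
    (hO : ∀ x ∈ S, ∀ y ∈ S, x ∈ X → y ∈ X → x ≠ y → ¬ G.Adj x y → S.card ≤ dg G S x + dg G S y)
    {l : List V} (hl : Cyc (EE G X) l) (hS : ∀ x ∈ l, x ∈ S) :
      ∃ m, Cyc G.Adj m ∧ (∀ x ∈ m, x ∈ S) ∧ ∀ x ∈ l, x ∈ m := by
  obtain ⟨h1, h2, a, b, h3, h4⟩ := hl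
  exact conv_cyc hO _ l a b h1 h2 hS h3 h4 rfl

theorem TwoC.exists_nbr {S : Finset V} (h : TwoC G S) {x y : V} (hx : x ∈ S) (hxy : x ≠ y) :
    ∃ a ∈ S, a ≠ y ∧ G.Adj x a := by
  have hc : Conn G (S.erase y) := by
    by_cases hy : y ∈ S
    · exact h.2 y hy
    · rw [Finset.erase_eq_of_notMem hy]; exact h.conn
  obtain ⟨z, hz, hzxy⟩ : ∃ z ∈ S, z ∉ ({x, y} : Finset V) := by
    apply Finset.exists_mem_notMem_of_card_lt_card
    have := h.1
    have := Finset.card_le_two (a := x) (b := y)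
    omega
  simp at hzxy
  obtain ⟨p, hp, hpT, q, hq, hqA, hpq⟩ := hc.mono_edges (A := {x}) (a := x) (b := z) (by simp)
    (by simp [hx, hxy]) (by simp [hz, hzxy.2]) (by simp [hzxy.1])
  simp at hp hq
  subst hp
  exact ⟨q, hq.2, hq.1, hpq⟩

theorem exists_cyc_heavy {S : Finset V} (h : TwoC G S)
    (hO : ∀ x ∈ S, ∀ y ∈ S, x ∈ X → y ∈ X → x ≠ y → ¬ G.Adj x y → S.card ≤ dg G S x + dg G S y) :
    ∃ m, Cyc G.Adj m ∧ (∀ x ∈ m, x ∈ S) ∧ ∀ x ∈ S, x ∈ X → x ∈ m := by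
  suffices hE : ∃ m, Cyc (EE G X) m ∧ (∀ x ∈ m, x ∈ S) ∧ ∀ x ∈ S, x ∈ X → x ∈ m by
    obtain ⟨m, h1, h2, h3⟩ := hE
    obtain ⟨m', h4, h5, h6⟩ := conv_cyc' hO h1 h2
    exact ⟨m', h4, h5, fun x hx hX => h6 x (h3 x hx hX)⟩
  set H := S.filter (· ∈ X) with hH
  by_cases h3 : 3 ≤ H.card
  · refine ⟨H.toList, ⟨by simpa using h3, H.nodup_toList, ?_⟩, ?_, ?_⟩
    · have hpw : H.toList.Pairwise (EE G X) := by
        have := H.nodup_toList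
        refine List.Pairwise.imp_of_mem ?_ this
        intro a b ha hb hab
        simp [hH] at ha hb
        exact Or.inr ⟨hab, ha.2, hb.2⟩
      have hne : H.toList ≠ [] := by
        intro h0
        have : H.toList.length = 0 := by rw [h0]; rfl
        simp at this
        simp [this] at h3
      obtain ⟨a, b, hp⟩ := exists_pth_of_chain hpw.isChain hne
      refine ⟨a, b, hp, Or.inr ⟨?_, ?_, ?_⟩⟩
      · rintro rfl
        have hn := H.nodup_toList
        obtain ⟨m, hm⟩ := hp.exists_cons
        rw [hm] at hp hn
        have hm0 : m ≠ [] := by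
          rintro rfl
          have : H.toList.length = 1 := by rw [hm]; rfl
          simp only [Finset.length_toList] at this
          omega
        obtain ⟨d, _, hd⟩ := hp.tail hm0
        exact (List.nodup_cons.1 hn).1 hd.last_mem
      · have := hp.last_mem; simp [hH] at this; exact this.2
      · have := hp.head_mem; simp [hH] at this; exact this.2
    · intro x hx; simp [hH] at hx; exact hx.1
    · intro x hx hX; simp [hH, hx, hX]
  · have : ∃ x ∈ S, ∃ y ∈ S, EE G X x y ∧ ∀ z ∈ S, z ∈ X → z = x ∨ z = y := by
      by_cases h2 : H.card = 2
      · obtain ⟨x, y, hxy, hHe⟩ := Finset.card_eq_two.1 h2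
        have hx : x ∈ H := by simp [hHe]
        have hy : y ∈ H := by simp [hHe]
        have hz : ∀ z ∈ H, z = x ∨ z = y := by intro z hz; simpa [hHe] using hz
        simp [hH] at hx hy hz
        exact ⟨x, hx.1, y, hy.1, Or.inr ⟨hxy, hx.2, hy.2⟩, hz⟩
      · have h1 : H.card ≤ 1 := by omega
        have hx : ∃ x ∈ S, ∀ z ∈ S, z ∈ X → z = x := by
          by_cases hne : H.Nonempty
          · obtain ⟨x, hx⟩ := hne
            refine ⟨x, by simp [hH] at hx; exact hx.1, ?_⟩
            intro z hz hzX
            exact Finset.card_le_one.1 h1 z (by simp [hH, hz, hzX]) x hx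
          · obtain ⟨x, hx⟩ : S.Nonempty := Finset.card_pos.1 (by have := h.1; omega)
            refine ⟨x, hx, ?_⟩
            intro z hz hzX
            exact absurd ⟨z, by simp [hH, hz, hzX]⟩ hne
        obtain ⟨x, hx, hxz⟩ := hx
        obtain ⟨w, hw, hwx⟩ : ∃ w ∈ S, w ∉ ({x} : Finset V) := by
          apply Finset.exists_mem_notMem_of_card_lt_card
          have := h.1
          simp; omega
        simp at hwx
        obtain ⟨y, hy, _, hxy⟩ := h.exists_nbr hx (Ne.symm hwx)
        exact ⟨x, hx, y, hy, Or.inl hxy, fun z hz hX => Or.inl (hxz z hz hX)⟩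
    obtain ⟨x, hx, y, hy, hxy, hz⟩ := this
    have hne : x ≠ y := by
      rcases hxy with hxy | hxy
      · exact hxy.ne
      · exact hxy.1
    obtain ⟨a, ha, hay, hxa⟩ := h.exists_nbr hx hne
    obtain ⟨l, hl1, hl2, hl3⟩ := path_in (h.2 x hx) (a := a) (b := y)
      (by simp [ha, hxa.ne']) (by simp [hy, hne.symm])
    have hlx : ∀ z ∈ l, z ∈ S ∧ z ≠ x := by
      intro z hz; have := hl3 z hz; simp at this; tauto
    refine ⟨x :: l, Cyc.mk' (hl1.mono EE.of) ?_ ?_ (Or.inl hxa) (EE.symm _ _ hxy), ?_, ?_⟩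
    · rw [List.nodup_cons]; exact ⟨fun h => (hlx x h).2 rfl, hl2⟩
    · by_contra hcon
      obtain ⟨m, hm⟩ := hl1.exists_cons
      subst hm
      have : m = [] := by
        rcases m with _ | ⟨_, _⟩
        · rfl
        · simp at hcon
      subst this
      exact hay (by simpa using hl1.2.2)
    · intro z hz
      rcases List.mem_cons.1 hz with rfl | hz
      · exact hx
      · exact (hlx z hz).1
    · intro z hzS hzX
      rcases hz z hzS hzX with rfl | rfl
      · simp
      · exact List.mem_cons_of_mem _ hl1.last_mem
end HT
end Panc

namespace Panc
open scoped Classical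

section HT2
variable {V : Type} {G : SimpleGraph V} {X : Set V} {S : Finset V}

/-- Situation: a maximal cycle `u A v B` and an ear `I` from `u` to `v`. -/
structure Ctx (G : SimpleGraph V) (X : Set V) (S : Finset V) (u v : V) (A B I : List V) : Prop where
  cyc : Cyc G.Adj (u :: (A ++ v :: B))
  heavy : ∀ x ∈ S, x ∈ X → x ∈ u :: (A ++ v :: B)
  ins : ∀ (J l : List V) (a b : V), J ≠ [] → J.Nodup → (∀ x ∈ J, x ∈ S ∧ x ∉ u :: (A ++ v :: B)) →
    Pth (EE G X) a l b → EE G X b a → List.Perm l (J ++ (u :: (A ++ v :: B))) → False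
  pth : ∃ i j, G.Adj u i ∧ Pth G.Adj i I j ∧ G.Adj j v
  Inodup : I.Nodup
  Isub : ∀ x ∈ I, x ∈ S ∧ x ∉ u :: (A ++ v :: B)
  hI1 : ∀ I1 j' j, I = I1 ++ [j', j] → ¬ G.Adj v j'
  hI2 : ∀ I1 j' j, I = j :: j' :: I1 → ¬ G.Adj u j'

theorem Ctx.rot {u v : V} {A B I : List V} (h : Ctx G X S u v A B I) :
    Ctx G X S v u B A I.reverse := by
  have hp : List.Perm (v :: (B ++ u :: A)) (u :: (A ++ v :: B)) := by
    rw [List.perm_iff_count]; intro t; simp only [List.count_cons, List.count_append]; omega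
  refine ⟨?_, ?_, ?_, ?_, ?_, ?_, ?_, ?_⟩
  · have : Cyc G.Adj ((u :: A) ++ (v :: B)) := by simpa using h.cyc
    simpa using this.rot
  · intro x hx hX; rw [hp.mem_iff]; exact h.heavy x hx hX
  · intro J l a b h1 h2 h3 h4 h5 h6
    refine h.ins J l a b h1 h2 ?_ h4 h5 (h6.trans (List.Perm.append_left _ hp))
    intro x hx; rw [← hp.mem_iff]; exact h3 x hx
  · obtain ⟨i, j, h1, h2, h3⟩ := h.pth
    exact ⟨j, i, h3.symm, h2.reverse adj_symm', h1.symm⟩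
  · simpa using h.Inodup
  · intro x hx; rw [hp.mem_iff]; exact h.Isub x (by simpa using hx)
  · intro I1 j' j he
    exact h.hI2 I1.reverse j' j (by rw [← List.reverse_reverse I, he]; simp)
  · intro I1 j' j he
    exact h.hI1 I1.reverse j' j (by rw [← List.reverse_reverse I, he]; simp)

theorem Ctx.flip {u v : V} {A B I : List V} (h : Ctx G X S u v A B I) :
    Ctx G X S u v B.reverse A.reverse I := by
  have hp : List.Perm (u :: (B.reverse ++ v :: A.reverse)) (u :: (A ++ v :: B)) := by
    rw [List.perm_iff_count]; intro t
    simp only [List.count_cons, List.count_append, List.count_reverse]; omega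
  refine ⟨?_, ?_, ?_, ?_, h.Inodup, ?_, h.hI1, h.hI2⟩
  · have h1 := h.cyc.rev adj_symm'
    have : Cyc G.Adj ((B.reverse ++ v :: A.reverse) ++ [u]) := by simpa using h1
    simpa using this.rot
  · intro x hx hX; rw [hp.mem_iff]; exact h.heavy x hx hX
  · intro J l a b h1 h2 h3 h4 h5 h6
    refine h.ins J l a b h1 h2 ?_ h4 h5 (h6.trans (List.Perm.append_left _ hp))
    intro x hx; rw [← hp.mem_iff]; exact h3 x hx
  · exact h.pth
  · intro x hx; rw [hp.mem_iff]; exact h.Isub x hx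

theorem Ctx.B_ne {u v : V} {A B I : List V} (h : Ctx G X S u v A B I) : B ≠ [] := by
  rintro rfl
  obtain ⟨i, j, h1, h2, h3⟩ := h.pth
  obtain ⟨_, _, a, b, h5, h6⟩ := h.cyc
  have := h5.head_eq
  subst this
  have hb : v = b := by
    have h8 := h5.2.2
    rw [show u :: (A ++ [v]) = (u :: A) ++ [v] by simp, List.getLast?_concat] at h8
    simpa using h8
  subst hb
  have h7 := (h2.append h3 ((h5.reverse adj_symm'))).mono (B := EE G X) EE.of
  refine h.ins I _ i u h2.ne_nil h.Inodup h.Isub h7 (Or.inl h1) ?_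
  rw [List.perm_iff_count]; intro t
  simp only [List.count_cons, List.count_append, List.count_reverse]

theorem Ctx.A_ne {u v : V} {A B I : List V} (h : Ctx G X S u v A B I) : A ≠ [] := h.rot.B_ne

theorem Ctx.data {u v : V} {A B I : List V} (h : Ctx G X S u v A B I) :
    ∃ a a' b b', Pth G.Adj a A a' ∧ Pth G.Adj b B b' ∧ G.Adj u a ∧ G.Adj a' v ∧ G.Adj v b ∧
      G.Adj b' u := by
  obtain ⟨a, b', h1, h2, h3⟩ := h.cyc.open_head
  obtain ⟨a', v', h4, h5, h6⟩ := h1.split h.A_ne (by simp)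
  have := h6.head_eq
  subst this
  obtain ⟨b, h7, h8⟩ := h6.tail h.B_ne
  exact ⟨a, a', b, b', h4, h8, h2, h5, h7, h3⟩

theorem Ctx.nX {u v : V} {A B I : List V} (h : Ctx G X S u v A B I) {j : V} (hj : j ∈ I) : j ∉ X :=
  fun hX => (h.Isub j hj).2 (h.heavy j (h.Isub j hj).1 hX)

/-- claw at `u` -/
theorem Ctx.claw (hC : HC G X) {u v : V} {A B I : List V} (h : Ctx G X S u v A B I) {a a' b b' : V}
    (hA : Pth G.Adj a A a') (hB : Pth G.Adj b B b') (h1 : G.Adj u a) (h2 : G.Adj a' v)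
    (h3 : G.Adj v b) (h4 : G.Adj b' u) : EE G X a b' := by
  by_contra hcon
  obtain ⟨i, j, hi, hI, hj⟩ := h.pth
  have hiI := hI.head_mem
  have hiX := h.nX hiI
  have hA' := hA.mono (B := EE G X) EE.of
  have hB' := hB.mono (B := EE G X) EE.of
  have hisub : ∀ x ∈ [i], x ∈ S ∧ x ∉ u :: (A ++ v :: B) := by
    intro x hx; simp only [List.mem_singleton] at hx; subst hx; exact h.Isub x hiI
  have n1 : ¬ G.Adj i a := by
    intro hia
    refine h.ins [i] (u :: i :: (A ++ v :: B)) u b' (by simp) (by simp) hisub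
      (Pth.cons (Or.inl hi) (Pth.cons (Or.inl hia) (hA'.append (Or.inl h2) (Pth.cons (Or.inl h3) hB'))))
      (Or.inl h4) ?_
    exact List.Perm.swap _ _ _
  have n2 : ¬ G.Adj i b' := by
    intro hib
    exact h.ins [i] (i :: u :: (A ++ v :: B)) i b' (by simp) (by simp) hisub
      (Pth.cons (Or.inl hi.symm) (Pth.cons (Or.inl h1) (hA'.append (Or.inl h2) (Pth.cons (Or.inl h3) hB'))))
      (Or.inl hib.symm) (List.Perm.refl _)
  have hn := h.cyc.2.1
  have hab : a ≠ b' := by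
    rintro rfl
    simp only [List.nodup_cons, List.nodup_append, List.mem_cons, List.mem_append] at hn
    exact hn.2.2.2 a hA.head_mem a (Or.inr hB.last_mem) rfl
  have hiC := (h.Isub i hiI).2
  have hia : i ≠ a := by
    rintro rfl; apply hiC; simp [hA.head_mem]
  have hib : i ≠ b' := by
    rintro rfl; apply hiC; simp [hB.last_mem]
  have hnab : ¬ G.Adj a b' := fun h => hcon (Or.inl h)
  have c1 := hC u a i b' h1 hi h4.symm hia.symm hab hib (fun h => n1 h.symm) hnab n2
  have c2 := hC u b' i a h4.symm hi h1 hib.symm hab.symm hia (fun h => n2 h.symm)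
    (fun h => hnab h.symm) n1
  exact hcon (Or.inr ⟨hab, c1.resolve_right hiX, c2.resolve_right hiX⟩)

theorem first_fail {P : V → Prop} {l : List V} {a : V} (hne : l ≠ []) (hh : ∀ x ∈ l.head?, P x)
    (ha : a ∈ l) (hna : ¬ P a) :
    ∃ s w y t, l = (s ++ [w]) ++ (y :: t) ∧ (∀ x ∈ s ++ [w], P x) ∧ ¬ P y := by
  induction l with
  | nil => exact absurd rfl hne
  | cons x l ih =>
    have hx : P x := hh x (by simp)
    have hal : a ∈ l := by
      rcases List.mem_cons.1 ha with rfl | h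
      · exact absurd hx hna
      · exact h
    cases l with
    | nil => simp at hal
    | cons y l =>
      by_cases hy : P y
      · obtain ⟨s, w, y', t, h1, h2, h3⟩ := ih (by simp) (by simpa using hy) hal
        refine ⟨x :: s, w, y', t, by simp [h1], ?_, h3⟩
        intro z hz
        simp only [List.cons_append, List.mem_cons] at hz
        rcases hz with rfl | hz
        · exact hx
        · exact h2 z hz
      · exact ⟨[], x, y, l, by simp, by simpa using hx, hy⟩

/-- the three excluded (virtual) edges -/
theorem Ctx.excl (hC : HC G X) {u v : V} {A B I : List V} (h : Ctx G X S u v A B I) {a a' b b' : V}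
    (hA : Pth G.Adj a A a') (hB : Pth G.Adj b B b') (h1 : G.Adj u a) (h2 : G.Adj a' v)
    (h3 : G.Adj v b) (h4 : G.Adj b' u) : ¬ EE G X a b ∧ ¬ EE G X u a' ∧ ¬ EE G X u b := by
  have hab := h.claw hC hA hB h1 h2 h3 h4
  obtain ⟨i, j, hi, hI, hj⟩ := h.pth
  have hA' := hA.mono (B := EE G X) EE.of
  have hB' := hB.mono (B := EE G X) EE.of
  have hI' := hI.mono (B := EE G X) EE.of
  have hAr := hA'.reverse EE.symm
  have hBr := hB'.reverse EE.symm
  refine ⟨?_, ?_, ?_⟩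
  · intro he
    refine h.ins I (u :: (I ++ v :: (A.reverse ++ B))) u b' hI.ne_nil h.Inodup h.Isub
      (Pth.cons (Or.inl hi) (hI'.append (Or.inl hj) (Pth.cons (Or.inl h2.symm)
        (hAr.append he hB')))) (Or.inl h4) ?_
    rw [List.perm_iff_count]; intro t
    simp only [List.count_cons, List.count_append, List.count_reverse]; omega
  · intro he
    refine h.ins I (u :: (I ++ v :: (B ++ A))) u a' hI.ne_nil h.Inodup h.Isub
      (Pth.cons (Or.inl hi) (hI'.append (Or.inl hj) (Pth.cons (Or.inl h3)
        (hB'.append (EE.symm _ _ hab) hA')))) (EE.symm _ _ he) ?_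
    rw [List.perm_iff_count]; intro t
    simp only [List.count_cons, List.count_append, List.count_reverse]; omega
  · intro he
    refine h.ins I (u :: (I ++ v :: (A.reverse ++ B.reverse))) u b hI.ne_nil h.Inodup h.Isub
      (Pth.cons (Or.inl hi) (hI'.append (Or.inl hj) (Pth.cons (Or.inl h2.symm)
        (hAr.append hab hBr)))) (EE.symm _ _ he) ?_
    rw [List.perm_iff_count]; intro t
    simp only [List.count_cons, List.count_append, List.count_reverse]; omega

theorem Ctx.core1 (hC : HC G X) (hZ : HZ G X) {u v : V} {A B I : List V} (h : Ctx G X S u v A B I)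
    {a a' b b' : V}
    (hA : Pth G.Adj a A a') (hB : Pth G.Adj b B b') (h1 : G.Adj u a) (h2 : G.Adj a' v)
    (h3 : G.Adj v b) (h4 : G.Adj b' u) (hX : ¬ (a' ∈ X ∧ b ∈ X))
    (hor : 2 ≤ I.length ∨ ¬ G.Adj u v) : False := by
  have hab : G.Adj a' b := by
    have : EE G X b a' := h.rot.claw hC hB hA h3 h4 h1 h2
    rcases this with h | h
    · exact h.symm
    · exact absurd ⟨h.2.2, h.2.1⟩ hX
  obtain ⟨e1, e2, e3⟩ := h.excl hC hA hB h1 h2 h3 h4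
  obtain ⟨i, j, hi, hI, hj⟩ := h.pth
  have hA' := hA.mono (B := EE G X) EE.of
  have hB' := hB.mono (B := EE G X) EE.of
  have hjI := hI.last_mem
  have hjsub : ∀ x ∈ [j], x ∈ S ∧ x ∉ u :: (A ++ v :: B) := by
    intro x hx; simp only [List.mem_singleton] at hx; subst hx; exact h.Isub x hjI
  have n1 : ¬ G.Adj a' j := by
    intro he
    refine h.ins [j] (u :: (A ++ j :: v :: B)) u b' (by simp) (by simp) hjsub
      (Pth.cons (Or.inl h1) (hA'.append (Or.inl he) (Pth.cons (Or.inl hj) (Pth.cons (Or.inl h3) hB'))))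
      (Or.inl h4) ?_
    rw [List.perm_iff_count]; intro t
    simp only [List.count_cons, List.count_append, List.count_nil]; omega
  have n2 : ¬ G.Adj b j := by
    intro he
    refine h.ins [j] (u :: (A ++ v :: j :: B)) u b' (by simp) (by simp) hjsub
      (Pth.cons (Or.inl h1) (hA'.append (Or.inl h2) (Pth.cons (Or.inl hj.symm)
        (Pth.cons (Or.inl he.symm) hB')))) (Or.inl h4) ?_
    rw [List.perm_iff_count]; intro t
    simp only [List.count_cons, List.count_append, List.count_nil]; omega
  obtain ⟨j', hjj', m1, m2, m3⟩ : ∃ j', G.Adj j j' ∧ ¬ G.Adj a' j' ∧ ¬ G.Adj b j' ∧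
      ¬ G.Adj v j' := by
    obtain ⟨I0, hI0⟩ := hI.exists_concat
    rcases eq_or_ne I0 [] with rfl | hne
    · simp only [List.nil_append] at hI0
      subst hI0
      have : j = i := hI.head_eq
      subst this
      refine ⟨u, hi.symm, ?_, ?_, ?_⟩
      · exact fun he => e2 (Or.inl he.symm)
      · exact fun he => e3 (Or.inl he.symm)
      · intro he
        rcases hor with h | h
        · simp at h
        · exact h he.symm
    · rw [hI0] at hI
      obtain ⟨c, d, hc1, hc2, hc3⟩ := hI.split hne (by simp)
      have : j = d := hc3.head_eq
      subst this
      obtain ⟨I1, rfl⟩ := hc1.exists_concat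
      have hI1 : I = I1 ++ [c, j] := by rw [hI0]; simp
      have hnc : [c, j].Nodup := by
        have := h.Inodup; rw [hI1] at this; exact this.of_append_right
      have hsub : ∀ x ∈ [c, j], x ∈ S ∧ x ∉ u :: (A ++ v :: B) := by
        intro x hx; apply h.Isub; rw [hI1]; exact List.mem_append_right _ hx
      refine ⟨c, hc2.symm, ?_, ?_, h.hI1 _ _ _ hI1⟩
      · intro he
        refine h.ins [c, j] (u :: (A ++ c :: j :: v :: B)) u b' (by simp) hnc hsub
          (Pth.cons (Or.inl h1) (hA'.append (Or.inl he) (Pth.cons (Or.inl hc2)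
            (Pth.cons (Or.inl hj) (Pth.cons (Or.inl h3) hB'))))) (Or.inl h4) ?_
        rw [List.perm_iff_count]; intro t
        simp only [List.count_cons, List.count_append, List.count_nil]; omega
      · intro he
        refine h.ins [c, j] (u :: (A ++ v :: j :: c :: B)) u b' (by simp) hnc hsub
          (Pth.cons (Or.inl h1) (hA'.append (Or.inl h2) (Pth.cons (Or.inl hj.symm)
            (Pth.cons (Or.inl hc2.symm) (Pth.cons (Or.inl he.symm) hB'))))) (Or.inl h4) ?_
        rw [List.perm_iff_count]; intro t
        simp only [List.count_cons, List.count_append, List.count_nil]; omega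
  have hjX := h.nX hjI
  have z1 := hZ a' b v j j' hab h2 h3.symm hj.symm hjj' n1 n2 m1 m2 m3
  have z2 := hZ b a' v j j' hab.symm h3.symm h2 hj.symm hjj' n2 n1 m2 m1 m3
  exact hX ⟨z1.resolve_left hjX, z2.resolve_left hjX⟩

/-- appending a prefix of `A` consisting of neighbours of `u` -/
theorem app_prefix {A0 : List V} {a b' u w : V} (hA : Pth G.Adj a (A0 ++ [w]) w)
    (hn : ∀ x ∈ A0, G.Adj u x) (hab : EE G X b' a) (hbu : G.Adj b' u) {m : List V} {c : V}
    (hm : Pth (EE G X) c m b') : ∃ e, Pth (EE G X) c (m ++ A0) e ∧ EE G X e u := by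
  rcases eq_or_ne A0 [] with rfl | hne
  · exact ⟨b', by simpa using hm, Or.inl hbu⟩
  · obtain ⟨e, d, h1, h2, h3⟩ := hA.split hne (by simp)
    exact ⟨e, hm.append hab (h1.mono EE.of), Or.inl (hn e h1.last_mem).symm⟩

theorem Ctx.case2w (hC : HC G X) (hZ : HZ G X) {u v j : V} {A B : List V}
    (h : Ctx G X S u v A B [j]) {a a' b b' : V}
    (hA : Pth G.Adj a A a') (hB : Pth G.Adj b B b') (h1 : G.Adj u a) (h2 : G.Adj a' v)
    (h3 : G.Adj v b) (h4 : G.Adj b' u) (huv : G.Adj u v) :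
    ∃ A0 w y A2, A = (A0 ++ [w]) ++ (y :: A2) ∧ (∀ x ∈ A0 ++ [w], G.Adj u x) ∧ w ∈ X := by
  obtain ⟨e1, e2, e3⟩ := h.excl hC hA hB h1 h2 h3 h4
  have hab := h.claw hC hA hB h1 h2 h3 h4
  have hba : EE G X b a' := h.rot.claw hC hB hA h3 h4 h1 h2
  obtain ⟨i, j', hi, hI, hj⟩ := h.pth
  have : j = i := hI.head_eq
  subst this
  have : j = j' := by simpa using hI.2.2
  subst this
  have hB' := hB.mono (B := EE G X) EE.of
  have hjsub := h.Isub
  obtain ⟨A0, w, y, A2, rfl, hu, hy⟩ := first_fail (P := G.Adj u) hA.ne_nil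
    (by intro x hx; rw [hA.2.1] at hx; cases hx; exact h1) hA.last_mem (fun he => e2 (Or.inl he))
  refine ⟨A0, w, y, A2, rfl, hu, ?_⟩
  obtain ⟨w', y', p1, hwy, p2⟩ := hA.split (by simp) (by simp)
  have : w = w' := by simpa using p1.2.2
  subst this
  have : y = y' := p2.head_eq
  subst this
  have p2' := p2.mono (B := EE G X) EE.of
  have p1' := p1.mono (B := EE G X) EE.of
  have huw : G.Adj u w := hu w (by simp)
  have hu0 : ∀ x ∈ A0, G.Adj u x := fun x hx => hu x (by simp [hx])
  have hends : Pth (EE G X) y (y :: A2 ++ B) b' := p2'.append (EE.symm _ _ hba) hB'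
  have hends2 : Pth (EE G X) y (y :: A2 ++ v :: B) b' := p2'.append (Or.inl h2) (Pth.cons (Or.inl h3) hB')
  have n1 : ¬ G.Adj v w := by
    intro he
    obtain ⟨e, q1, q2⟩ := app_prefix p1 hu0 (EE.symm _ _ hab) h4 (Pth.cons (Or.inl hi)
      (Pth.cons (Or.inl hj) (Pth.cons (Or.inl he) (Pth.cons (Or.inl hwy) hends))))
    refine h.ins [j] _ _ _ (by simp) (by simp) hjsub q1 q2 ?_
    rw [List.perm_iff_count]; intro t
    simp only [List.count_cons, List.count_append, List.count_nil]; omega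
  have n2 : ¬ G.Adj v y := by
    intro he
    refine h.ins [j] _ _ _ (by simp) (by simp) hjsub (p1'.append (Or.inl huw.symm)
      (Pth.cons (Or.inl hi) (Pth.cons (Or.inl hj) (Pth.cons (Or.inl he) hends))))
      (EE.symm _ _ hab) ?_
    rw [List.perm_iff_count]; intro t
    simp only [List.count_cons, List.count_append, List.count_nil]; omega
  have n3 : ¬ G.Adj j w := by
    intro he
    obtain ⟨e, q1, q2⟩ := app_prefix p1 hu0 (EE.symm _ _ hab) h4 (Pth.cons (Or.inl hi)
      (Pth.cons (Or.inl he) (Pth.cons (Or.inl hwy) hends2)))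
    refine h.ins [j] _ _ _ (by simp) (by simp) hjsub q1 q2 ?_
    rw [List.perm_iff_count]; intro t
    simp only [List.count_cons, List.count_append, List.count_nil]; omega
  have n4 : ¬ G.Adj j y := by
    intro he
    refine h.ins [j] _ _ _ (by simp) (by simp) hjsub (p1'.append (Or.inl huw.symm)
      (Pth.cons (Or.inl hi) (Pth.cons (Or.inl he) hends2)))
      (EE.symm _ _ hab) ?_
    rw [List.perm_iff_count]; intro t
    simp only [List.count_cons, List.count_append, List.count_nil]; omega
  exact (hZ j v u w y hj hi.symm huv.symm huw hwy n3 n1 n4 n2 hy).resolve_right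
    (h.nX (by simp))

theorem Ctx.contra (hC : HC G X) (hZ : HZ G X) {u v : V} {A B I : List V}
    (h : Ctx G X S u v A B I) : False := by
  obtain ⟨a, a', b, b', hA, hB, h1, h2, h3, h4⟩ := h.data
  by_cases hor : 2 ≤ I.length ∨ ¬ G.Adj u v
  · by_cases hX : a' ∈ X ∧ b ∈ X
    · refine h.rot.core1 hC hZ hB hA h3 h4 h1 h2 ?_ ?_
      · rintro ⟨k1, k2⟩
        apply (h.excl hC hA hB h1 h2 h3 h4).1
        refine Or.inr ⟨?_, k2, hX.2⟩
        rintro rfl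
        have hn := h.cyc.2.1
        simp only [List.nodup_cons, List.nodup_append, List.mem_cons, List.mem_append] at hn
        exact hn.2.2.2 a hA.head_mem a (Or.inr hB.head_mem) rfl
      · rw [List.length_reverse, G.adj_comm]; exact hor
    · exact h.core1 hC hZ hA hB h1 h2 h3 h4 hX hor
  · push Not at hor
    obtain ⟨hl, huv⟩ := hor
    obtain ⟨j, rfl⟩ : ∃ j, I = [j] := by
      rw [← List.length_eq_one_iff]
      obtain ⟨i, j, _, hI, _⟩ := h.pth
      have := List.length_pos_iff.2 hI.ne_nil
      omega
    obtain ⟨A0, w, y, A2, rfl, hu, hwX⟩ := h.case2w hC hZ hA hB h1 h2 h3 h4 huv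
    obtain ⟨B0, z, y2, B2, rfl, hv, hzX⟩ := h.rot.case2w hC hZ hB hA h3 h4 h1 h2 huv.symm
    have hab := h.claw hC hA hB h1 h2 h3 h4
    have hba : EE G X b a' := h.rot.claw hC hB hA h3 h4 h1 h2
    obtain ⟨w', y', p1, hwy, p2⟩ := hA.split (by simp) (by simp)
    have : w = w' := by simpa using p1.2.2
    subst this
    have : y = y' := p2.head_eq
    subst this
    obtain ⟨z', y', r1, hzy, r2⟩ := hB.split (by simp) (by simp)
    have : z = z' := by simpa using r1.2.2
    subst this
    have : y2 = y' := r2.head_eq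
    subst this
    have p2' := (p2.mono (B := EE G X) EE.of).reverse EE.symm
    have r2' := r2.mono (B := EE G X) EE.of
    obtain ⟨i, j', hi, hI, hj⟩ := h.pth
    have : j = i := hI.head_eq
    subst this
    have : j = j' := by simpa using hI.2.2
    subst this
    have hwz : w ≠ z := by
      have := h.cyc.2.1
      rintro rfl
      simp only [List.nodup_cons, List.nodup_append, List.mem_cons, List.mem_append] at this
      exact this.2.2.2 w (by simp) w (by simp) rfl
    have start : ∃ m c, Pth (EE G X) u m c ∧ EE G X c a' ∧
        List.Perm m (u :: j :: v :: B0) := by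
      rcases eq_or_ne B0 [] with rfl | hne
      · exact ⟨[u, j, v], v, Pth.cons (Or.inl hi) (Pth.cons (Or.inl hj) (Pth.single v)),
          Or.inl h2.symm, List.Perm.refl _⟩
      · obtain ⟨e, d, s1, s2, s3⟩ := r1.split hne (by simp)
        refine ⟨u :: j :: v :: B0.reverse, b, Pth.cons (Or.inl hi) (Pth.cons (Or.inl hj)
          (Pth.cons (Or.inl (hv e (by simp [s1.last_mem]))) ((s1.mono EE.of).reverse EE.symm))), hba, ?_⟩
        rw [List.perm_iff_count]; intro t
        simp only [List.count_cons, List.count_reverse]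
    obtain ⟨m, c, t1, t2, t3⟩ := start
    obtain ⟨e, q1, q2⟩ := app_prefix p1 (fun x hx => hu x (by simp [hx])) (EE.symm _ _ hab) h4
      (t1.append t2 (p2'.append (Or.inl hwy.symm) (Pth.cons (Or.inr ⟨hwz, hwX, hzX⟩)
        (Pth.cons (Or.inl hzy) r2'))))
    refine h.ins [j] _ _ _ (by simp) (by simp) h.Isub q1 q2 ?_
    rw [List.perm_iff_count] at t3 ⊢; intro t
    have := t3 t
    simp only [List.count_cons, List.count_append, List.count_nil, List.count_reverse] at this ⊢
    omega

/-- Hamiltonicity -/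
theorem ham (hC : HC G X) (hZ : HZ G X) (h2 : TwoC G S)
    (hO : ∀ x ∈ S, ∀ y ∈ S, x ∈ X → y ∈ X → x ≠ y → ¬ G.Adj x y → S.card ≤ dg G S x + dg G S y) :
    Ham G S := by
  obtain ⟨m0, k1, k2, k3⟩ := exists_cyc_heavy h2 hO
  -- a longest cycle through all heavy vertices
  have hmax : ∃ C, (Cyc G.Adj C ∧ (∀ x ∈ C, x ∈ S) ∧ ∀ x ∈ S, x ∈ X → x ∈ C) ∧
      ∀ D, (Cyc G.Adj D ∧ (∀ x ∈ D, x ∈ S) ∧ ∀ x ∈ S, x ∈ X → x ∈ D) → D.length ≤ C.length := by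
    have hb : ∀ D : List V, (Cyc G.Adj D ∧ (∀ x ∈ D, x ∈ S) ∧ ∀ x ∈ S, x ∈ X → x ∈ D) →
        D.length ≤ S.card := by
      rintro D ⟨d1, d2, d3⟩
      rw [← d1.toFinset_card]
      exact Finset.card_le_card (fun x hx => d2 x (List.mem_toFinset.1 hx))
    let Q : ℕ → Prop := fun n => ∃ D : List V,
      (Cyc G.Adj D ∧ (∀ x ∈ D, x ∈ S) ∧ ∀ x ∈ S, x ∈ X → x ∈ D) ∧ D.length = n
    have hQ : Q m0.length := ⟨m0, ⟨k1, k2, k3⟩, rfl⟩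
    obtain ⟨C, hC1, hC2⟩ := Nat.findGreatest_spec (P := Q) (hb m0 ⟨k1, k2, k3⟩) hQ
    refine ⟨C, hC1, fun D hD => ?_⟩
    rw [hC2]
    exact Nat.le_findGreatest (hb D hD) ⟨D, hD, rfl⟩
  obtain ⟨C, ⟨c1, c2, c3⟩, hmax⟩ := hmax
  refine ⟨C, c1, ?_⟩
  by_contra hne
  have hsub : C.toFinset ⊆ S := fun x hx => c2 x (List.mem_toFinset.1 hx)
  have hins : ∀ (J l : List V) (a b : V), J ≠ [] → J.Nodup → (∀ x ∈ J, x ∈ S ∧ x ∉ C) →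
      Pth (EE G X) a l b → EE G X b a → List.Perm l (J ++ C) → False := by
    intro J l a b j1 j2 j3 j4 j5 j6
    have hl : Cyc (EE G X) l := by
      refine ⟨?_, ?_, a, b, j4, j5⟩
      · rw [j6.length_eq]; have := c1.1; simp; omega
      · rw [j6.nodup_iff, List.nodup_append]
        exact ⟨j2, c1.2.1, fun x hx y hy hxy => (j3 x hx).2 (hxy ▸ hy)⟩
    obtain ⟨D, d1, d2, d3⟩ := conv_cyc' hO hl (by
      intro x hx; rw [j6.mem_iff, List.mem_append] at hx
      rcases hx with hx | hx
      · exact (j3 x hx).1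
      · exact c2 x hx)
    have h3 := hmax D ⟨d1, d2, fun x hx hX => d3 x (by
      rw [j6.mem_iff, List.mem_append]; exact Or.inr (c3 x hx hX))⟩
    have h4 : l.toFinset ⊆ D.toFinset := by
      intro x hx; simp at hx ⊢; exact d3 x hx
    have h5 := Finset.card_le_card h4
    rw [hl.toFinset_card, d1.toFinset_card, j6.length_eq, List.length_append] at h5
    have := List.length_pos_iff.2 j1
    omega
  -- an ear exists
  obtain ⟨r0, hr0, hr0C⟩ : ∃ r ∈ S, r ∉ C := by
    by_contra hcon
    push Not at hcon
    exact hne (Finset.Subset.antisymm hsub (fun x hx => List.mem_toFinset.2 (hcon x hx)))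
  obtain ⟨w0, hw0⟩ : ∃ w, w ∈ C := by
    have := c1.1
    cases C with
    | nil => simp at this
    | cons x C => exact ⟨x, by simp⟩
  obtain ⟨u1, hu1, _, r1, hr1, hr1C, hur⟩ := h2.conn.mono_edges (A := C.toFinset) (a := w0) (b := r0)
    (by simpa using hw0) (c2 _ hw0) hr0 (by simpa using hr0C)
  rw [List.mem_toFinset] at hu1 hr1C
  let Ear : List V → Prop := fun I => ∃ u v, u ∈ C ∧ v ∈ C ∧ u ≠ v ∧ I.Nodup ∧
    (∀ x ∈ I, x ∈ S ∧ x ∉ C) ∧ ∃ i j, G.Adj u i ∧ Pth G.Adj i I j ∧ G.Adj j v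
  have hear : ∃ I, Ear I := by
    let R := (S \ C.toFinset).filter (fun r => ∃ I, Pth G.Adj r1 I r ∧ I.Nodup ∧
      ∀ x ∈ I, x ∈ S ∧ x ∉ C)
    have hr1R : r1 ∈ R := by
      simp only [R, Finset.mem_filter, Finset.mem_sdiff, List.mem_toFinset]
      exact ⟨⟨hr1, hr1C⟩, [r1], Pth.single r1, by simp, by simp [hr1, hr1C]⟩
    obtain ⟨u2, hu2, hu2ne⟩ : ∃ u2 ∈ C, u2 ≠ u1 := by
      by_contra hcon
      push Not at hcon
      have : C.toFinset ⊆ {u1} := by intro x hx; simp at hx ⊢; exact hcon x hx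
      have h5 := Finset.card_le_card this
      rw [c1.toFinset_card] at h5
      have := c1.1
      simp at h5; omega
    obtain ⟨p, hp, _, q, hq, hqR, hpq⟩ := (h2.2 u1 (c2 _ hu1)).mono_edges (A := R) (a := r1) (b := u2)
      hr1R (by simp only [Finset.mem_erase]; exact ⟨fun h => hr1C (h ▸ hu1), hr1⟩)
      (by simp [hu2ne, c2 _ hu2]) (by simp [R, hu2])
    simp only [R, Finset.mem_filter, Finset.mem_sdiff, List.mem_toFinset] at hp
    obtain ⟨-, I, i1, i2, i3⟩ := hp
    simp only [Finset.mem_erase] at hq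
    have hqC : q ∈ C := by
      by_contra hqC
      apply hqR
      simp only [R, Finset.mem_filter, Finset.mem_sdiff, List.mem_toFinset]
      refine ⟨⟨hq.2, hqC⟩, ?_⟩
      have hcn := i1.conn.union (conn_singleton q) (x := p) (y := q) (by simp [i1.last_mem]) (by simp) hpq
      obtain ⟨l, l1, l2, l3⟩ := path_in hcn (a := r1) (b := q) (by simp [i1.head_mem]) (by simp)
      refine ⟨l, l1, l2, ?_⟩
      intro x hx
      have := l3 x hx
      simp at this
      rcases this with rfl | h
      · exact ⟨hq.2, hqC⟩
      · exact i3 x h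
    exact ⟨I, u1, q, hu1, hqC, hq.1.symm, i2, i3, r1, p, hur, i1, hpq⟩
  have hmin : ∃ I, Ear I ∧ ∀ I', Ear I' → I.length ≤ I'.length := by
    obtain ⟨I, hI⟩ := hear
    have hQ : ∃ n, ∃ I, Ear I ∧ I.length = n := ⟨_, I, hI, rfl⟩
    obtain ⟨I', h1, h2⟩ := Nat.find_spec hQ
    refine ⟨I', h1, fun I'' h3 => ?_⟩
    rw [h2]
    exact Nat.find_min' hQ ⟨I'', h3, rfl⟩
  obtain ⟨I, ⟨u, v, hu, hv, huv, i1, i2, i, j, i3, i4, i5⟩, hmin⟩ := hmin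
  obtain ⟨D, d1, d2⟩ := c1.rotate_to hu
  have hvD : v ∈ D := by
    have : v ∈ u :: D := d2.mem_iff.2 hv
    rcases List.mem_cons.1 this with h | h
    · exact absurd h.symm huv
    · exact h
  obtain ⟨A, B, rfl⟩ := List.append_of_mem hvD
  have hctx : Ctx G X S u v A B I := by
    refine ⟨d1, ?_, ?_, ⟨i, j, i3, i4, i5⟩, i1, ?_, ?_, ?_⟩
    · intro x hx hX; rw [d2.mem_iff]; exact c3 x hx hX
    · intro J l a b j1 j2 j3 j4 j5 j6
      refine hins J l a b j1 j2 ?_ j4 j5 (j6.trans (List.Perm.append_left _ d2))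
      intro x hx; rw [← d2.mem_iff]; exact j3 x hx
    · intro x hx; rw [d2.mem_iff]; exact i2 x hx
    · intro I1 j' jj he hadj
      have he' : I = (I1 ++ [j']) ++ [jj] := by simp [he]
      rw [he'] at i4
      obtain ⟨c, d, s1, s2, s3⟩ := i4.split (by simp) (by simp)
      have : j' = c := by simpa using s1.2.2
      subst this
      have := hmin (I1 ++ [j']) ⟨u, v, hu, hv, huv, ?_, ?_, i, j', i3, s1, hadj.symm⟩
      · rw [he] at this; simp at this
      · rw [he'] at i1; exact i1.of_append_left
      · intro x hx; apply i2; rw [he']; exact List.mem_append_left _ hx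
    · intro I1 j' jj he hadj
      rw [he] at i4
      obtain ⟨d, s2, s3⟩ := i4.tail (by simp)
      have : j' = d := s3.head_eq
      subst this
      have := hmin (j' :: I1) ⟨u, v, hu, hv, huv, ?_, ?_, j', j, hadj, s3, i5⟩
      · rw [he] at this; simp at this
      · rw [he] at i1; exact i1.of_cons
      · intro x hx; apply i2; rw [he]; exact List.mem_cons_of_mem _ hx
  exact hctx.contra hC hZ
end HT2
end Panc

namespace Panc
open scoped Classical

section Ind
variable {V : Type} {G : SimpleGraph V}

theorem modne {m i a b : ℕ} (h : a < b) (h' : b < a + m) : (i + a) % m ≠ (i + b) % m := by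
  intro he
  have h1 : a ≡ b [MOD m] := Nat.ModEq.add_left_cancel' i he
  have h2 := (Nat.modEq_iff_dvd' h.le).1 h1
  have := Nat.le_of_dvd (by omega) h2
  omega

theorem indcyc (hC : HC G ∅) (hZ : HZ G ∅) {cc : List V} (hc : Cyc G.Adj cc) {w : V} (hw : w ∉ cc)
    (hind : ∀ v ∈ cc, dg G cc.toFinset v ≤ 2) (hwv : ∃ v ∈ cc, G.Adj w v) {k : ℕ} (hk : 3 ≤ k)
    (hk' : k ≤ cc.length) : HasCyc G (insert w cc.toFinset) k := by
  obtain ⟨h3, hn, a, b, hp, hba⟩ := id hc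
  set m := cc.length with hm
  have hmp : 0 < m := by omega
  let cv : ℕ → V := fun i => cc[i % m]'(Nat.mod_lt _ hmp)
  have hcvmem : ∀ i, cv i ∈ cc := fun i => List.getElem_mem _
  have hinj : ∀ i j, cv i = cv j → i % m = j % m := by
    intro i j h; exact hn.getElem_inj_iff.1 h
  have hcong : ∀ i j, i % m = j % m → cv i = cv j := by
    intro i j h; simp only [cv, h]
  have hl0 : cc[0]'(by omega) = a := by
    have := hp.2.1
    rw [List.head?_eq_getElem?, List.getElem?_eq_getElem (by omega)] at this
    simpa using this
  have hll : cc[cc.length - 1]'(by omega) = b := by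
    have := hp.2.2
    rw [List.getLast?_eq_getElem?, List.getElem?_eq_getElem (by omega)] at this
    simpa using this
  have hadj : ∀ i, G.Adj (cv i) (cv (i + 1)) := by
    intro i
    have hi : i % m < m := Nat.mod_lt _ hmp
    by_cases hlt : i % m + 1 < m
    · have h1 := (List.isChain_iff_getElem.1 hp.1) (i % m) hlt
      have : (i + 1) % m = i % m + 1 := by
        rw [Nat.add_mod, Nat.mod_eq_of_lt (a := 1) (by omega), Nat.mod_eq_of_lt hlt]
      simp only [cv, this]
      exact h1
    · have h1 : i % m = cc.length - 1 := by omega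
      have h2 : (i + 1) % m = 0 := by
        rw [Nat.add_mod, Nat.mod_eq_of_lt (a := 1) (by omega), show i % m + 1 = m by omega]; simp
      simp only [cv, h1, h2, hl0, hll]
      exact hba
  have hper : ∀ i, cv (i + m) = cv i := fun i => hcong _ _ (by simp)
  -- adjacency only along the cycle
  have hnon : ∀ i j, G.Adj (cv (i + 1)) (cv j) → (j % m = i % m ∨ j % m = (i + 2) % m) := by
    intro i j hij
    by_contra hcon
    push Not at hcon
    have hs : ({cv i, cv (i + 2), cv j} : Finset V) ⊆ cc.toFinset.filter (G.Adj (cv (i + 1))) := by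
      intro x hx
      simp only [Finset.mem_insert, Finset.mem_singleton] at hx
      simp only [Finset.mem_filter, List.mem_toFinset]
      rcases hx with rfl | rfl | rfl
      · exact ⟨hcvmem _, (hadj i).symm⟩
      · exact ⟨hcvmem _, hadj (i + 1)⟩
      · exact ⟨hcvmem _, hij⟩
    have h1 := Finset.card_le_card hs
    have h2 := hind (cv (i + 1)) (hcvmem _)
    have h3 : ({cv i, cv (i + 2), cv j} : Finset V).card = 3 := by
      rw [Finset.card_eq_three]
      refine ⟨_, _, _, ?_, ?_, ?_, rfl⟩
      · intro h; exact modne (m := m) (i := i) (a := 0) (b := 2) (by omega) (by omega) (hinj _ _ h)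
      · intro h; exact hcon.1 (hinj _ _ h).symm
      · intro h; exact hcon.2 (hinj _ _ h).symm
    unfold dg at h2
    omega
  by_cases hkm : k = m
  · exact ⟨cc, hc, fun x hx => by simp [hx], hkm ▸ rfl⟩
  have hm4 : 4 ≤ m := by omega
  have hwne : ∀ i, w ≠ cv i := fun i h => hw (h ▸ hcvmem i)
  have hne2 : ∀ i, cv i ≠ cv (i + 2) := fun i h =>
    modne (m := m) (i := i) (a := 0) (b := 2) (by omega) (by omega) (hinj _ _ h)
  have hna2 : ∀ i, ¬ G.Adj (cv i) (cv (i + 2)) := by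
    intro i h
    have h1 := hcong (i + m) ((i + m - 1) + 1) (by congr 1; omega)
    rw [hper] at h1
    rw [h1] at h
    have e : (i + m - 1) = i + (m - 1) := by omega
    have e2 : (i + m - 1 + 2) = i + (m + 1) := by omega
    rcases hnon _ _ h with h | h
    · rw [e] at h; exact modne (by omega) (by omega) h
    · rw [e2] at h; exact modne (by omega) (by omega) h
  have hclaw : ∀ i, G.Adj w (cv (i + 1)) → ¬ G.Adj w (cv i) → G.Adj w (cv (i + 2)) := by
    intro i h1 h2
    by_contra h3
    have := hC (cv (i + 1)) w (cv i) (cv (i + 2)) h1.symm (hadj i).symm (hadj (i + 1)) (hwne _) (hwne _)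
      (hne2 i) h2 h3 (hna2 i)
    simp at this
  obtain ⟨i0, hb0, hb1⟩ : ∃ i0, G.Adj w (cv i0) ∧ G.Adj w (cv (i0 + 1)) := by
    obtain ⟨v, hv, hwv⟩ := hwv
    obtain ⟨i, hi, rfl⟩ := List.getElem_of_mem hv
    have hcv : cc[i] = cv ((i + m - 1) + 1) := by
      simp only [cv]
      congr 1
      rw [show i + m - 1 + 1 = i + m by omega, Nat.add_mod_right, Nat.mod_eq_of_lt hi]
    rw [hcv] at hwv
    by_cases h : G.Adj w (cv (i + m - 1))
    · exact ⟨_, h, hwv⟩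
    · exact ⟨_, hwv, hclaw _ hwv h⟩
  rcases Nat.lt_or_ge m 5 with h5 | h5
  · have : k = 3 := by omega
    subst this
    refine ⟨[w, cv i0, cv (i0 + 1)], Cyc.mk' (Pth.cons (hadj i0) (Pth.single _)) ?_ (by simp) hb0
      hb1.symm, ?_, by simp⟩
    · simp [hwne, (hadj i0).ne]
    · simp [hcvmem]
  have hna3 : ∀ i, ¬ G.Adj (cv i) (cv (i + 3)) := by
    intro i h
    have h1 := hcong (i + m) ((i + m - 1) + 1) (by congr 1; omega)
    rw [hper] at h1
    rw [h1] at h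
    have e : (i + m - 1) = i + (m - 1) := by omega
    have e2 : (i + m - 1 + 2) = i + (m + 1) := by omega
    rcases hnon _ _ h with h | h
    · rw [e] at h; exact modne (by omega) (by omega) h
    · rw [e2] at h; exact modne (by omega) (by omega) h
  have hz : ∀ i, G.Adj w (cv i) → G.Adj w (cv (i + 1)) → ¬ G.Adj w (cv (i + 2)) →
      G.Adj w (cv (i + 3)) := by
    intro i h1 h2 h3
    by_contra h4
    have := hZ (cv i) w (cv (i + 1)) (cv (i + 2)) (cv (i + 3)) h1.symm (hadj i) h2 (hadj (i + 1))
      (hadj (i + 2)) (hna2 i) h3 (hna3 i) h4 (hna2 (i + 1))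
    simp at this
  have hinv : ∀ t, (G.Adj w (cv (i0 + t)) ∧ G.Adj w (cv (i0 + t + 1))) ∨
      (G.Adj w (cv (i0 + t)) ∧ ¬ G.Adj w (cv (i0 + t + 1)) ∧ G.Adj w (cv (i0 + t + 2))) ∨
      (¬ G.Adj w (cv (i0 + t)) ∧ G.Adj w (cv (i0 + t + 1)) ∧ G.Adj w (cv (i0 + t + 2))) := by
    intro t
    induction t with
    | zero => exact Or.inl ⟨hb0, hb1⟩
    | succ t ih =>
      rw [show i0 + (t + 1) = i0 + t + 1 by omega, show i0 + t + 1 + 1 = i0 + t + 2 by omega,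
        show i0 + t + 1 + 2 = i0 + t + 3 by omega]
      have h1 := hclaw (i0 + t + 1)
      have h2 := hz (i0 + t)
      rw [show i0 + t + 1 + 1 = i0 + t + 2 by omega, show i0 + t + 1 + 2 = i0 + t + 3 by omega] at h1
      tauto
  have hiso : ∀ i, G.Adj w (cv i) ∨ G.Adj w (cv (i + 1)) := by
    intro i
    have e1 : cv (i0 + (i + (m * i0 - i0))) = cv i := by
      apply hcong
      have : i0 ≤ m * i0 := Nat.le_mul_of_pos_left _ hmp
      rw [show i0 + (i + (m * i0 - i0)) = i + m * i0 by omega]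
      simp
    have e2 : cv (i0 + (i + (m * i0 - i0)) + 1) = cv (i + 1) := by
      apply hcong
      have : i0 ≤ m * i0 := Nat.le_mul_of_pos_left _ hmp
      rw [show i0 + (i + (m * i0 - i0)) + 1 = i + 1 + m * i0 by omega]
      simp
    have := hinv (i + (m * i0 - i0))
    rw [e1, e2] at this
    tauto
  refine ml hc hw ?_ hk (by omega)
  by_contra hle
  have hpart : dg G cc.toFinset w + (cc.toFinset.filter (fun v => ¬ G.Adj w v)).card = m := by
    unfold dg
    rw [Finset.card_filter_add_card_filter_not, hc.toFinset_card]
  have hP : (cc.toFinset.filter (fun v => ¬ G.Adj w v ∨ v = cv i0)).card =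
      (cc.toFinset.filter (fun v => ¬ G.Adj w v)).card + 1 := by
    rw [← Finset.card_insert_of_notMem (a := cv i0) (s := cc.toFinset.filter (fun v => ¬ G.Adj w v))
      (by simp [hb0])]
    congr 1
    ext x
    have := hcvmem i0
    simp only [Finset.mem_filter, Finset.mem_insert, List.mem_toFinset]
    constructor
    · tauto
    · rintro (rfl | h)
      · exact ⟨this, Or.inr rfl⟩
      · exact ⟨h.1, Or.inl h.2⟩
  obtain ⟨j, hj, j1, j2⟩ := pigeon hn (fun v => ¬ G.Adj w v ∨ v = cv i0) (fun v => ¬ G.Adj w v)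
    (by
      have e1 : (Finset.filter (fun v => ¬ G.Adj w v ∨ v = cv i0) cc.toFinset).card +
          (Finset.filter (fun v => ¬ G.Adj w v) cc.toFinset).card > m := by omega
      convert e1) 1
  have ej : cc[j] = cv j := by simp only [cv]; congr 1; exact (Nat.mod_eq_of_lt hj).symm
  have ej2 : cc[(j + 1) % cc.length]'(Nat.mod_lt _ (by omega)) = cv (j + 1) := rfl
  rw [ej] at j1
  rw [ej2] at j2
  rcases j1 with j1 | j1
  · rcases hiso j with h | h
    · exact j1 h
    · exact j2 h
  · have h1 := hinj _ _ j1
    have h2 : cv (j + 1) = cv (i0 + 1) := hcong _ _ (by rw [Nat.add_mod, h1, ← Nat.add_mod])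
    exact j2 (h2 ▸ hb1)
end Ind
end Panc

namespace Panc
open scoped Classical

section Config
variable {V : Type} {G : SimpleGraph V} {X : Set V} {S : Finset V}

/-- a hamilton cycle `u P x Q` of `S` without edges between `P` and `Q` -/
structure Cfg (G : SimpleGraph V) (S : Finset V) (u : V) (P : List V) (x : V) (Q : List V)
    (p1 pl qh q1 : V) : Prop where
  hP : Pth G.Adj p1 P pl
  hQ : Pth G.Adj qh Q q1
  up : G.Adj u p1
  uq : G.Adj u q1
  px : G.Adj pl x
  xq : G.Adj x qh
  nd : (u :: (P ++ x :: Q)).Nodup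
  hS : (u :: (P ++ x :: Q)).toFinset = S
  no : ∀ y ∈ P, ∀ z ∈ Q, ¬ G.Adj y z

variable {u x p1 pl qh q1 : V} {P Q : List V}

theorem Cfg.flip (h : Cfg G S u P x Q p1 pl qh q1) :
    Cfg G S u Q.reverse x P.reverse q1 qh pl p1 := by
  have hp : List.Perm (u :: (Q.reverse ++ x :: P.reverse)) (u :: (P ++ x :: Q)) := by
    rw [List.perm_iff_count]; intro t
    simp only [List.count_cons, List.count_append, List.count_reverse]; omega
  refine ⟨h.hQ.reverse adj_symm', h.hP.reverse adj_symm', h.uq, h.up, h.xq.symm, h.px.symm,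
    hp.nodup_iff.2 h.nd, by rw [List.toFinset_eq_of_perm _ _ hp, h.hS], ?_⟩
  intro y hy z hz hyz
  exact h.no z (by simpa using hz) y (by simpa using hy) hyz.symm

theorem Cfg.swap (h : Cfg G S u P x Q p1 pl qh q1) : Cfg G S x Q u P qh q1 p1 pl := by
  have hp : List.Perm (x :: (Q ++ u :: P)) (u :: (P ++ x :: Q)) := by
    rw [List.perm_iff_count]; intro t
    simp only [List.count_cons, List.count_append]; omega
  refine ⟨h.hQ, h.hP, h.xq, h.px.symm, h.uq.symm, h.up,
    hp.nodup_iff.2 h.nd, by rw [List.toFinset_eq_of_perm _ _ hp, h.hS], ?_⟩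
  intro y hy z hz hyz
  exact h.no z hz y hy hyz.symm

theorem Cfg.cyc (h : Cfg G S u P x Q p1 pl qh q1) : Cyc G.Adj (u :: (P ++ x :: Q)) := by
  have h1 := List.length_pos_iff.2 h.hP.ne_nil
  refine Cyc.mk' (h.hP.append h.px (Pth.cons h.xq h.hQ)) h.nd (by simp; omega) h.up h.uq.symm

theorem mk_cfg (h : Cyc G.Adj (u :: (P ++ x :: Q))) (hS : (u :: (P ++ x :: Q)).toFinset = S)
    (hP : P ≠ []) (hQ : Q ≠ []) (no : ∀ y ∈ P, ∀ z ∈ Q, ¬ G.Adj y z) :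
    ∃ p1 pl qh q1, Cfg G S u P x Q p1 pl qh q1 := by
  obtain ⟨a, b, h1, h2, h3⟩ := h.open_head
  obtain ⟨c, d, h4, h5, h6⟩ := h1.split hP (by simp)
  have := h6.head_eq
  subst this
  obtain ⟨e, h7, h8⟩ := h6.tail hQ
  exact ⟨a, c, e, b, h4, h8, h2, h3.symm, h5, h7, h.2.1, hS, no⟩

theorem Cfg.card (h : Cfg G S u P x Q p1 pl qh q1) : S.card = P.length + Q.length + 2 := by
  rw [← h.hS, List.toFinset_card_of_nodup h.nd]; simp; omega

theorem Cfg.mem (h : Cfg G S u P x Q p1 pl qh q1) {v : V} :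
    v ∈ S ↔ v = u ∨ v ∈ P ∨ v = x ∨ v ∈ Q := by
  rw [← h.hS]; simp; tauto

theorem Cfg.uP (h : Cfg G S u P x Q p1 pl qh q1) : u ∉ P := fun hu => by
  have := h.nd; simp [hu] at this
theorem Cfg.uQ (h : Cfg G S u P x Q p1 pl qh q1) : u ∉ Q := fun hu => by
  have := h.nd; simp [hu] at this
theorem Cfg.ux (h : Cfg G S u P x Q p1 pl qh q1) : u ≠ x := fun hu => by
  have := h.nd; simp [hu] at this
theorem Cfg.xP (h : Cfg G S u P x Q p1 pl qh q1) : x ∉ P := fun hu => by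
  have := h.nd; simp [List.nodup_append] at this; exact (this.2.2.2 x hu).1 rfl
theorem Cfg.xQ (h : Cfg G S u P x Q p1 pl qh q1) : x ∉ Q := fun hu => by
  have := h.nd; simp [List.nodup_append, hu] at this
theorem Cfg.PQ (h : Cfg G S u P x Q p1 pl qh q1) {y z : V} (hy : y ∈ P) (hz : z ∈ Q) : y ≠ z := by
  rintro rfl
  have := h.nd
  simp only [List.nodup_cons, List.nodup_append, List.mem_cons] at this
  exact this.2.2.2 _ hy _ (Or.inr hz) rfl
theorem Cfg.ndP (h : Cfg G S u P x Q p1 pl qh q1) : P.Nodup := by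
  have := h.nd
  simp only [List.nodup_cons, List.nodup_append] at this
  exact this.2.1
theorem Cfg.ndQ (h : Cfg G S u P x Q p1 pl qh q1) : Q.Nodup := by
  have := h.nd
  simp only [List.nodup_cons, List.nodup_append] at this
  exact this.2.2.1.2

theorem Cfg.F2 (h : Cfg G S u P x Q p1 pl qh q1) (hC : HC G X) (hq : q1 ∉ X) {y y' : V}
    (hy : y ∈ P) (hy' : y' ∈ P) (hne : y ≠ y') (uy : G.Adj u y) (uy' : G.Adj u y')
    (hn : ¬ G.Adj y y') : y ∈ X := by
  have hq1 := h.hQ.last_mem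
  have := hC u y q1 y' uy h.uq uy' (h.PQ hy hq1) hne (h.PQ hy' hq1).symm (h.no _ hy _ hq1) hn
    (fun e => h.no _ hy' _ hq1 e.symm)
  tauto

theorem Cfg.F2p (h : Cfg G S u P x Q p1 pl qh q1) (hC : HC G X) (hp : p1 ∉ X) (hq : q1 ∉ X) {y : V}
    (hy : y ∈ P) (hne : p1 ≠ y) (uy : G.Adj u y) : G.Adj p1 y := by
  by_contra hn
  exact hp (h.F2 hC hq h.hP.head_mem hy hne h.up uy hn)

theorem Cfg.F3 (h : Cfg G S u P x Q p1 pl qh q1) (hC : HC G X) (hZ : HZ G X) (hp : p1 ∉ X)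
    (hq : q1 ∉ X) {t : V} (ht : t ∈ Q) (htq : t ≠ q1) (ut : G.Adj u t) {y z : V} (hy : y ∈ P)
    (hz : z ∈ P) (uy : G.Adj u y) (yz : G.Adj y z) (uz : ¬ G.Adj u z) : y ∈ X := by
  have hq1 := h.hQ.last_mem
  have h1 : G.Adj q1 t := h.flip.F2p hC hq hp (by simpa using ht) htq.symm ut
  have := hZ q1 t u y z h1 h.uq.symm ut.symm uy yz (fun e => h.no _ hy _ hq1 e.symm)
    (fun e => h.no _ hy _ ht e.symm) (fun e => h.no _ hz _ hq1 e.symm)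
    (fun e => h.no _ hz _ ht e.symm) uz
  tauto

theorem Cfg.bdry (h : Cfg G S u P x Q p1 pl qh q1) (hn : ¬ ∀ y ∈ P, G.Adj u y) :
    ∃ y ∈ P, ∃ z ∈ P, G.Adj u y ∧ G.Adj y z ∧ ¬ G.Adj u z := by
  push Not at hn
  obtain ⟨a, ha, hna⟩ := hn
  obtain ⟨s, w, y, t, e, h1, h2⟩ := first_fail (P := fun v => G.Adj u v) h.hP.ne_nil
    (by intro v hv; rw [h.hP.2.1] at hv; simp at hv; rw [← hv]; exact h.up) ha hna
  have hp := h.hP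
  rw [e] at hp
  obtain ⟨c, d, h3, h4, h5⟩ := hp.split (by simp) (by simp)
  have e1 := h5.head_eq
  have e2 : w = c := by simpa using h3.2.2
  subst e1 e2
  exact ⟨w, by simp [e], y, by simp [e], h1 w (by simp), h4, h2⟩

theorem Cfg.full (h : Cfg G S u P x Q p1 pl qh q1) (hC : HC G ∅) (hZ : HZ G ∅)
    {t : V} (ht : t ∈ Q) (htq : t ≠ q1) (ut : G.Adj u t) : ∀ y ∈ P, G.Adj u y := by
  by_contra hn
  obtain ⟨y, hy, z, hz, h1, h2, h3⟩ := h.bdry hn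
  exact h.F3 hC hZ (by simp) (by simp) ht htq ut hy hz h1 h2 h3

theorem le_dg_of {T : Finset V} {S : Finset V} {u : V} (h1 : T ⊆ S) (h2 : ∀ t ∈ T, G.Adj u t) :
    T.card ≤ dg G S u := by
  unfold dg
  apply Finset.card_le_card
  intro t ht
  simp [h1 ht, h2 t ht]

theorem dg_le_of {T : Finset V} {S : Finset V} {u : V} (h1 : ∀ t ∈ S, G.Adj u t → t ∈ T) :
    dg G S u ≤ T.card := by
  unfold dg
  apply Finset.card_le_card
  intro t ht
  simp only [Finset.mem_filter] at ht
  exact h1 t ht.1 ht.2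

theorem three_le_dg {a b c : V} (hab : a ≠ b) (hac : a ≠ c) (hbc : b ≠ c) (ha : a ∈ S) (hb : b ∈ S)
    (hc : c ∈ S) (ua : G.Adj u a) (ub : G.Adj u b) (uc : G.Adj u c) : 3 ≤ dg G S u := by
  have : ({a, b, c} : Finset V).card = 3 := Finset.card_eq_three.2 ⟨a, b, c, hab, hac, hbc, rfl⟩
  rw [← this]
  apply le_dg_of
  · intro t ht; simp at ht; rcases ht with rfl | rfl | rfl <;> assumption
  · intro t ht; simp at ht; rcases ht with rfl | rfl | rfl <;> assumption

theorem Cfg.pa (h : Cfg G S u P x Q p1 pl qh q1) (hPu : ∀ y ∈ P, G.Adj u y)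
    (hQu : ∀ y ∈ Q, G.Adj u y) (hd : 3 ≤ dg G S u) : Pan G S := by
  have := Panc.pa h.cyc h.hP.ne_nil h.hQ.ne_nil hPu hQu (by rw [h.hS]; exact hd)
  rwa [h.hS] at this

/-- a path with at least two vertices has distinct ends -/
theorem Pth.ends_ne {A : V → V → Prop} {a b : V} {l : List V} (h : Pth A a l b) (hn : l.Nodup)
    (h2 : 2 ≤ l.length) : a ≠ b := by
  rintro rfl
  obtain ⟨m, rfl⟩ := h.exists_cons
  have hm : m ≠ [] := by rintro rfl; simp at h2
  obtain ⟨d, _, h3⟩ := h.tail hm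
  have := h3.last_mem
  simp [this] at hn

theorem eq_single {l : List V} {a : V} (hn : l.Nodup) (hne : l ≠ []) (h : ∀ y ∈ l, y = a) :
    l = [a] := by
  match l, hne with
  | b :: l, _ =>
    have hb := h b (by simp)
    subst hb
    cases l with
    | nil => rfl
    | cons c l =>
      have := h c (by simp)
      subst this
      simp at hn

theorem Cfg.c2 (h : Cfg G S u P x Q p1 pl qh q1) (hC : HC G ∅) (hZ : HZ G ∅)
    (hPl : 2 ≤ P.length) (hQl : 2 ≤ Q.length) (hx : G.Adj x p1) : Pan G S := by
  have e1 := h.hP.ends_ne h.ndP hPl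
  have e2 := h.hQ.ends_ne h.ndQ hQl
  have f1 := h.swap.full hC hZ h.hP.head_mem e1 hx
  have f2 := h.swap.flip.full hC hZ (by simpa using h.hQ.last_mem) e2.symm (f1 _ h.hQ.last_mem)
  refine h.swap.pa f1 (by simpa using f2) (three_le_dg (a := p1) (b := pl) (c := qh) e1
    (h.PQ h.hP.head_mem h.hQ.head_mem)
    (h.PQ h.hP.last_mem h.hQ.head_mem) ?_ ?_ ?_ hx h.px.symm h.xq)
  · rw [h.mem]; exact Or.inr (Or.inl h.hP.head_mem)
  · rw [h.mem]; exact Or.inr (Or.inl h.hP.last_mem)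
  · rw [h.mem]; exact Or.inr (Or.inr (Or.inr h.hQ.head_mem))

/-- the cycle obtained by deleting a singleton `Q` when `u ~ x` -/
theorem Cfg.del_single (h : Cfg G S u P x [q1] p1 pl qh q1) (ux : G.Adj u x) :
    Ham G (S.erase q1) := by
  have h1 := List.length_pos_iff.2 h.hP.ne_nil
  have hnd : (u :: (P ++ [x])).Nodup := by
    have := h.nd
    have hsub : List.Sublist (u :: (P ++ [x])) (u :: (P ++ x :: [q1])) := by simp
    exact this.sublist hsub
  refine ⟨u :: (P ++ [x]), Cyc.mk' (h.hP.append h.px (Pth.single x)) hnd (by simp; omega) h.up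
    ux.symm, ?_⟩
  ext v
  have a1 : q1 ∉ P := fun e => h.PQ e (by simp) rfl
  have a2 : u ≠ q1 := fun e => h.uQ (by simp [e])
  have a3 : x ≠ q1 := fun e => h.xQ (by simp [e])
  simp only [List.mem_toFinset, Finset.mem_erase, h.mem, List.mem_cons, List.mem_append]
  constructor
  · rintro (rfl | hv | hv | hv)
    · exact ⟨a2, Or.inl rfl⟩
    · exact ⟨fun e => a1 (e ▸ hv), Or.inr (Or.inl hv)⟩
    · subst hv; exact ⟨a3, by simp⟩
    · simp at hv
  · rintro ⟨h1, h2 | h2 | h2 | h2 | h2⟩ <;> simp_all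

end Config
end Panc

namespace Panc
open scoped Classical

section TZero
variable {V : Type} {G : SimpleGraph V} {S : Finset V}

theorem claim0 (hC : HC G ∅) (hZ : HZ G ∅) (h2 : TwoC G S)
    (IH : ∀ T : Finset V, T.card < S.card → TwoC G T → (∃ u ∈ T, 3 ≤ dg G T u) → Pan G T)
    {w : V} (hw : w ∈ S) (hH : Ham G (S.erase w)) : Pan G S := by
  intro k hk3 hkn
  rcases Nat.lt_or_ge k S.card with hlt | hge
  swap
  · have : k = S.card := by omega
    subst this
    exact (ham hC hZ h2 (by simp)).hasCyc
  have hcard := Finset.card_erase_of_mem hw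
  obtain ⟨l, hl, hlS⟩ := hH
  by_cases hd : ∃ v ∈ S.erase w, 3 ≤ dg G (S.erase w) v
  · have h3 : TwoC G (S.erase w) := by rw [← hlS]; exact twoC_of_cyc hl
    exact (IH _ (Finset.card_erase_lt_of_mem hw) h3 hd k hk3 (by omega)).mono
      (Finset.erase_subset _ _)
  · push Not at hd
    have hwl : w ∉ l := by rw [← List.mem_toFinset, hlS]; simp
    have hlc : l.length = S.card - 1 := by rw [← hl.toFinset_card, hlS, hcard]
    obtain ⟨z, hz, hzw⟩ : ∃ z ∈ S, z ≠ w := by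
      have : (S.erase w).Nonempty := by rw [← Finset.card_pos]; have := h2.1; omega
      obtain ⟨z, hz⟩ := this
      exact ⟨z, Finset.mem_of_mem_erase hz, Finset.ne_of_mem_erase hz⟩
    obtain ⟨a, ha, _, wa⟩ := h2.exists_nbr hw hzw.symm
    have := indcyc hC hZ hl hwl (fun v hv => by
        have := hd v (by rw [← hlS]; simpa using hv)
        rw [hlS]; omega)
      ⟨a, by rw [← List.mem_toFinset, hlS]; simp [ha, wa.ne'], wa⟩ hk3 (by omega)
    rwa [hlS, Finset.insert_erase hw] at this

theorem t0_core (hC : HC G ∅) (hZ : HZ G ∅) (h2 : TwoC G S)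
    (hcl : ∀ w ∈ S, Ham G (S.erase w) → Pan G S)
    {u x p1 pl qh q1 : V} {P Q : List V} (h : Cfg G S u P x Q p1 pl qh q1) (hd : 3 ≤ dg G S u)
    (hnf : ¬ ∀ y ∈ P, G.Adj u y) : Pan G S := by
  have hQ1 : ∀ t ∈ Q, G.Adj u t → t = q1 := by
    intro t ht ut
    by_contra htq
    exact hnf (h.full hC hZ ht htq ut)
  have hq1S : q1 ∈ S := by rw [h.mem]; exact Or.inr (Or.inr (Or.inr h.hQ.last_mem))
  have hPl : 2 ≤ P.length := by
    by_contra hlt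
    apply hnf
    have h1 := List.length_pos_iff.2 h.hP.ne_nil
    obtain ⟨a, ha⟩ := List.length_eq_one_iff.1 (show P.length = 1 by omega)
    have hp := h.hP
    rw [ha] at hp
    have := hp.head_eq
    subst this
    rw [ha]; simpa using h.up
  by_cases hp' : ∃ p' ∈ P, p' ≠ p1 ∧ G.Adj u p'
  · obtain ⟨p', hp'P, hp'1, up'⟩ := hp'
    have hQf := h.flip.full hC hZ (by simpa using hp'P) hp'1 up'
    have hQs : Q = [q1] := eq_single h.ndQ h.hQ.ne_nil
      (fun y hy => hQ1 y hy (hQf y (by simpa using hy)))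
    subst hQs
    have hqq : qh = q1 := h.hQ.head_eq.symm
    subst hqq
    by_cases ux : G.Adj u x
    · exact hcl _ hq1S (h.del_single ux)
    have hpath : Pth G.Adj u (u :: (P ++ [x])) x := Pth.cons h.up (h.hP.append h.px (Pth.single x))
    have hnd : (u :: (P ++ [x])).Nodup := by
      have := h.nd
      have hsub : List.Sublist (u :: (P ++ [x])) (u :: (P ++ x :: [qh])) := by simp
      exact this.sublist hsub
    have hSe : (u :: (P ++ [x])).toFinset = S.erase qh := by
      have a1 : qh ∉ (u :: (P ++ [x])).toFinset := by
        intro e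
        simp only [List.mem_toFinset, List.mem_cons, List.mem_append, List.not_mem_nil,
          or_false] at e
        rcases e with e | e | e
        · exact h.uQ (by simp [e])
        · exact h.PQ e (by simp) rfl
        · exact h.xQ (by simp [e])
      rw [← h.hS]
      have : (u :: (P ++ x :: [qh])).toFinset = insert qh (u :: (P ++ [x])).toFinset := by
        ext v; simp; tauto
      rw [this, Finset.erase_insert a1]
    rcases cut_lemma hpath hnd (by simp; omega) with h3 | ⟨P0, w, P2, e, hP0, hP2, hno⟩
    · rw [hSe] at h3
      exact hcl _ hq1S (ham hC hZ h3 (by simp))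
    obtain ⟨u', P1, rfl⟩ := List.exists_cons_of_ne_nil hP0
    obtain ⟨P3, x', rfl⟩ := List.eq_nil_or_concat P2 |>.resolve_left hP2
    have e' : u = u' ∧ P = P1 ++ w :: P3 ∧ x = x' := by
      simp only [List.cons_append, List.cons.injEq, List.concat_eq_append] at e
      refine ⟨e.1, ?_⟩
      have := e.2
      rw [show P1 ++ w :: (P3 ++ [x']) = (P1 ++ w :: P3) ++ [x'] by simp] at this
      have := List.append_inj' this rfl
      simpa using this
    obtain ⟨rfl, e2, rfl⟩ := e'
    subst e2
    simp only [List.concat_eq_append] at hno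
    have hndP := h.ndP
    have hloc : ∀ v ∈ P1 ++ w :: P3, G.Adj u v → v ∈ P1 ∨ v = w := by
      intro v hv uv
      simp at hv
      rcases hv with hv | hv | hv
      · exact Or.inl hv
      · exact Or.inr hv
      · exact absurd uv (hno u (by simp) v (by simp [hv]))
    have hP1 : P1 ≠ [] := by
      rintro rfl
      have : w = p1 := by simpa using h.hP.2.1
      subst this
      rcases hloc _ hp'P up' with h4 | h4
      · simp at h4
      · exact hp'1 h4
    obtain ⟨c, w', k1, k2, k3⟩ := h.hP.split hP1 (by simp)
    have := k3.head_eq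
    subst this
    have xw : ∀ v ∈ P1 ++ w :: P3, v ≠ p1 → G.Adj u v → v = w ∧ G.Adj x w := by
      intro v hv hv1 uv
      have p1v := h.F2p hC (by simp) (by simp) hv hv1.symm uv
      have hz := hZ p1 v u qh x p1v h.up.symm uv.symm h.uq h.xq.symm (h.no _ h.hP.head_mem _ (by simp))
        (h.no _ hv _ (by simp))
      have n1 : ¬ G.Adj p1 x := hno p1 (by simp [k1.head_mem]) x (by simp)
      have n2 : G.Adj v x := by
        by_contra n2
        simpa using hz n1 n2 ux
      rcases hloc v hv uv with h4 | h4
      · exact absurd n2 (hno v (by simp [h4]) x (by simp))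
      · subst h4; exact ⟨rfl, n2.symm⟩
    obtain ⟨rfl, hxw⟩ := xw p' hp'P hp'1 up'
    rcases Nat.lt_or_ge P1.length 2 with hl | hl
    · have h1 := List.length_pos_iff.2 hP1
      obtain ⟨a, ha⟩ := List.length_eq_one_iff.1 (show P1.length = 1 by omega)
      subst ha
      have := k1.head_eq
      subst this
      apply hcl a (by rw [h.mem]; simp)
      have hnd2 := h.nd
      refine ⟨u :: ((p' :: P3) ++ x :: [qh]), Cyc.mk' (k3.append h.px (Pth.cons h.xq (Pth.single qh)))
        ?_ (by simp) up' h.uq.symm, ?_⟩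
      · exact hnd2.sublist (by simp)
      · rw [← h.hS]
        ext v
        simp only [List.cons_append, List.nil_append, List.nodup_cons, List.mem_cons,
          not_or] at hnd2
        simp only [List.mem_toFinset, Finset.mem_erase, List.mem_cons, List.mem_append,
          List.cons_append, List.nil_append]
        have b1 := hnd2.1.1
        have b2 := hnd2.2.1
        constructor
        · intro hv
          refine ⟨?_, by tauto⟩
          rintro rfl
          rcases hv with hv | hv | hv
          · exact b1 hv.symm
          · exact b2.1 hv
          · exact b2.2 (by simpa using hv)
        · tauto
    · have cne := k1.ends_ne (hndP.sublist (by simp)) hl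
      have hcP : c ∈ P1 ++ p' :: P3 := by simp [k1.last_mem]
      have ncu : ¬ G.Adj u c := by
        intro uc
        have h5 := (xw c hcP cne.symm uc).1
        subst h5
        simp [List.nodup_append] at hndP
        exact (hndP.2.2 c k1.last_mem).1 rfl
      have := hC p' u x c up'.symm hxw.symm k2.symm h.ux (by rintro rfl; exact h.uP hcP)
        (by rintro rfl; exact h.xP hcP) ux ncu
        (fun e => hno c (by simp [k1.last_mem]) x (by simp) e.symm)
      simp at this
  · push Not at hp'
    have ux : G.Adj u x := by
      by_contra ux
      have : dg G S u ≤ ({p1, q1} : Finset V).card := by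
        apply dg_le_of
        intro t ht ut
        rw [h.mem] at ht
        rcases ht with rfl | ht | rfl | ht
        · exact absurd ut (by simp)
        · by_cases e : t = p1
          · simp [e]
          · exact absurd ut (hp' t ht e)
        · exact absurd ut ux
        · simp [hQ1 t ht ut]
      have := (Finset.card_le_two (a := p1) (b := q1))
      omega
    rcases Nat.lt_or_ge Q.length 2 with hl | hl
    · have h1 := List.length_pos_iff.2 h.hQ.ne_nil
      obtain ⟨a, ha⟩ := List.length_eq_one_iff.1 (show Q.length = 1 by omega)
      subst ha
      have : a = q1 := by simpa using h.hQ.2.2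
      subst this
      exact hcl _ hq1S (h.del_single ux)
    · by_cases e1 : G.Adj x p1
      · exact h.c2 hC hZ hPl hl e1
      by_cases e2 : G.Adj x q1
      · exact h.flip.c2 hC hZ (by simpa using hl) (by simpa using hPl) e2
      · have m1 := h.hP.head_mem
        have m2 := h.hQ.last_mem
        have := hC u x p1 q1 ux h.up h.uq (fun e => h.xP (e ▸ m1)) (fun e => h.xQ (e ▸ m2))
          (h.PQ m1 m2) e1 e2 (h.no _ m1 _ m2)
        simp at this

theorem t0 (hC : HC G ∅) (hZ : HZ G ∅) (n : ℕ) : ∀ S : Finset V, S.card = n → TwoC G S →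
    (∃ u ∈ S, 3 ≤ dg G S u) → Pan G S := by
  induction n using Nat.strong_induction_on with
  | _ n IH =>
  rintro S hn h2 ⟨u, hu, hd⟩
  have hcl : ∀ w ∈ S, Ham G (S.erase w) → Pan G S := fun w hw hH =>
    claim0 hC hZ h2 (fun T hT => IH T.card (by omega) T rfl) hw hH
  obtain ⟨l, hl, hlS⟩ := ham hC hZ h2 (by simp)
  obtain ⟨m, hm, hperm⟩ := hl.rotate_to (by rw [← List.mem_toFinset, hlS]; exact hu)
  have hmS : (u :: m).toFinset = S := by rw [List.toFinset_eq_of_perm _ _ hperm, hlS]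
  obtain ⟨a, b, h3, h4, h5⟩ := hm.open_head
  have hS4 : 4 ≤ S.card := by
    have : dg G S u ≤ (S.erase u).card := dg_le_of (fun t ht ut => by simp [ht, ut.ne'])
    rw [Finset.card_erase_of_mem hu] at this
    omega
  have hml : m.length + 1 = S.card := by rw [← hmS, hm.toFinset_card]; simp
  have hnd := hm.2.1
  rw [List.nodup_cons] at hnd
  rcases cut_lemma h3 hnd.2 (by omega) with h6 | ⟨P, x, Q, rfl, hP, hQ, hno⟩
  · apply hcl u hu
    have : m.toFinset = S.erase u := by
      rw [← hmS, List.toFinset_cons, Finset.erase_insert (by simpa using hnd.1)]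
    rw [← this]
    exact ham hC hZ h6 (by simp)
  · obtain ⟨p1, pl, qh, q1, h⟩ := mk_cfg hm hmS hP hQ hno
    by_cases f1 : ∀ y ∈ P, G.Adj u y
    · by_cases f2 : ∀ y ∈ Q, G.Adj u y
      · exact h.pa f1 f2 hd
      · exact t0_core hC hZ h2 hcl h.flip hd (by simpa using f2)
    · exact t0_core hC hZ h2 hcl h hd f1

end TZero
end Panc

namespace Panc
open scoped Classical

section Heavy
variable {V : Type} {G : SimpleGraph V} {X : Set V} {S : Finset V}

/-- any two heavy vertices have large degree sum -/
def HD (G : SimpleGraph V) (X : Set V) (S : Finset V) : Prop :=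
  ∀ y ∈ S, ∀ z ∈ S, y ∈ X → z ∈ X → y ≠ z → S.card + 1 ≤ dg G S y + dg G S z

theorem HD.ham (hD : HD G X S) (hC : HC G X) (hZ : HZ G X) (h2 : TwoC G S) : Ham G S :=
  Panc.ham hC hZ h2 (fun x hx y hy h1 h3 h4 _ => by have := hD x hx y hy h1 h3 h4; omega)

theorem dg_erase_le {v w : V} : dg G S v ≤ dg G (S.erase w) v + 1 := by
  unfold dg
  rw [Finset.filter_erase]
  have := Finset.pred_card_le_card_erase (s := S.filter (G.Adj v)) (a := w)
  omega

theorem dg_erase_not {v w : V} (h : ¬ G.Adj v w) : dg G (S.erase w) v = dg G S v := by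
  unfold dg
  rw [Finset.filter_erase, Finset.erase_eq_of_notMem (by simp [h])]

variable {u x p1 pl qh q1 : V} {P Q : List V}

/-- the exceptional configuration -/
structure CB (G : SimpleGraph V) (X : Set V) (S : Finset V) (u : V) (P : List V) (x : V) (Q : List V)
    (p1 pl qh q1 y : V) : Prop where
  cf : Cfg G S u P x Q p1 pl qh q1
  uQ : ∀ q ∈ Q, G.Adj u q
  Ql : ∀ q ∈ Q, q ∉ X
  Q2 : 2 ≤ Q.length
  Qc : ∀ q ∈ Q, ∀ q' ∈ Q, q ≠ q' → G.Adj q q'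
  yP : y ∈ P
  yX : y ∈ X
  uy : G.Adj u y

/-- there is an exceptional configuration at `u` -/
def EB (G : SimpleGraph V) (X : Set V) (S : Finset V) (u : V) : Prop :=
  ∃ P x Q p1 pl qh q1 y, CB G X S u P x Q p1 pl qh q1 y

theorem Cfg.uS (h : Cfg G S u P x Q p1 pl qh q1) : u ∈ S := by rw [h.mem]; simp
theorem Cfg.xS (h : Cfg G S u P x Q p1 pl qh q1) : x ∈ S := by rw [h.mem]; simp
theorem Cfg.PS (h : Cfg G S u P x Q p1 pl qh q1) {y : V} (hy : y ∈ P) : y ∈ S := by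
  rw [h.mem]; simp [hy]
theorem Cfg.QS (h : Cfg G S u P x Q p1 pl qh q1) {y : V} (hy : y ∈ Q) : y ∈ S := by
  rw [h.mem]; simp [hy]

theorem Cfg.p1X (h : Cfg G S u P x Q p1 pl qh q1) (hD : HD G X S) (huX : u ∈ X)
    (hnp : ¬ Pan G S) : p1 ∉ X := by
  intro hp
  have h1 := h.cyc
  have h2 := hD u h.uS p1 (h.PS h.hP.head_mem) huX hp h.up.ne
  obtain ⟨m, hm⟩ := h.hP.exists_cons
  have h3 := h.hS
  have h4 := h.nd
  rw [hm] at h1 h3 h4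
  simp only [List.cons_append] at h1 h3 h4
  have := sh h1 (by rw [h3, ← List.toFinset_card_of_nodup h4, h3]; exact h2)
  rw [h3] at this
  exact hnp this

theorem Cfg.q1X (h : Cfg G S u P x Q p1 pl qh q1) (hD : HD G X S) (huX : u ∈ X)
    (hnp : ¬ Pan G S) : q1 ∉ X := h.flip.p1X hD huX hnp

theorem Cfg.dgP (h : Cfg G S u P x Q p1 pl qh q1) {y : V} (hy : y ∈ P) : dg G S y ≤ P.length + 1 := by
  have h1 : dg G S y ≤ (insert u (insert x (P.toFinset.erase y))).card := by
    apply dg_le_of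
    intro t ht hyt
    rw [h.mem] at ht
    rcases ht with rfl | ht | rfl | ht
    · simp
    · simp [ht, hyt.ne']
    · simp
    · exact absurd hyt (h.no _ hy _ ht)
  have h2 := Finset.card_insert_le u (insert x (P.toFinset.erase y))
  have h3 := Finset.card_insert_le x (P.toFinset.erase y)
  have h4 : y ∈ P.toFinset := by simpa using hy
  rw [Finset.card_erase_of_mem h4, List.toFinset_card_of_nodup h.ndP] at h3
  have := List.length_pos_iff.2 h.hP.ne_nil
  omega

theorem Cfg.F1 (h : Cfg G S u P x Q p1 pl qh q1) (hD : HD G X S) {y z : V} (hy : y ∈ P) (hz : z ∈ Q)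
    (yX : y ∈ X) (zX : z ∈ X) : False := by
  have h1 := h.dgP hy
  have h2 := h.flip.dgP (y := z) (by simpa using hz)
  have h3 := hD y (h.PS hy) z (h.QS hz) yX zX (h.PQ hy hz)
  have := h.card
  simp at h2
  omega

theorem Cfg.caseB (h : Cfg G S u P x Q p1 pl qh q1) (hC : HC G X) (hZ : HZ G X) (hD : HD G X S)
    (huX : u ∈ X) (hnp : ¬ Pan G S) (hnf : ¬ ∀ y ∈ P, G.Adj u y) {t : V} (ht : t ∈ Q) (htq : t ≠ q1)
    (ut : G.Adj u t) : EB G X S u := by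
  have hp := h.p1X hD huX hnp
  have hq := h.q1X hD huX hnp
  obtain ⟨y, hy, z, hz, uy, yz, uz⟩ := h.bdry hnf
  have yX := h.F3 hC hZ hp hq ht htq ut hy hz uy yz uz
  have hQX : ∀ q ∈ Q, q ∉ X := fun q hqq hqX => h.F1 hD hy hqq yX hqX
  have yp : y ≠ p1 := fun e => hp (e ▸ yX)
  have hQf : ∀ q ∈ Q, G.Adj u q := by
    by_contra hQn
    obtain ⟨y', hy', z', hz', uy', yz', uz'⟩ := h.flip.bdry (by simpa using hQn)
    exact hQX y' (by simpa using hy')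
      (h.flip.F3 hC hZ hq hp (by simpa using hy) yp uy hy' hz' uy' yz' uz')
  refine ⟨P, x, Q, p1, pl, qh, q1, y, h, hQf, hQX, ?_, ?_, hy, yX, uy⟩
  · by_contra hlt
    have h1 := List.length_pos_iff.2 h.hQ.ne_nil
    obtain ⟨a, rfl⟩ := List.length_eq_one_iff.1 (show Q.length = 1 by omega)
    have e1 : a = q1 := by simpa using h.hQ.2.2
    simp at ht
    exact htq (ht.trans e1)
  · intro q hq1 q' hq' hne
    by_contra hn
    exact hQX q hq1 (h.flip.F2 hC hp (by simpa using hq1) (by simpa using hq') hne (hQf _ hq1)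
      (hQf _ hq') hn)

theorem hasCyc3 {a b c : V} (nd : [a, b, c].Nodup) (ab : G.Adj a b) (bc : G.Adj b c) (ca : G.Adj c a)
    (hS : ∀ v ∈ [a, b, c], v ∈ S) : HasCyc G S 3 :=
  ⟨[a, b, c], ⟨by simp, nd, a, c, ⟨by simp [ab, bc], rfl, rfl⟩, ca⟩, hS, rfl⟩
theorem hasCyc4 {a b c d : V} (nd : [a, b, c, d].Nodup) (ab : G.Adj a b) (bc : G.Adj b c)
    (cd : G.Adj c d) (da : G.Adj d a) (hS : ∀ v ∈ [a, b, c, d], v ∈ S) : HasCyc G S 4 :=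
  ⟨[a, b, c, d], ⟨by simp, nd, a, d, ⟨by simp [ab, bc, cd], rfl, rfl⟩, da⟩, hS, rfl⟩
theorem hasCyc5 {a b c d e : V} (nd : [a, b, c, d, e].Nodup) (ab : G.Adj a b) (bc : G.Adj b c)
    (cd : G.Adj c d) (de : G.Adj d e) (ea : G.Adj e a) (hS : ∀ v ∈ [a, b, c, d, e], v ∈ S) :
    HasCyc G S 5 :=
  ⟨[a, b, c, d, e], ⟨by simp, nd, a, e, ⟨by simp [ab, bc, cd, de], rfl, rfl⟩, ea⟩, hS, rfl⟩
theorem hasCyc6 {a b c d e f : V} (nd : [a, b, c, d, e, f].Nodup) (ab : G.Adj a b) (bc : G.Adj b c)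
    (cd : G.Adj c d) (de : G.Adj d e) (ef : G.Adj e f) (fa : G.Adj f a)
    (hS : ∀ v ∈ [a, b, c, d, e, f], v ∈ S) : HasCyc G S 6 :=
  ⟨[a, b, c, d, e, f], ⟨by simp, nd, a, f, ⟨by simp [ab, bc, cd, de, ef], rfl, rfl⟩, fa⟩, hS, rfl⟩

theorem Cfg.hasCyc (h : Cfg G S u P x Q p1 pl qh q1) : HasCyc G S S.card :=
  Ham.hasCyc ⟨_, h.cyc, h.hS⟩

theorem Cfg.caseC2 (h : Cfg G S u P x Q p1 pl qh q1) (hd : S.card + 1 ≤ 2 * dg G S u)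
    (hnf : ¬ ∀ y ∈ P, G.Adj u y) (hP1 : ∀ t ∈ P, G.Adj u t → t = p1)
    (hQ1 : ∀ t ∈ Q, G.Adj u t → t = q1) : Pan G S := by
  have hPl : 2 ≤ P.length := by
    by_contra hlt
    apply hnf
    have h1 := List.length_pos_iff.2 h.hP.ne_nil
    obtain ⟨a, ha⟩ := List.length_eq_one_iff.1 (show P.length = 1 by omega)
    have hp := h.hP
    rw [ha] at hp
    have := hp.head_eq
    subst this
    rw [ha]; simpa using h.up
  have hQl := List.length_pos_iff.2 h.hQ.ne_nil
  have hcard := h.card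
  have ux : G.Adj u x := by
    by_contra ux
    have : dg G S u ≤ ({p1, q1} : Finset V).card := by
      apply dg_le_of
      intro t ht ut
      rw [h.mem] at ht
      rcases ht with rfl | ht | rfl | ht
      · exact absurd ut (by simp)
      · simp [hP1 t ht ut]
      · exact absurd ut ux
      · simp [hQ1 t ht ut]
    have := (Finset.card_le_two (a := p1) (b := q1))
    omega
  have : dg G S u ≤ ({p1, q1, x} : Finset V).card := by
    apply dg_le_of
    intro t ht ut
    rw [h.mem] at ht
    rcases ht with rfl | ht | rfl | ht
    · exact absurd ut (by simp)
    · simp [hP1 t ht ut]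
    · simp
    · simp [hQ1 t ht ut]
  have := (Finset.card_le_three (a := p1) (b := q1) (c := x))
  obtain ⟨a, b, rfl⟩ := List.length_eq_two.1 (show P.length = 2 by omega)
  obtain ⟨q, rfl⟩ := List.length_eq_one_iff.1 (show Q.length = 1 by omega)
  have e1 : a = p1 := by simpa using h.hP.2.1
  have e2 : b = pl := by simpa using h.hP.2.2
  have e3 : q = q1 := by simpa using h.hQ.2.2
  have e4 : q = qh := by simpa using h.hQ.2.1
  subst e1 e2 e3 e4
  have ab : G.Adj a b := by have := h.hP.1; simpa using this
  have nd := h.nd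
  intro k hk3 hkn
  have hk5 : k = 3 ∨ k = 4 ∨ k = S.card := by simp at hcard; omega
  rcases hk5 with rfl | rfl | rfl
  · apply hasCyc3 (a := u) (b := x) (c := q) _ ux h.xq h.uq.symm
    · intro v hv; rw [h.mem]; simp at hv; simp; tauto
    · simp at nd ⊢; tauto
  · apply hasCyc4 (a := u) (b := a) (c := b) (d := x) _ h.up ab h.px ux.symm
    · intro v hv; rw [h.mem]; simp at hv; simp; tauto
    · simp at nd ⊢; tauto
  · exact h.hasCyc

set_option maxHeartbeats 4000000 in
theorem caseSing {p2 q : V} {R : List V} (h : Cfg G S u (p1 :: p2 :: R) x [q] p1 pl q q)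
    (hC : HC G X) (hZ : HZ G X) (hD : HD G X S) (huX : u ∈ X) (hnp : ¬ Pan G S)
    (hd : S.card + 1 ≤ 2 * dg G S u)
    (hnf : ¬ ∀ y ∈ p1 :: p2 :: R, G.Adj u y) (up2 : G.Adj u p2) (hno : ∀ y ∈ R, ¬ G.Adj p1 y) :
    False := by
  apply hnp
  have hp := h.p1X hD huX hnp
  have hq := h.q1X hD huX hnp
  have nR : ∀ y ∈ R, ¬ G.Adj u y := by
    intro y hy uy
    have hne : p1 ≠ y := by
      rintro rfl
      have := h.ndP
      simp [hy] at this
    exact hno y hy (h.F2p hC hp hq (by simp [hy]) hne uy)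
  have hRne : 0 < R.length := by
    rw [List.length_pos_iff]
    rintro rfl
    apply hnf
    intro y hy
    simp at hy
    rcases hy with rfl | rfl
    · exact h.up
    · exact up2
  have hcard := h.card
  simp at hcard
  have ux : G.Adj u x := by
    by_contra ux
    have : dg G S u ≤ ({p1, p2, q} : Finset V).card := by
      apply dg_le_of
      intro t ht ut
      rw [h.mem] at ht
      simp only [List.mem_cons, List.not_mem_nil, or_false] at ht
      rcases ht with rfl | (rfl | rfl | ht) | rfl | rfl
      · exact absurd ut (by simp)
      · simp
      · simp
      · exact absurd ut (nR _ ht)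
      · exact absurd ut ux
      · simp
    have := (Finset.card_le_three (a := p1) (b := p2) (c := q))
    omega
  have hd4 : dg G S u ≤ 4 := by
    have : dg G S u ≤ ({p1, p2, q, x} : Finset V).card := by
      apply dg_le_of
      intro t ht ut
      rw [h.mem] at ht
      simp only [List.mem_cons, List.not_mem_nil, or_false] at ht
      rcases ht with rfl | (rfl | rfl | ht) | rfl | rfl
      · exact absurd ut (by simp)
      · simp
      · simp
      · exact absurd ut (nR _ ht)
      · simp
      · simp
    have := (Finset.card_le_four (a := p1) (b := p2) (c := q) (d := x))
    omega
  have hqx := h.xq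
  have hR : R.length = 1 ∨ R.length = 2 := by omega
  intro k hk3 hkn
  rcases Nat.lt_or_ge k S.card with hlt | hge
  swap
  · have : k = S.card := by omega
    subst this
    exact h.hasCyc
  have nd := h.nd
  have hch := h.hP.1
  rcases hR with hR | hR
  · obtain ⟨p3, rfl⟩ := List.length_eq_one_iff.1 hR
    have e2 : p3 = pl := by simpa using h.hP.2.2
    subst e2
    simp at hch
    have hk5 : k = 3 ∨ k = 4 ∨ k = 5 := by omega
    have hmem : ∀ v, (v = u ∨ v = p1 ∨ v = p2 ∨ v = p3 ∨ v = x ∨ v = q) → v ∈ S := by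
      intro v hv; rw [h.mem]; simp; tauto
    rcases hk5 with rfl | rfl | rfl
    · apply hasCyc3 (a := u) (b := x) (c := q) _ ux h.xq h.uq.symm
      · intro v hv; apply hmem; simp at hv; tauto
      · simp at nd ⊢; tauto
    · apply hasCyc4 (a := u) (b := p2) (c := p3) (d := x) _ up2 hch.2 h.px ux.symm
      · intro v hv; apply hmem; simp at hv; tauto
      · simp at nd ⊢; tauto
    · apply hasCyc5 (a := u) (b := p2) (c := p3) (d := x) (e := q) _ up2 hch.2 h.px h.xq h.uq.symm
      · intro v hv; apply hmem; simp at hv; tauto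
      · simp at nd ⊢; tauto
  · obtain ⟨p3, p4, rfl⟩ := List.length_eq_two.1 hR
    have e2 : p4 = pl := by simpa using h.hP.2.2
    subst e2
    simp at hch
    obtain ⟨a12, a23, a34⟩ := hch
    have hk5 : k = 3 ∨ k = 4 ∨ k = 5 ∨ k = 6 := by omega
    have hmem : ∀ v, (v = u ∨ v = p1 ∨ v = p2 ∨ v = p3 ∨ v = p4 ∨ v = x ∨ v = q) → v ∈ S := by
      intro v hv; rw [h.mem]; simp; tauto
    rcases hk5 with rfl | rfl | rfl | rfl
    · apply hasCyc3 (a := u) (b := x) (c := q) _ ux h.xq h.uq.symm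
      · intro v hv; apply hmem; simp at hv; tauto
      · simp at nd ⊢; tauto
    · by_cases c1 : G.Adj x p2
      · apply hasCyc4 (a := u) (b := p2) (c := x) (d := q) _ up2 c1.symm h.xq h.uq.symm
        · intro v hv; apply hmem; simp at hv; tauto
        · simp at nd ⊢; tauto
      by_cases c2 : G.Adj x p3
      · apply hasCyc4 (a := u) (b := p2) (c := p3) (d := x) _ up2 a23 c2.symm ux.symm
        · intro v hv; apply hmem; simp at hv; tauto
        · simp at nd ⊢; tauto
      by_cases c3 : G.Adj p2 p4
      · apply hasCyc4 (a := u) (b := p2) (c := p4) (d := x) _ up2 c3 h.px ux.symm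
        · intro v hv; apply hmem; simp at hv; tauto
        · simp at nd ⊢; tauto
      exfalso
      have hz := hZ q x u p2 p3 h.xq.symm h.uq.symm ux.symm up2 a23
        (fun e => h.no p2 (by simp) q (by simp) e.symm) c1
        (fun e => h.no p3 (by simp) q (by simp) e.symm) c2 (nR p3 (by simp))
      have p2X : p2 ∈ X := by tauto
      have h8 := hD u h.uS p2 (hmem p2 (by tauto)) huX p2X up2.ne
      have : dg G S p2 ≤ ({p1, p3, u} : Finset V).card := by
        apply dg_le_of
        intro t ht ut
        rw [h.mem] at ht
        simp only [List.mem_cons, List.not_mem_nil, or_false] at ht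
        rcases ht with rfl | (rfl | rfl | rfl | rfl) | rfl | rfl
        · simp
        · simp
        · exact absurd ut (by simp)
        · simp
        · exact absurd ut c3
        · exact absurd ut.symm c1
        · exact absurd ut (h.no _ (by simp) _ (by simp))
      have := (Finset.card_le_three (a := p1) (b := p3) (c := u))
      simp at hcard
      omega
    · apply hasCyc5 (a := u) (b := p2) (c := p3) (d := p4) (e := x) _ up2 a23 a34 h.px ux.symm
      · intro v hv; apply hmem; simp at hv; tauto
      · simp at nd ⊢; tauto
    · apply hasCyc6 (a := u) (b := p2) (c := p3) (d := p4) (e := x) (f := q) _ up2 a23 a34 h.px h.xq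
        h.uq.symm
      · intro v hv; apply hmem; simp at hv; tauto
      · simp at nd ⊢; tauto

end Heavy
end Panc

namespace Panc
open scoped Classical

section Main
variable {V : Type} {G : SimpleGraph V} {X : Set V} {S : Finset V}
variable {u x p1 pl qh q1 : V} {P Q : List V}

theorem Cfg.three (h : Cfg G S u P x Q p1 pl qh q1) (hd : S.card + 1 ≤ 2 * dg G S u) :
    3 ≤ dg G S u := by
  have := h.card
  have := List.length_pos_iff.2 h.hP.ne_nil
  have := List.length_pos_iff.2 h.hQ.ne_nil
  omega

theorem Cfg.two_le (h : Cfg G S u P x Q p1 pl qh q1) (hnf : ¬ ∀ y ∈ P, G.Adj u y) :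
    2 ≤ P.length := by
  by_contra hlt
  apply hnf
  have h1 := List.length_pos_iff.2 h.hP.ne_nil
  obtain ⟨a, ha⟩ := List.length_eq_one_iff.1 (show P.length = 1 by omega)
  have hp := h.hP
  rw [ha] at hp
  have := hp.head_eq
  subst this
  rw [ha]; simpa using h.up

/-- the easy part of the case analysis -/
theorem Cfg.easy (h : Cfg G S u P x Q p1 pl qh q1) (hC : HC G X) (hZ : HZ G X) (hD : HD G X S)
    (huX : u ∈ X) (hnp : ¬ Pan G S) (hd : S.card + 1 ≤ 2 * dg G S u) (hE : ¬ EB G X S u)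
    (hnf : ¬ ∀ y ∈ P, G.Adj u y) : Q = [q1] ∧ ∃ p' ∈ P, p' ≠ p1 ∧ G.Adj u p' := by
  have hQ1 : ∀ t ∈ Q, G.Adj u t → t = q1 := by
    intro t ht ut
    by_contra htq
    exact hE (h.caseB hC hZ hD huX hnp hnf ht htq ut)
  have hp' : ∃ p' ∈ P, p' ≠ p1 ∧ G.Adj u p' := by
    by_contra hcon
    push Not at hcon
    refine hnp (h.caseC2 hd hnf (fun t ht ut => ?_) hQ1)
    by_contra e
    exact hcon t ht e ut
  refine ⟨?_, hp'⟩
  obtain ⟨p', hp'P, hne, up'⟩ := hp'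
  apply eq_single h.ndQ h.hQ.ne_nil
  have hQf : ∀ y ∈ Q, G.Adj u y := by
    by_contra hn
    exact hE (h.flip.caseB hC hZ hD huX hnp (by simpa using hn) (by simpa using hp'P) hne up')
  exact fun y hy => hQ1 y hy (hQf y hy)

theorem Cfg.caseC1 (h : Cfg G S u P x Q p1 pl qh q1) (hC : HC G X) (hZ : HZ G X) (hD : HD G X S)
    (huX : u ∈ X) (hnp : ¬ Pan G S) (hd : S.card + 1 ≤ 2 * dg G S u) (hE : ¬ EB G X S u)
    (hnf : ¬ ∀ y ∈ P, G.Adj u y) : False := by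
  obtain ⟨rfl, p', hp'P, hp'1, up'⟩ := h.easy hC hZ hD huX hnp hd hE hnf
  have hqq : qh = q1 := h.hQ.head_eq.symm
  subst hqq
  have hp := h.p1X hD huX hnp
  have hq := h.q1X hD huX hnp
  have hPl := h.two_le hnf
  have hcard := h.card
  simp only [List.length_singleton] at hcard
  have hpath : Pth G.Adj p1 (P ++ [x]) x := h.hP.append h.px (Pth.single x)
  have hnd : (P ++ [x]).Nodup := h.nd.sublist (by
    apply List.Sublist.cons
    simp)
  have hqS : qh ∈ S := h.QS (by simp)
  have hqu : qh ≠ u := h.uq.ne'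
  have hT : (P ++ [x]).toFinset = (S.erase u).erase qh := by
    ext v
    simp only [List.mem_toFinset, List.mem_append, List.mem_singleton, Finset.mem_erase, h.mem]
    constructor
    · rintro (hv | rfl)
      · exact ⟨h.PQ hv (by simp), fun e => h.uP (e ▸ hv), by tauto⟩
      · exact ⟨h.xq.ne, h.ux.symm, by tauto⟩
    · rintro ⟨h1, h2, h3⟩
      tauto
  rcases cut_lemma hpath hnd (by simp; omega) with h3 | ⟨P1, w, P2, e, hP1, hP2, hno⟩
  · have hTc : ((P ++ [x]).toFinset).card = P.length + 1 := by
      rw [List.toFinset_card_of_nodup hnd]; simp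
    have loseP : ∀ y ∈ P, dg G S y ≤ dg G (P ++ [x]).toFinset y + 1 := by
      intro y hy
      rw [hT, dg_erase_not (h.no _ hy _ (by simp))]
      exact dg_erase_le
    have losex : dg G S x ≤ dg G (P ++ [x]).toFinset x + 2 := by
      rw [hT]
      have h1 := dg_erase_le (G := G) (S := S) (v := x) (w := u)
      have h2 := dg_erase_le (G := G) (S := S.erase u) (v := x) (w := qh)
      omega
    obtain ⟨cc, hc, hcT⟩ := ham (X := X) hC hZ h3 (by
      intro y hy z hz hyX hzX hyz _
      rw [hTc]
      have h5 := hD y (by rw [hT] at hy; simp at hy; tauto) z (by rw [hT] at hz; simp at hz; tauto)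
        hyX hzX hyz
      simp only [List.mem_toFinset, List.mem_append, List.mem_singleton] at hy hz
      rcases hy with hy | rfl
      · have := loseP y hy
        rcases hz with hz | rfl
        · have := loseP z hz
          omega
        · omega
      · rcases hz with hz | rfl
        · have := loseP z hz
          omega
        · exact absurd rfl hyz)
    have hcl : cc.length = P.length + 1 := by rw [← hc.toFinset_card, hcT, hTc]
    have hdu : dg G S u ≤ dg G cc.toFinset u + 1 := by
      rw [hcT, hT]
      have h1 := dg_erase_not (G := G) (S := S) (v := u) (w := u) (by simp)
      have h2 := dg_erase_le (G := G) (S := S.erase u) (v := u) (w := qh)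
      omega
    apply hnp
    intro k hk3 hkn
    rcases Nat.lt_or_ge k S.card with hlt | hge
    swap
    · have : k = S.card := by omega
      subst this
      exact h.hasCyc
    have huc : u ∉ cc := by rw [← List.mem_toFinset, hcT, hT]; simp
    refine (ml hc huc (by omega) hk3 (by omega)).mono ?_
    rw [hcT, hT]
    intro v hv
    simp at hv
    rcases hv with rfl | hv
    · exact h.uS
    · exact hv.2.2
  · obtain ⟨P3, x', rfl⟩ := List.eq_nil_or_concat P2 |>.resolve_left hP2
    have e' : P = P1 ++ w :: P3 ∧ x = x' := by
      rw [show P1 ++ w :: (P3.concat x') = (P1 ++ w :: P3) ++ [x'] by simp] at e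
      have := List.append_inj' e rfl
      simpa using this
    obtain ⟨rfl, rfl⟩ := e'
    simp only [List.concat_eq_append] at hno
    have hperm : List.Perm (u :: (P1 ++ w :: (P3 ++ [x, qh]))) (u :: ((P1 ++ w :: P3) ++ x :: [qh])) := by
      simp
    have heq : (u :: (P1 ++ w :: (P3 ++ [x, qh]))) = (u :: ((P1 ++ w :: P3) ++ x :: [qh])) := by
      simp
    obtain ⟨p1', pl', qh', q1', h'⟩ := mk_cfg (G := G) (S := S) (u := u) (P := P1) (x := w)
      (Q := P3 ++ [x, qh]) (by rw [heq]; exact h.cyc) (by rw [heq]; exact h.hS) hP1 (by simp) (by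
        intro y hy z hz
        simp at hz
        rcases hz with hz | rfl | rfl
        · exact hno y hy z (by simp [hz])
        · exact hno y hy z (by simp)
        · exact h.no y (by simp [hy]) z (by simp))
    have eq1 : q1' = qh := by
      have := h'.hQ.2.2
      simpa using this.symm
    have ep1 : p1' = p1 := by
      have h1 := h'.hP.2.1
      have h2 := h.hP.2.1
      obtain ⟨a, l, rfl⟩ := List.exists_cons_of_ne_nil hP1
      simp at h1 h2
      exact h1.symm.trans h2
    subst eq1 ep1
    by_cases f1 : ∀ y ∈ P1, G.Adj u y
    · by_cases f2 : ∀ y ∈ P3 ++ [x, q1'], G.Adj u y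
      · exact hnp (h'.pa f1 f2 (h.three hd))
      · have hs := (h'.flip.easy hC hZ hD huX hnp hd hE (fun e => f2 (fun y hy => e y (List.mem_reverse.2 hy)))).1
        have hs : P1 = [p1'] := by simpa using congrArg List.reverse hs
        subst hs
        have hnR : ∀ y ∈ P3, ¬ G.Adj p1' y := fun y hy => hno p1' (by simp) y (by simp [hy])
        have hw : p' = w := by
          have h6 := h.F2p hC hp hq hp'P hp'1.symm up'
          simp at hp'P
          rcases hp'P with h7 | h7 | h7
          · exact absurd h7 hp'1
          · exact h7
          · exact absurd h6 (hnR _ h7)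
        subst hw
        exact caseSing h hC hZ hD huX hnp hd hnf up' hnR
    · have hs := (h'.easy hC hZ hD huX hnp hd hE f1).1
      have := congrArg List.length hs
      simp at this

theorem main_cfg (hC : HC G X) (hZ : HZ G X) (hD : HD G X S) (h2 : TwoC G S)
    (huS : u ∈ S) (huX : u ∈ X) (hd : S.card + 1 ≤ 2 * dg G S u) : Pan G S ∨ EB G X S u := by
  by_contra hcon
  push Not at hcon
  obtain ⟨hnp, hE⟩ := hcon
  have hH := hD.ham hC hZ h2
  obtain ⟨l, hl, hlS⟩ := hH
  obtain ⟨m, hm, hperm⟩ := hl.rotate_to (u := u) (by rw [← List.mem_toFinset, hlS]; exact huS)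
  have hmS : (u :: m).toFinset = S := by rw [List.toFinset_eq_of_perm _ _ hperm, hlS]
  obtain ⟨a, b, h3, h4, h5⟩ := hm.open_head
  have hml : m.length + 1 = S.card := by rw [← hmS, hm.toFinset_card]; simp
  have hfull : HasCyc G S S.card := Ham.hasCyc ⟨_, hm, hmS⟩
  have hS3 := h2.1
  have hm3 : 3 ≤ m.length := by
    by_contra hlt
    apply hnp
    intro k hk3 hkn
    have : k = S.card := by omega
    subst this
    exact hfull
  have hnd := hm.2.1
  rw [List.nodup_cons] at hnd
  rcases cut_lemma h3 hnd.2 hm3 with h6 | ⟨P, x, Q, rfl, hP, hQ, hno⟩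
  · have hmT : m.toFinset = S.erase u := by
      rw [← hmS, List.toFinset_cons, Finset.erase_insert (by simpa using hnd.1)]
    rw [hmT] at h6
    have hTc := Finset.card_erase_of_mem huS
    obtain ⟨cc, hc, hcT⟩ := ham (X := X) hC hZ h6 (by
      intro y hy z hz hyX hzX hyz _
      have h5 := hD y (Finset.mem_of_mem_erase hy) z (Finset.mem_of_mem_erase hz) hyX hzX hyz
      have h1 := dg_erase_le (G := G) (S := S) (v := y) (w := u)
      have h2 := dg_erase_le (G := G) (S := S) (v := z) (w := u)
      omega)
    have hcl : cc.length = S.card - 1 := by rw [← hc.toFinset_card, hcT, hTc]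
    have hdu : dg G S u = dg G cc.toFinset u := by
      rw [hcT, dg_erase_not (by simp)]
    apply hnp
    intro k hk3 hkn
    have huc : u ∉ cc := by rw [← List.mem_toFinset, hcT]; simp
    refine (ml hc huc (by omega) hk3 (by omega)).mono ?_
    rw [hcT, Finset.insert_erase huS]
  · obtain ⟨p1, pl, qh, q1, h⟩ := mk_cfg hm hmS hP hQ hno
    by_cases f1 : ∀ y ∈ P, G.Adj u y
    · by_cases f2 : ∀ y ∈ Q, G.Adj u y
      · exact hnp (h.pa f1 f2 (h.three hd))
      · exact h.flip.caseC1 hC hZ hD huX hnp hd hE (by simpa using f2)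
    · exact h.caseC1 hC hZ hD huX hnp hd hE f1

end Main
end Panc

namespace Panc
open scoped Classical

section Final
variable {V : Type} {G : SimpleGraph V} {X : Set V} {S : Finset V}
variable {u x p1 pl qh q1 y : V} {P Q : List V}

theorem conn_star {T R : Finset V} {t : V} (hT : Conn G T) (ht : t ∈ T) (hR : ∀ r ∈ R, G.Adj t r) :
    Conn G (T ∪ R) := by
  induction R using Finset.induction_on with
  | empty => simpa using hT
  | insert a R ha ih =>
    have h1 := ih (fun r hr => hR r (by simp [hr]))
    have h2 := h1.union (conn_singleton a) (x := t) (y := a) (by simp [ht]) (by simp) (hR a (by simp))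
    have : T ∪ insert a R = (T ∪ R) ∪ {a} := by ext v; simp
    rwa [this]

theorem CB.nbr (h : CB G X S u P x Q p1 pl qh q1 y) {q v : V} (hq : q ∈ Q) (hv : v ∈ S)
    (hqv : G.Adj q v) : v ∈ Q ∨ v = u ∨ v = x := by
  rw [h.cf.mem] at hv
  rcases hv with hv | hv | hv | hv
  · tauto
  · exact absurd hqv.symm (h.cf.no _ hv _ hq)
  · tauto
  · tauto

theorem CB.twin (h : CB G X S u P x Q p1 pl qh q1 y) {q w : V} (hq : q ∈ Q) (hw : w ∈ Q)
    (hx : G.Adj x q → G.Adj x w) {v : V} (hv : v ∈ S) (hvw : v ≠ w) (hqv : G.Adj q v) :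
    G.Adj w v := by
  rcases h.nbr hq hv hqv with h1 | rfl | rfl
  · exact h.Qc w hw v h1 hvw.symm
  · exact (h.uQ w hw).symm
  · exact (hx hqv.symm).symm

theorem CB.conn2 (h : CB G X S u P x Q p1 pl qh q1 y) {q w : V} (hq : q ∈ Q) (hw : w ∈ Q) :
    Conn G ((S.erase w).erase q) := by
  have h1 : Conn G (u :: (P ++ [x])).toFinset :=
    (Pth.cons h.cf.up (h.cf.hP.append h.cf.px (Pth.single x))).conn
  have h2 := conn_star (R := (Q.toFinset.erase w).erase q) (t := u) h1 (by simp) (fun r hr => by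
    simp at hr; exact h.uQ r hr.2.2)
  convert h2 using 1
  ext v
  simp only [Finset.mem_erase, h.cf.mem, Finset.mem_union, List.mem_toFinset, List.mem_cons,
    List.mem_append, List.not_mem_nil, or_false]
  constructor
  · tauto
  · have aux : ∀ q ∈ Q, (v = u ∨ v ∈ P ∨ v = x) → v ≠ q := by
      intro q hq hv e
      subst e
      rcases hv with rfl | hv | rfl
      · exact h.cf.uQ hq
      · exact h.cf.PQ hv hq rfl
      · exact h.cf.xQ hq
    have := aux q hq
    have := aux w hw
    tauto

theorem CB.exists_other (h : CB G X S u P x Q p1 pl qh q1 y) (q : V) : ∃ w ∈ Q, w ≠ q := by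
  by_contra hcon
  push Not at hcon
  have := eq_single h.cf.ndQ h.cf.hQ.ne_nil hcon
  have h2 := h.Q2
  rw [this] at h2
  simp at h2

theorem twoC_erase {T : Finset V} (h : TwoC G T) {f w : V} (hf : f ∈ T) (hw : w ∈ T) (hfw : f ≠ w)
    (h4 : 4 ≤ T.card) (hN : ∀ v ∈ T, v ≠ w → G.Adj f v → G.Adj w v)
    (hc : Conn G ((T.erase w).erase f)) : TwoC G (T.erase f) := by
  refine ⟨by rw [Finset.card_erase_of_mem hf]; omega, ?_⟩
  intro z hz
  rw [Finset.erase_right_comm]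
  by_cases hzw : z = w
  · subst hzw; exact hc
  · apply twin_conn (h.2 z (Finset.mem_of_mem_erase hz)) (w := w) (by
      simp at hz; simp [hf]; exact Ne.symm hz.1) (by simp [hw]; exact Ne.symm hzw) hfw
    intro v hv
    exact hN v (Finset.mem_of_mem_erase hv)

theorem CB.card4 (h : CB G X S u P x Q p1 pl qh q1 y) : 5 ≤ S.card := by
  have := h.cf.card
  have := h.Q2
  have := List.length_pos_iff.2 h.cf.hP.ne_nil
  omega

theorem CB.twoC (h : CB G X S u P x Q p1 pl qh q1 y) (h2 : TwoC G S) {q : V} (hq : q ∈ Q)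
    (hx : G.Adj x q → ∀ w ∈ Q, G.Adj x w) : TwoC G (S.erase q) := by
  obtain ⟨w, hw, hwq⟩ := h.exists_other q
  exact twoC_erase h2 (h.cf.QS hq) (h.cf.QS hw) hwq.symm (by have := h.card4; omega)
    (fun v hv hvw hqv => h.twin hq hw (fun e => hx e w hw) hv hvw hqv) (h.conn2 hq hw)

theorem CB.une (h : CB G X S u P x Q p1 pl qh q1 y) : u ≠ y := h.uy.ne
theorem CB.xne (h : CB G X S u P x Q p1 pl qh q1 y) : x ≠ y := fun e => h.cf.xP (e ▸ h.yP)

theorem exists_heavy (hD : HD G X S) {a b : V} (ha : a ∈ S) (hb : b ∈ S) (aX : a ∈ X) (bX : b ∈ X)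
    (hab : a ≠ b) : ∃ u ∈ S, u ∈ X ∧ S.card + 1 ≤ 2 * dg G S u := by
  have := hD a ha b hb aX bX hab
  rcases Nat.lt_or_ge (2 * dg G S a) (S.card + 1) with h | h
  · exact ⟨b, hb, bX, by omega⟩
  · exact ⟨a, ha, aX, h⟩

theorem CB.obst (h : CB G X S u P x Q p1 pl qh q1 y) (hC : HC G X) (hZ : HZ G X) (hD : HD G X S)
    (h2 : TwoC G S) (huX : u ∈ X)
    (IH : ∀ T : Finset V, T.card < S.card → TwoC G T → HD G X T →
      (∃ u ∈ T, u ∈ X ∧ T.card + 1 ≤ 2 * dg G T u) → Pan G T) (hnp : ¬ Pan G S) :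
    x ∈ X ∧ (∀ q ∈ Q, G.Adj x q) ∧ dg G S u + dg G S x ≤ S.card + 1 := by
  by_contra hcon
  apply hnp
  have hchoose : ∃ q ∈ Q, (G.Adj x q → ∀ w ∈ Q, G.Adj x w) := by
    by_cases hall : ∀ w ∈ Q, G.Adj x w
    · exact ⟨q1, h.cf.hQ.last_mem, fun _ => hall⟩
    · have := hall
      push Not at this
      obtain ⟨q, hq, hxq⟩ := this
      exact ⟨q, hq, fun e => absurd e hxq⟩
  obtain ⟨q, hq, hxq⟩ := hchoose
  have hqS := h.cf.QS hq
  have hT2 := h.twoC h2 hq hxq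
  have hTc := Finset.card_erase_of_mem hqS
  have hqX := h.Ql q hq
  have hpos := h.card4
  have hadj : ∀ v ∈ S, v ∈ X → G.Adj v q → v = u ∨ v = x := by
    intro v hv hvX hvq
    rcases h.nbr hq hv hvq.symm with h1 | h1
    · exact absurd hvX (h.Ql v h1)
    · exact h1
  have hxu : x ∈ X → G.Adj x q → S.card + 2 ≤ dg G S u + dg G S x := by
    intro xX xq
    by_contra hlt
    exact hcon ⟨xX, hxq xq, by omega⟩
  have hDT : HD G X (S.erase q) := by
    intro a ha b hb aX bX hab
    have haS := Finset.mem_of_mem_erase ha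
    have hbS := Finset.mem_of_mem_erase hb
    have h5 := hD a haS b hbS aX bX hab
    have la := dg_erase_le (G := G) (S := S) (v := a) (w := q)
    have lb := dg_erase_le (G := G) (S := S) (v := b) (w := q)
    by_cases aq : G.Adj a q
    · by_cases bq : G.Adj b q
      · rcases hadj a haS aX aq with rfl | rfl
        · rcases hadj b hbS bX bq with rfl | rfl
          · exact absurd rfl hab
          · have := hxu bX bq; omega
        · rcases hadj b hbS bX bq with rfl | rfl
          · have := hxu aX aq; omega
          · exact absurd rfl hab
      · have := dg_erase_not (G := G) (S := S) bq
        omega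
    · have := dg_erase_not (G := G) (S := S) aq
      omega
  have hP := IH (S.erase q) (Finset.card_erase_lt_of_mem hqS) hT2 hDT
    (exists_heavy hDT (a := u) (b := y) (by simp [h.cf.uS]; exact (h.uQ q hq).ne)
      (by simp [h.cf.PS h.yP]; exact fun e => hqX (e ▸ h.yX)) huX h.yX h.une)
  intro k hk3 hkn
  rcases Nat.lt_or_ge k S.card with hlt | hge
  · exact (hP k hk3 (by omega)).mono (Finset.erase_subset _ _)
  · have : k = S.card := by omega
    subst this
    exact (hD.ham hC hZ h2).hasCyc

set_option maxHeartbeats 4000000 in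
theorem center (hC : HC G X) (hZ : HZ G X) (hD : HD G X S) (h2 : TwoC G S) {a b c : V}
    {A B : Finset V} (ha : a ∈ S) (hb : b ∈ S) (hc : c ∈ S) (hab : a ≠ b) (hac : a ≠ c) (hbc : b ≠ c)
    (hAS : A ⊆ S) (hBS : B ⊆ S) (hdis : ∀ v ∈ A, v ∉ B) (hAX : ∀ v ∈ A, v ∉ X) (hBX : ∀ v ∈ B, v ∉ X)
    (hA2 : 2 ≤ A.card) (hB2 : 2 ≤ B.card)
    (hAc : ∀ v ∈ A, ∀ w ∈ A, v ≠ w → G.Adj v w) (hBc : ∀ v ∈ B, ∀ w ∈ B, v ≠ w → G.Adj v w)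
    (hAN : ∀ v ∈ A, ∀ w ∈ S, G.Adj v w → w ∈ A ∨ w = a ∨ w = c)
    (hBN : ∀ v ∈ B, ∀ w ∈ S, G.Adj v w → w ∈ B ∨ w = b ∨ w = c)
    (hAa : ∀ v ∈ A, G.Adj v a) (hAcc : ∀ v ∈ A, G.Adj v c) (hBb : ∀ v ∈ B, G.Adj v b)
    (hBcc : ∀ v ∈ B, G.Adj v c) (haB : a ∉ B) (hbA : b ∉ A) (cX : c ∈ X) :
    S.card + 2 ≤ dg G S a + dg G S c := by
  have haA : a ∉ A := fun h => (hAa a h).ne rfl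
  have hcA : c ∉ A := fun h => (hAcc c h).ne rfl
  have hbB : b ∉ B := fun h => (hBb b h).ne rfl
  have hcB : c ∉ B := fun h => (hBcc c h).ne rfl
  obtain ⟨q, hq, q2, hq2, hqq⟩ := Finset.one_lt_card.1 (show 1 < A.card by omega)
  obtain ⟨f, hf, f2, hf2, hff⟩ := Finset.one_lt_card.1 (show 1 < B.card by omega)
  have nAB : ∀ v ∈ A, ∀ w ∈ B, ¬ G.Adj v w := by
    intro v hv w hw e
    rcases hAN v hv w (hBS hw) e with h | rfl | rfl
    · exact hdis w h hw
    · exact haB hw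
    · exact hcB hw
  have nBa : ∀ v ∈ B, ¬ G.Adj v a := by
    intro v hv e
    rcases hBN v hv a ha e with h | h | h
    · exact haB h
    · exact hab h
    · exact hac h
  have nAb : ∀ v ∈ A, ¬ G.Adj v b := by
    intro v hv e
    rcases hAN v hv b hb e with h | h | h
    · exact hbA h
    · exact hab h.symm
    · exact hbc h
  have ca : G.Adj c a := by
    by_contra hn
    have := hZ f f2 c q a (hBc f hf f2 hf2 hff) (hBcc f hf) (hBcc f2 hf2) (hAcc q hq).symm (hAa q hq)
      (fun e => nAB q hq f hf e.symm) (fun e => nAB q hq f2 hf2 e.symm) (nBa f hf) (nBa f2 hf2) hn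
    have := hAX q hq
    have := hBX f hf
    tauto
  have cb : G.Adj c b := by
    by_contra hn
    have := hZ q q2 c f b (hAc q hq q2 hq2 hqq) (hAcc q hq) (hAcc q2 hq2) (hBcc f hf).symm (hBb f hf)
      (nAB q hq f hf) (nAB q2 hq2 f hf) (nAb q hq) (nAb q2 hq2) hn
    have := hAX q hq
    have := hBX f hf
    tauto
  have Nc : ∀ w ∈ S, G.Adj c w → w ∈ A ∨ w ∈ B ∨ w = a ∨ w = b := by
    intro w hw cw
    by_contra hcon
    push Not at hcon
    obtain ⟨h1, h3, h4, h5⟩ := hcon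
    have := hC c q f w (hAcc q hq).symm (hBcc f hf).symm cw (fun e => hdis q hq (e ▸ hf))
      (fun e => h1 (e ▸ hq)) (fun e => h3 (e ▸ hf)) (nAB q hq f hf)
      (fun e => by have := hAN q hq w hw e; have := cw.ne'; tauto)
      (fun e => by have := hBN f hf w hw e; have := cw.ne'; tauto)
    have := hAX q hq
    have := hBX f hf
    tauto
  set D : Finset V := insert a (insert b (insert c (A ∪ B))) with hDdef
  have hDc : D.card = A.card + B.card + 3 := by
    rw [hDdef, Finset.card_insert_of_notMem (by simp; tauto),
      Finset.card_insert_of_notMem (by simp; tauto), Finset.card_insert_of_notMem (by simp; tauto),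
      Finset.card_union_of_disjoint (Finset.disjoint_left.2 hdis)]
  have hDS : D ⊆ S := by
    intro v hv
    simp [hDdef] at hv
    rcases hv with rfl | rfl | rfl | hv | hv
    · exact ha
    · exact hb
    · exact hc
    · exact hAS hv
    · exact hBS hv
  set R := S \ D with hR
  have hRc : R.card + D.card = S.card := Finset.card_sdiff_add_card_eq_card hDS
  have hmR : ∀ v, v ∈ R ↔ v ∈ S ∧ v ≠ a ∧ v ≠ b ∧ v ≠ c ∧ v ∉ A ∧ v ∉ B := by
    intro v; simp [hR, hDdef]
  have hdR : ∀ v ∈ R, ∀ w ∈ S, G.Adj v w → w ∈ R ∨ w = a ∨ w = b := by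
    intro v hv w hw vw
    obtain ⟨v1, v2, v3, v4, v5, v6⟩ := (hmR v).1 hv
    rw [hmR]
    have n1 : w ∉ A := fun hwA => by have := hAN w hwA v v1 vw.symm; tauto
    have n2 : w ∉ B := fun hwB => by have := hBN w hwB v v1 vw.symm; tauto
    have n3 : w ≠ c := by rintro rfl; have := Nc v v1 vw.symm; tauto
    tauto
  have hRX : ∀ v ∈ R, v ∉ X := by
    intro v hv vX
    have h3 := (hmR v).1 hv
    have h1 := hD c hc v h3.1 cX vX (Ne.symm h3.2.2.2.1)
    have d1 : dg G S v ≤ (insert a (insert b (R.erase v))).card := by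
      apply dg_le_of
      intro t ht vt
      have := hdR v hv t ht vt
      have := vt.ne'
      simp; tauto
    have d2 : dg G S c ≤ (insert a (insert b (A ∪ B))).card := by
      apply dg_le_of
      intro t ht vt
      have := Nc t ht vt
      simp; tauto
    have e1 := Finset.card_insert_le a (insert b (R.erase v))
    have e2 := Finset.card_insert_le b (R.erase v)
    have e3 := Finset.card_insert_le a (insert b (A ∪ B))
    have e4 := Finset.card_insert_le b (A ∪ B)
    have e5 := Finset.card_union_le A B
    have e6 := Finset.card_erase_of_mem hv
    have e7 := Finset.card_pos.2 ⟨v, hv⟩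
    omega
  have hRa : ∀ v ∈ R, G.Adj a v := by
    by_contra hcon
    push Not at hcon
    obtain ⟨α0, hα0, hn0⟩ := hcon
    obtain ⟨α, hα, hα1, β, hβ, hβ1, αβ⟩ := (h2.2 b hb).mono_edges
      (A := R.filter (fun v => ¬ G.Adj a v)) (a := α0) (b := a) (by simp [hα0, hn0])
      (by have := (hmR α0).1 hα0; simp; tauto) (by simp [ha, hab]) (by simp [hmR])
    simp only [Finset.mem_filter] at hα hβ1
    simp only [Finset.mem_erase] at hβ
    have hβR : β ∈ R := by
      rcases hdR α hα.1 β hβ.2 αβ with h | rfl | rfl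
      · exact h
      · exact absurd αβ.symm hα.2
      · exact absurd rfl hβ.1
    have aβ : G.Adj a β := by tauto
    have nn : ∀ v ∈ A, ∀ w ∈ R, ¬ G.Adj v w := by
      intro v hv w hw e
      have h3 := (hmR w).1 hw
      have := hAN v hv w h3.1 e
      tauto
    have := hZ q q2 a β α (hAc q hq q2 hq2 hqq) (hAa q hq) (hAa q2 hq2) aβ αβ.symm (nn q hq β hβR)
      (nn q2 hq2 β hβR) (nn q hq α hα.1) (nn q2 hq2 α hα.1) hα.2
    have := hRX β hβR
    have := hAX q hq
    tauto
  have c1 : (insert c (A ∪ R)).card ≤ dg G S a := by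
    apply le_dg_of
    · intro t ht
      simp at ht
      rcases ht with rfl | ht | ht
      · exact hc
      · exact hAS ht
      · exact ((hmR t).1 ht).1
    · intro t ht
      simp at ht
      rcases ht with rfl | ht | ht
      · exact ca.symm
      · exact (hAa t ht).symm
      · exact hRa t ht
  have c2 : (insert a (insert b (A ∪ B))).card ≤ dg G S c := by
    apply le_dg_of
    · intro t ht
      simp at ht
      rcases ht with rfl | rfl | ht | ht
      · exact ha
      · exact hb
      · exact hAS ht
      · exact hBS ht
    · intro t ht
      simp at ht
      rcases ht with rfl | rfl | ht | ht
      · exact ca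
      · exact cb
      · exact (hAcc t ht).symm
      · exact (hBcc t ht).symm
  rw [Finset.card_insert_of_notMem (by simp [hmR]; exact hcA),
    Finset.card_union_of_disjoint (Finset.disjoint_left.2 (by
      intro v hv hvR; exact ((hmR v).1 hvR).2.2.2.2.1 hv))] at c1
  rw [Finset.card_insert_of_notMem (by simp; tauto),
    Finset.card_insert_of_notMem (by simp; tauto),
    Finset.card_union_of_disjoint (Finset.disjoint_left.2 hdis)] at c2
  omega

set_option maxHeartbeats 1000000 in
theorem tD (hC : HC G X) (hZ : HZ G X) (n : ℕ) : ∀ S : Finset V, S.card = n → TwoC G S → HD G X S →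
    (∃ u ∈ S, u ∈ X ∧ S.card + 1 ≤ 2 * dg G S u) → Pan G S := by
  induction n using Nat.strong_induction_on with
  | _ n IH0 =>
  rintro S hn h2 hD ⟨u, huS, huX, hd⟩
  have IH : ∀ T : Finset V, T.card < S.card → TwoC G T → HD G X T →
      (∃ u ∈ T, u ∈ X ∧ T.card + 1 ≤ 2 * dg G T u) → Pan G T :=
    fun T hT => IH0 T.card (by omega) T rfl
  by_contra hnp
  obtain ⟨P, x, Q, p1, pl, qh, q1, y, h⟩ := (main_cfg hC hZ hD h2 huS huX hd).resolve_left hnp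
  obtain ⟨xX, xQ, hsum⟩ := h.obst hC hZ hD h2 huX IH hnp
  have yS := h.cf.PS h.yP
  have xS := h.cf.xS
  have hyd : S.card + 1 ≤ 2 * dg G S y := by
    have := hD y yS x xS h.yX xX h.xne.symm
    omega
  obtain ⟨P', x', Q', p1', pl', qh', q1', y', h'⟩ :=
    (main_cfg hC hZ hD h2 yS h.yX hyd).resolve_left hnp
  obtain ⟨xX', xQ', hsum'⟩ := h'.obst hC hZ hD h2 h.yX IH hnp
  have hdis : ∀ v ∈ Q, v ∉ Q' := fun v hv hv' => h.cf.no y h.yP v hv (h'.uQ v hv')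
  have cQ : Q.toFinset.card = Q.length := List.toFinset_card_of_nodup h.cf.ndQ
  have cQ' : Q'.toFinset.card = Q'.length := List.toFinset_card_of_nodup h'.cf.ndQ
  have xS' := h'.cf.xS
  have hxy' : y ≠ x' := h'.cf.ux
  have hsum1 := hD u huS x xS huX xX h.cf.ux
  by_cases e1 : x' = x
  · subst e1
    have := center hC hZ hD h2 (a := u) (b := y) (c := x') (A := Q.toFinset) (B := Q'.toFinset) huS yS
      xS h.une h.cf.ux hxy' (fun v hv => h.cf.QS (by simpa using hv))
      (fun v hv => h'.cf.QS (by simpa using hv)) (by simpa using hdis) (by simpa using h.Ql)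
      (by simpa using h'.Ql) (by rw [cQ]; exact h.Q2) (by rw [cQ']; exact h'.Q2)
      (by simpa using h.Qc) (by simpa using h'.Qc)
      (fun v hv w hw e => by
        have := h.nbr (by simpa using hv) hw e
        simpa using this)
      (fun v hv w hw e => by
        have := h'.nbr (by simpa using hv) hw e
        simpa using this)
      (fun v hv => (h.uQ v (by simpa using hv)).symm) (fun v hv => (xQ v (by simpa using hv)).symm)
      (fun v hv => (h'.uQ v (by simpa using hv)).symm) (fun v hv => (xQ' v (by simpa using hv)).symm)
      (fun e => h'.Ql u (by simpa using e) huX) (fun e => h.Ql y (by simpa using e) h.yX) xX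
    omega
  by_cases e2 : x' = u
  · subst e2
    have := center hC hZ hD h2 (a := x) (b := y) (c := x') (A := Q.toFinset) (B := Q'.toFinset) xS yS
      huS h.xne h.cf.ux.symm hxy' (fun v hv => h.cf.QS (by simpa using hv))
      (fun v hv => h'.cf.QS (by simpa using hv)) (by simpa using hdis) (by simpa using h.Ql)
      (by simpa using h'.Ql) (by rw [cQ]; exact h.Q2) (by rw [cQ']; exact h'.Q2)
      (by simpa using h.Qc) (by simpa using h'.Qc)
      (fun v hv w hw e => by
        have := h.nbr (by simpa using hv) hw e
        simp only [List.mem_toFinset]; tauto)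
      (fun v hv w hw e => by
        have := h'.nbr (by simpa using hv) hw e
        simpa using this)
      (fun v hv => (xQ v (by simpa using hv)).symm) (fun v hv => (h.uQ v (by simpa using hv)).symm)
      (fun v hv => (h'.uQ v (by simpa using hv)).symm) (fun v hv => (xQ' v (by simpa using hv)).symm)
      (fun e => h'.Ql x (by simpa using e) xX) (fun e => h.Ql y (by simpa using e) h.yX) huX
    omega
  -- delete a vertex from each of the two cliques
  apply hnp
  have hq := h.cf.hQ.last_mem
  have hf := h'.cf.hQ.last_mem
  obtain ⟨w, hw, hwq⟩ := h.exists_other q1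
  obtain ⟨w', hw', hwf⟩ := h'.exists_other q1'
  have qS := h.cf.QS hq
  have fS := h'.cf.QS hf
  have qf : q1 ≠ q1' := fun e => hdis q1 hq (e ▸ hf)
  have hT1 := h.twoC h2 hq (fun _ => xQ)
  have hc1 := Finset.card_erase_of_mem qS
  have fT : q1' ∈ S.erase q1 := by simp [fS, qf.symm]
  have hc2 := Finset.card_erase_of_mem fT
  have hn5 := h.card4
  have hn4 : 5 ≤ S.card → 4 ≤ (S.erase q1).card := by omega
  have hT2 : TwoC G ((S.erase q1).erase q1') := by
    apply twoC_erase hT1 fT (w := w') (by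
      simp [h'.cf.QS hw']; rintro rfl; exact hdis _ hq hw') hwf.symm (by omega)
    · intro v hv hvw e
      exact h'.twin hf hw' (fun _ => xQ' w' hw') (Finset.mem_of_mem_erase hv) hvw e
    · have k1 := h'.conn2 hf hw'
      have k2 := twin_conn k1 (q := q1) (w := w) (by
        simp [qS, qf]; rintro rfl; exact hdis _ hq hw') (by
        simp [h.cf.QS hw]; exact ⟨fun e => hdis _ hw (e ▸ hf), fun e => hdis _ hw (e ▸ hw')⟩) hwq.symm
        (fun v hv hvw e => h.twin hq hw (fun _ => xQ w hw)
          (Finset.mem_of_mem_erase (Finset.mem_of_mem_erase hv)) hvw e)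
      convert k2 using 1
      ext v
      simp only [Finset.mem_erase]
      tauto
  have adj1 : ∀ v ∈ S, v ∈ X → G.Adj v q1 → v = u ∨ v = x := by
    intro v hv hvX e
    rcases h.nbr hq hv e.symm with h1 | h1
    · exact absurd hvX (h.Ql v h1)
    · exact h1
  have adj2 : ∀ v ∈ S, v ∈ X → G.Adj v q1' → v = y ∨ v = x' := by
    intro v hv hvX e
    rcases h'.nbr hf hv e.symm with h1 | h1
    · exact absurd hvX (h'.Ql v h1)
    · exact h1
  have lose : ∀ v ∈ S, v ∈ X → dg G S v ≤ dg G ((S.erase q1).erase q1') v + 1 := by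
    intro v hv hvX
    by_cases a1 : G.Adj v q1
    · have a2 : ¬ G.Adj v q1' := by
        intro a2
        have b1 := adj1 v hv hvX a1
        have b2 := adj2 v hv hvX a2
        have := h.une
        have := h.xne
        rcases b1 with rfl | rfl <;> rcases b2 with b2 | b2 <;> tauto
      rw [dg_erase_not a2]
      exact dg_erase_le
    · rw [← dg_erase_not (S := S) a1]
      exact dg_erase_le
  have hDT : HD G X ((S.erase q1).erase q1') := by
    intro a ha b hb aX bX hab
    have haS := Finset.mem_of_mem_erase (Finset.mem_of_mem_erase ha)
    have hbS := Finset.mem_of_mem_erase (Finset.mem_of_mem_erase hb)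
    have := hD a haS b hbS aX bX hab
    have := lose a haS aX
    have := lose b hbS bX
    omega
  have hneX : ∀ v ∈ S, v ∈ X → v ∈ (S.erase q1).erase q1' := by
    intro v hv hvX
    simp only [Finset.mem_erase]
    exact ⟨fun e => h'.Ql _ hf (e ▸ hvX), fun e => h.Ql _ hq (e ▸ hvX), hv⟩
  have hPan := IH _ (by omega) hT2 hDT (exists_heavy hDT (hneX u huS huX) (hneX y yS h.yX) huX h.yX h.une)
  have hH1 : Ham G (S.erase q1) := by
    refine ham (X := X) hC hZ hT1 ?_
    intro a ha b hb aX bX hab _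
    have := hD a (Finset.mem_of_mem_erase ha) b (Finset.mem_of_mem_erase hb) aX bX hab
    have la := dg_erase_le (G := G) (S := S) (v := a) (w := q1)
    have lb := dg_erase_le (G := G) (S := S) (v := b) (w := q1)
    omega
  intro k hk3 hkn
  have hk : k ≤ ((S.erase q1).erase q1').card ∨ k = (S.erase q1).card ∨ k = S.card := by omega
  rcases hk with hk | rfl | rfl
  · exact (hPan k hk3 hk).mono ((Finset.erase_subset _ _).trans (Finset.erase_subset _ _))
  · exact hH1.hasCyc.mono (Finset.erase_subset _ _)
  · exact (hD.ham hC hZ h2).hasCyc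

end Final
end Panc

namespace Panc
open scoped Classical

section Top
variable {V : Type} {G : SimpleGraph V}

theorem dist_two {W : Type} {R : SimpleGraph W} {a b c : W} (hab : a ≠ b) (hn : ¬ R.Adj a b)
    (h1 : R.Adj a c) (h2 : R.Adj c b) : R.dist a b = 2 := by
  have hle : R.dist a b ≤ 2 := SimpleGraph.dist_le (Walk.cons h1 (Walk.cons h2 Walk.nil))
  have hr : R.Reachable a b := ⟨Walk.cons h1 (Walk.cons h2 Walk.nil)⟩
  have h0 : R.dist a b ≠ 0 := fun h => hab (hr.dist_eq_zero_iff.1 h)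
  have h1' : R.dist a b ≠ 1 := fun h => hn (SimpleGraph.dist_eq_one_iff_adj.1 h)
  omega

theorem use_heavy [Fintype V] [DecidableRel G.Adj] {W U : Type} {S : SimpleGraph W}
    {R : SimpleGraph U} (hS : F1Heavy G S) (e : S ≃g R) (f : R ↪g G) {a b : U} (c : U) (hab : a ≠ b)
    (hn : ¬ R.Adj a b) (h1 : R.Adj a c) (h2 : R.Adj c b) :
    Fintype.card V + 1 ≤ 2 * G.degree (f a) ∨ Fintype.card V + 1 ≤ 2 * G.degree (f b) := by
  have := hS (f.comp e.toEmbedding) (e.symm a) (e.symm b)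
    (dist_two (c := e.symm c) (by simpa using hab) (fun h => hn (e.symm.map_adj_iff.1 h)) (e.symm.map_adj_iff.2 h1)
      (e.symm.map_adj_iff.2 h2))
  have ea : (f.comp e.toEmbedding) (e.symm a) = f a := by simp
  have eb : (f.comp e.toEmbedding) (e.symm b) = f b := by simp
  rw [ea, eb] at this
  rcases max_choice (G.degree (f a)) (G.degree (f b)) with h | h <;> rw [h] at this
  · exact Or.inl this
  · exact Or.inr this

/-- embedding from a vertex map -/
def mkEmb {U : Type} {R : SimpleGraph U} (g : U → V) (hi : Function.Injective g)
    (hg : ∀ i j, G.Adj (g i) (g j) ↔ R.Adj i j) : R ↪g G := ⟨⟨g, hi⟩, hg _ _⟩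

/-- heavy vertices -/
def HX [Fintype V] (G : SimpleGraph V) [DecidableRel G.Adj] : Set V :=
  {v | Fintype.card V + 1 ≤ 2 * G.degree v}

theorem mkHC [Fintype V] [DecidableRel G.Adj] (h : F1Heavy G claw) : HC G (HX G) := by
  intro c a b e ca cb ce ab ae be nab nae nbe
  have nba : ¬ G.Adj b a := fun h => nab h.symm
  have nea : ¬ G.Adj e a := fun h => nae h.symm
  have neb : ¬ G.Adj e b := fun h => nbe h.symm
  let f : claw ↪g G := mkEmb ![c, a, b, e] (by
    have := ca.ne; have := cb.ne; have := ce.ne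
    intro i j; fin_cases i <;> fin_cases j <;> simp <;> grind) (by
    intro i j
    fin_cases i <;> fin_cases j <;> simp [claw, ca, cb, ce, ca.symm, cb.symm, ce.symm, nab, nae, nbe, nba, nea, neb])
  have := use_heavy h (SimpleGraph.Iso.refl) f (a := 1) (b := 2) 0 (by decide) (by simp [claw])
    (by simp [claw]) (by simp [claw])
  exact this

theorem mkHZ [Fintype V] [DecidableRel G.Adj] {W : Type} {S : SimpleGraph W}
    (hS : Nonempty (S ≃g pathGraph 4) ∨ Nonempty (S ≃g Zgraph 1) ∨ Nonempty (S ≃g Zgraph 2))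
    (h : F1Heavy G S) : HZ G (HX G) := by
  intro a b c d e ab ac bc cd de nad nbd nae nbe nce
  have nda : ¬ G.Adj d a := fun h => nad h.symm
  have ndb : ¬ G.Adj d b := fun h => nbd h.symm
  have nea : ¬ G.Adj e a := fun h => nae h.symm
  have neb : ¬ G.Adj e b := fun h => nbe h.symm
  have nec : ¬ G.Adj e c := fun h => nce h.symm
  have dab := ab.ne
  have dac := ac.ne
  have dbc := bc.ne
  have dcd := cd.ne
  have dde := de.ne
  have dad : a ≠ d := by rintro rfl; exact nbd ab.symm
  have dbd : b ≠ d := by rintro rfl; exact nad ab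
  have dae : a ≠ e := by rintro rfl; exact nbe ab.symm
  have dbe : b ≠ e := by rintro rfl; exact nae ab
  have dce : c ≠ e := by rintro rfl; exact nae ac
  apply Or.symm
  rcases hS with ⟨⟨i⟩⟩ | ⟨⟨i⟩⟩ | ⟨⟨i⟩⟩
  · let f : pathGraph 4 ↪g G := mkEmb ![a, c, d, e] (by
      intro i j; fin_cases i <;> fin_cases j <;> simp <;> grind) (by
      intro i j
      fin_cases i <;> fin_cases j <;> simp [pathGraph_adj, *] <;> grind [G.adj_comm])
    exact use_heavy h i f (a := 0) (b := 2) 1 (by decide) (by simp [pathGraph_adj])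
      (by simp [pathGraph_adj]) (by simp [pathGraph_adj])
  · let f : Zgraph 1 ↪g G := mkEmb ![a, b, c, d] (by
      intro i j; fin_cases i <;> fin_cases j <;> simp <;> grind) (by
      intro i j
      fin_cases i <;> fin_cases j <;> simp [Zgraph, *] <;> grind [G.adj_comm])
    exact use_heavy h i f (a := 0) (b := 3) 2 (by decide) (by simp [Zgraph])
      (by simp [Zgraph]) (by simp [Zgraph])
  · let f : Zgraph 2 ↪g G := mkEmb ![a, b, c, d, e] (by
      intro i j; fin_cases i <;> fin_cases j <;> simp <;> grind) (by
      intro i j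
      fin_cases i <;> fin_cases j <;> simp [Zgraph, *] <;> grind [G.adj_comm])
    exact use_heavy h i f (a := 0) (b := 3) 2 (by decide) (by simp [Zgraph])
      (by simp [Zgraph]) (by simp [Zgraph])

theorem dg_univ [Fintype V] [DecidableRel G.Adj] (v : V) : dg G Finset.univ v = G.degree v := by
  unfold dg
  rw [← SimpleGraph.card_neighborFinset_eq_degree]
  congr 1
  ext w
  simp

theorem walk_stay {W : Type} {H : SimpleGraph W} {A : Set W}
    (hA : ∀ a ∈ A, ∀ b, H.Adj a b → b ∈ A) {a b : W} (p : H.Walk a b) (ha : a ∈ A) : b ∈ A := by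
  induction p with
  | nil => exact ha
  | cons h p ih => exact ih (hA _ ha _ h)

theorem mkTwoC [Fintype V] (h : TwoConnected G) : TwoC G Finset.univ := by
  refine ⟨by simpa using h.1, ?_⟩
  intro z _ A hA ⟨a, ha⟩ hcl b hb
  have haz : a ≠ z := by simpa using hA ha
  have hbz : b ≠ z := by simpa using hb
  obtain ⟨p⟩ := (h.2 z).preconnected ⟨a, haz⟩ ⟨b, hbz⟩
  refine walk_stay (A := {x : {u : V | u ≠ z} | x.1 ∈ A}) ?_ p ha
  intro x hx y hxy
  by_contra hy
  exact hcl x.1 hx y.1 (Finset.mem_erase.2 ⟨y.2, Finset.mem_univ _⟩) hy (by simpa using hxy)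

theorem mkConn [Fintype V] (h : TwoConnected G) : G.Connected := by
  have hc := h.1
  have : Nonempty V := Fintype.card_pos_iff.1 (by omega)
  refine ⟨?_⟩
  intro a b
  obtain ⟨z, hz⟩ : ∃ z, z ∉ ({a, b} : Finset V) := by
    by_contra hh
    push Not at hh
    have h1 : (Finset.univ : Finset V) ⊆ {a, b} := fun x _ => hh x
    have := Finset.card_le_card h1
    have := Finset.card_le_two (a := a) (b := b)
    simp only [Finset.card_univ] at *
    omega
  simp only [Finset.mem_insert, Finset.mem_singleton, not_or] at hz
  have := (h.2 z).preconnected ⟨a, Ne.symm hz.1⟩ ⟨b, Ne.symm hz.2⟩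
  exact this.map (SimpleGraph.Embedding.induce _).toHom

theorem cyc_walk {l : List V} (h : Cyc G.Adj l) : HasCycleLength G l.length := by
  obtain ⟨h3, hnd, a, b, ⟨hch, hh, hl⟩, hba⟩ := h
  have hne : l ≠ [] := by rintro rfl; simp at h3
  have e1 : l.head hne = a := by
    rw [List.head?_eq_some_head hne] at hh; simpa using hh
  have e2 : l.getLast hne = b := by
    rw [List.getLast?_eq_some_getLast hne] at hl; simpa using hl
  let p := Walk.ofSupport l hne hch
  have hadj : G.Adj (l.getLast hne) (l.head hne) := by rw [e1, e2]; exact hba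
  have hlen : p.length = l.length - 1 := Walk.length_ofSupport hne hch
  have hp : p.IsPath := by
    rw [Walk.isPath_def, Walk.support_ofSupport]; exact hnd
  refine ⟨_, Walk.cons hadj p, ?_, ?_⟩
  · rw [Walk.cons_isCycle_iff]
    refine ⟨hp, fun hm => ?_⟩
    rw [Sym2.eq_swap] at hm
    have := hp.length_eq_one_of_mem_edges hm
    omega
  · rw [Walk.length_cons]; omega

theorem top [Fintype V] [DecidableRel G.Adj] {W : Type} {S : SimpleGraph W}
    (hS : Nonempty (S ≃g pathGraph 4) ∨ Nonempty (S ≃g Zgraph 1) ∨ Nonempty (S ≃g Zgraph 2))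
    (h2 : TwoConnected G) (hnc : ¬ IsCycleGraph G)
    (hclaw : F1Heavy G claw) (hSheavy : F1Heavy G S) : IsPancyclic G := by
  have hC := mkHC hclaw
  have hZ := mkHZ hS hSheavy
  have hT := mkTwoC h2
  have hP : Pan G Finset.univ := by
    by_cases hX : ∃ u, u ∈ HX G
    · obtain ⟨u, hu⟩ := hX
      refine tD hC hZ _ _ rfl hT ?_ ⟨u, Finset.mem_univ _, hu, ?_⟩
      · intro y _ z _ hy hz _
        have hy' : Fintype.card V + 1 ≤ 2 * G.degree y := hy
        have hz' : Fintype.card V + 1 ≤ 2 * G.degree z := hz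
        rw [dg_univ, dg_univ, Finset.card_univ]
        omega
      · rw [dg_univ, Finset.card_univ]; exact hu
    · have hXe : HX G = ∅ := Set.eq_empty_iff_forall_notMem.2 (fun x hx => hX ⟨x, hx⟩)
      rw [hXe] at hC hZ
      refine t0 hC hZ _ _ rfl hT ?_
      by_contra hno
      push Not at hno
      apply hnc
      refine ⟨mkConn h2, fun v => ?_⟩
      have h1 := hno v (Finset.mem_univ _)
      rw [dg_univ] at h1
      obtain ⟨z, hz⟩ : ∃ z, v ≠ z := by
        have : Nontrivial V := Fintype.one_lt_card_iff_nontrivial.1 (by have := h2.1; omega)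
        obtain ⟨z, hz⟩ := exists_ne v
        exact ⟨z, hz.symm⟩
      obtain ⟨a, _, _, hva⟩ := hT.exists_nbr (Finset.mem_univ v) hz
      obtain ⟨b, _, hba, hvb⟩ := hT.exists_nbr (Finset.mem_univ v) hva.ne
      have : 1 < G.degree v := by
        rw [← SimpleGraph.card_neighborFinset_eq_degree, Finset.one_lt_card]
        exact ⟨a, by simpa using hva, b, by simpa using hvb, hba.symm⟩
      omega
  intro k h3 hk
  obtain ⟨l, hl, _, rfl⟩ := hP k h3 (by simpa using hk)
  exact cyc_walk hl

end Top
end Panc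

theorem pancyclic_of_claw_S_f1_heavy {V W : Type} [Fintype V] (G : SimpleGraph V)
    [DecidableRel G.Adj] (S : SimpleGraph W)
    (hS : Nonempty (S ≃g pathGraph 4) ∨ Nonempty (S ≃g Zgraph 1) ∨ Nonempty (S ≃g Zgraph 2))
    (h2 : TwoConnected G) (hnc : ¬ IsCycleGraph G)
    (hclaw : F1Heavy G claw) (hSheavy : F1Heavy G S) :
    IsPancyclic G :=
  Panc.top hS h2 hnc hclaw hSheavy
end

section
/- Let G be a 2-connected graph on n vertices. If max{d(u), d(v)} ≥ n/2 for every pair of vertices u, v of G such that d_G(u,v) = 2, then G is Hamiltonian. -/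
open SimpleGraph

theorem ham_of_list {V : Type} [Fintype V] (G : SimpleGraph V) (hn : 3 ≤ Fintype.card V)
    (l : List V) (hnd : l.Nodup) (hfull : ∀ v, v ∈ l) (hch : l.IsChain G.Adj)
    (hcl : ∀ x ∈ l.getLast?, ∀ y ∈ l.head?, G.Adj x y) : IsHamiltonianGraph G := by
  classical
  have hlen : l.length = Fintype.card V := by
    rw [← List.toFinset_card_of_nodup hnd, Finset.card_eq_iff_eq_univ]
    ext v; simp [hfull]
  have hne : l ≠ [] := by
    rintro rfl; simp at hlen; omega
  have hadj : G.Adj (l.getLast hne) (l.head hne) :=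
    hcl _ (by simp [List.getLast?_eq_some_getLast hne]) _ (by simp [List.head?_eq_some_head hne])
  refine ⟨l.getLast hne, .cons hadj (.ofSupport l hne hch), ?_, ?_⟩
  · rw [Walk.isCycle_iff_isPath_tail_and_le_length]
    constructor
    · simp [Walk.isPath_def, hnd]
    · simp; omega
  · intro u
    simp [hfull]

theorem ore_list {V : Type} [Fintype V] (G : SimpleGraph V) [DecidableRel G.Adj]
    (hn : 3 ≤ Fintype.card V)
    {u v : V} (p : G.Walk u v) (hp : p.IsPath) (hfull : ∀ w, w ∈ p.support)
    (hdeg : Fintype.card V ≤ G.degree u + G.degree v) : IsHamiltonianGraph G := by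
  classical
  have hlen : p.length + 1 = Fintype.card V := by
    rw [← Walk.length_support, ← List.toFinset_card_of_nodup hp.support_nodup,
      Finset.card_eq_iff_eq_univ]
    ext v; simp [hfull]
  have hS : G.degree u ≤ ((Finset.range p.length).filter
      (fun i => G.Adj u (p.getVert (i + 1)))).card := by
    rw [← G.card_neighborFinset_eq_degree]
    refine (Finset.card_le_card ?_).trans
      (Finset.card_image_le (f := fun i => p.getVert (i + 1)))
    intro w hw
    rw [mem_neighborFinset] at hw
    obtain ⟨i, hi, hil⟩ := Walk.mem_support_iff_exists_getVert.mp (hfull w)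
    rcases i with _ | i
    · simp at hi; subst hi; exact absurd hw (G.irrefl)
    · simp only [Finset.mem_image, Finset.mem_filter, Finset.mem_range]
      exact ⟨i, ⟨by omega, by rw [hi]; exact hw⟩, hi⟩
  have hT : G.degree v ≤ ((Finset.range p.length).filter
      (fun i => G.Adj v (p.getVert i))).card := by
    rw [← G.card_neighborFinset_eq_degree]
    refine (Finset.card_le_card ?_).trans
      (Finset.card_image_le (f := fun i => p.getVert i))
    intro w hw
    rw [mem_neighborFinset] at hw
    obtain ⟨i, hi, hil⟩ := Walk.mem_support_iff_exists_getVert.mp (hfull w)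
    simp only [Finset.mem_image, Finset.mem_filter, Finset.mem_range]
    refine ⟨i, ⟨?_, by rw [hi]; exact hw⟩, hi⟩
    rcases hil.lt_or_eq with h | h
    · exact h
    · subst h; simp at hi; subst hi; exact absurd hw (G.irrefl)
  have : ∃ i < p.length, G.Adj u (p.getVert (i + 1)) ∧ G.Adj v (p.getVert i) := by
    by_contra! hcon
    have hd : Disjoint ((Finset.range p.length).filter (fun i => G.Adj u (p.getVert (i + 1))))
      ((Finset.range p.length).filter (fun i => G.Adj v (p.getVert i))) := by
      rw [Finset.disjoint_left]
      intro i hi hi'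
      simp only [Finset.mem_filter, Finset.mem_range] at hi hi'
      exact hcon i hi.1 hi.2 hi'.2
    have h1 := Finset.card_union_of_disjoint hd
    have h2 : _ ≤ (Finset.range p.length).card := Finset.card_le_card
      (Finset.union_subset (Finset.filter_subset (fun i => G.Adj u (p.getVert (i + 1))) _)
        (Finset.filter_subset (fun i => G.Adj v (p.getVert i)) _))
    rw [Finset.card_range] at h2
    omega
  obtain ⟨i, hi, hui, hvi⟩ := this
  let q : G.Walk (p.getVert (i + 1)) u :=
    (p.drop (i + 1)).append (.cons hvi (p.take i).reverse)
  have hperm : q.support.Perm p.support := by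
    have : q.support = p.support.drop (i + 1) ++ (p.support.take (i + 1)).reverse := by
      simp only [q, Walk.support_append, Walk.support_cons, List.tail_cons, Walk.support_reverse,
        Walk.support_take, Walk.drop_support_eq_support_drop_min]
      rw [min_eq_left (by omega)]
    rw [this]
    refine (List.Perm.append_left _ (List.reverse_perm _)).trans
      (List.perm_append_comm.trans ?_)
    rw [List.take_append_drop]
  refine ⟨u, .cons hui q, ?_, ?_⟩
  · rw [Walk.isCycle_iff_isPath_tail_and_le_length]
    constructor
    · simp [Walk.isPath_def, hperm.nodup_iff, hp.support_nodup]
    · have := hperm.length_eq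
      simp at this
      simp; omega
  · intro w
    simp [hperm.mem_iff, hfull]

theorem ore_edge {V : Type} [Fintype V] (G : SimpleGraph V) [DecidableRel G.Adj]
    (hn : 3 ≤ Fintype.card V) {u v : V} (huv : u ≠ v)
    (hdeg : Fintype.card V ≤ G.degree u + G.degree v)
    (hH : IsHamiltonianGraph (G ⊔ SimpleGraph.edge u v)) : IsHamiltonianGraph G := by
  classical
  obtain ⟨w, c, hc, hfull⟩ := hH
  have key : ∀ e, e ∈ (G ⊔ SimpleGraph.edge u v).edgeSet → e ≠ s(u, v) → e ∈ G.edgeSet := by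
    intro e he hne
    rw [SimpleGraph.edgeSet_sup] at he
    rcases he with he | he
    · exact he
    · simp [SimpleGraph.edge] at he
      exact absurd he.1 hne
  by_cases he : s(u, v) ∈ c.edges
  · have hu := c.fst_mem_support_of_mem_edges he
    have hadj : (c.rotate u hu).toSubgraph.Adj u v := by
      rw [Walk.adj_toSubgraph_iff_mem_edges, (c.rotate_edges u hu).mem_iff]
      exact he
    obtain ⟨d, hd, hsnd, hverts⟩ := (hc.rotate hu).exists_isCycle_snd_verts_eq hadj
    have hdfull : ∀ x, x ∈ d.support := by
      intro x
      have : x ∈ d.toSubgraph.verts := by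
        rw [hverts]; simp [hfull]
      simpa using this
    cases d with
    | nil => simp at hd
    | cons h q =>
      simp at hsnd
      subst hsnd
      rw [Walk.cons_isCycle_iff] at hd
      have hq : ∀ e ∈ q.edges, e ∈ G.edgeSet := fun e he =>
        key e (q.edges_subset_edgeSet he) (fun h => hd.2 (h ▸ he))
      refine ore_list G hn (q.transfer G hq) (hd.1.transfer hq) ?_ (by omega)
      intro x
      have := hdfull x
      simp at this ⊢
      rcases this with rfl | h
      · simp
      · exact h
  · refine ⟨w, c.transfer G (fun e h => key e (c.edges_subset_edgeSet h)
      (fun h' => he (h' ▸ h))), hc.transfer _, ?_⟩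
    simpa using hfull

theorem exists_maximal_nonham {V : Type} [Fintype V] (G : SimpleGraph V) [DecidableRel G.Adj]
    (hn : 3 ≤ Fintype.card V) (hG : ¬ IsHamiltonianGraph G) :
    ∃ H : SimpleGraph V, G ≤ H ∧ ¬ IsHamiltonianGraph H ∧
      ∀ u v, u ≠ v → Fintype.card V ≤ 2 * G.degree u → Fintype.card V ≤ 2 * G.degree v →
        H.Adj u v := by
  classical
  obtain ⟨H, hGH, hH⟩ := (Set.toFinite {H : SimpleGraph V | ¬ IsHamiltonianGraph H}).exists_le_maximal hG
  refine ⟨H, hGH, hH.1, ?_⟩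
  intro u v huv hu hv
  by_contra hadj
  have hdu : G.degree u ≤ H.degree u := SimpleGraph.degree_le_of_le hGH
  have hdv : G.degree v ≤ H.degree v := SimpleGraph.degree_le_of_le hGH
  apply hH.1
  refine ore_edge H hn huv (by omega) ?_
  by_contra hcon
  have := hH.2 hcon le_sup_left
  apply hadj
  apply this
  simp [SimpleGraph.edge, huv]

theorem cut_edge {V : Type} [Fintype V] (G : SimpleGraph V) (h2 : TwoConnected G)
    (x : V) (S : Set V) {s t : V} (hs : s ∈ S) (hsx : s ≠ x) (ht : t ∉ S) (htx : t ≠ x) :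
    ∃ p q, p ∈ S ∧ q ∉ S ∧ p ≠ x ∧ q ≠ x ∧ G.Adj p q := by
  obtain ⟨w⟩ := (h2.2 x).preconnected ⟨s, hsx⟩ ⟨t, htx⟩
  obtain ⟨d, -, h1, h3⟩ := w.exists_boundary_dart (Subtype.val ⁻¹' S) hs ht
  exact ⟨d.fst.1, d.snd.1, h1, h3, d.fst.2, d.snd.2, d.adj⟩

theorem exists_block {V : Type} [Fintype V] (G : SimpleGraph V) [DecidableRel G.Adj]
    (h2 : TwoConnected G) (v : V) (C : Finset V) (hvC : v ∈ C)
    (hlight : ∀ x ∈ C, 2 * G.degree x < Fintype.card V)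
    (hclique : ∀ x ∈ C, ∀ y ∈ C, x ≠ y → G.Adj x y)
    (hclosed : ∀ x ∈ C, ∀ y, G.Adj x y → 2 * G.degree y < Fintype.card V → y ∈ C) :
    ∃ l : List V, l.Nodup ∧ l.IsChain G.Adj ∧
      (∀ x ∈ l.head?, Fintype.card V ≤ 2 * G.degree x) ∧
      (∀ x ∈ l.getLast?, Fintype.card V ≤ 2 * G.degree x) ∧
      (∀ x ∈ C, x ∈ l) ∧
      (∀ x ∈ l, x ∈ C ∨ (Fintype.card V ≤ 2 * G.degree x ∧ ∃ c ∈ C, G.Adj x c)) := by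
  classical
  have hn := h2.1
  have hheavy : ∀ x ∈ C, ∀ y, y ∉ C → G.Adj x y → Fintype.card V ≤ 2 * G.degree y := by
    intro x hx y hy hxy
    by_contra hcon
    exact hy (hclosed x hx y hxy (by omega))
  -- no vertex of `C` is adjacent to all others
  have hfar : ∀ c ∈ C, ∃ t, t ≠ c ∧ ¬ G.Adj c t := by
    intro c hc
    by_contra! hcon
    have : Finset.univ.erase c ⊆ G.neighborFinset c := by
      intro t ht
      rw [mem_neighborFinset]
      exact hcon t (Finset.ne_of_mem_erase ht)
    have h1 := Finset.card_le_card this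
    rw [Finset.card_erase_of_mem (Finset.mem_univ _), Finset.card_univ,
      G.card_neighborFinset_eq_degree] at h1
    have := hlight c hc
    omega
  have hfar' : ∀ c ∈ C, ∃ t, t ∉ C ∧ ¬ G.Adj c t := by
    intro c hc
    obtain ⟨t, htc, hnt⟩ := hfar c hc
    exact ⟨t, fun h => hnt (hclique c hc t h htc.symm), hnt⟩
  obtain ⟨t, htC, -⟩ := hfar' v hvC
  have htv : t ≠ v := fun h => htC (h ▸ hvC)
  obtain ⟨x, hx⟩ : ∃ x, x ∉ ({v, t} : Finset V) := by
    by_contra! hcon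
    have : Fintype.card V ≤ ({v, t} : Finset V).card := by
      rw [← Finset.card_univ]; exact Finset.card_le_card (fun y _ => hcon y)
    have := Finset.card_le_two (a := v) (b := t)
    omega
  simp only [Finset.mem_insert, Finset.mem_singleton, not_or] at hx
  obtain ⟨c1, a, hc1, ha, -, -, hca⟩ := cut_edge G h2 x (C : Set V) (s := v) (t := t)
    (by simpa using hvC) (Ne.symm hx.1) (by simpa using htC) (Ne.symm hx.2)
  simp only [Finset.mem_coe] at hc1 ha
  obtain ⟨t', ht'C, ht'a⟩ := hfar' c1 hc1
  obtain ⟨c2, b, hc2, hb, -, hba, hcb⟩ := cut_edge G h2 a (C : Set V) (s := v) (t := t')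
    (by simpa using hvC) (fun h => ha (h ▸ hvC)) (by simpa using ht'C)
    (fun h => ht'a (h ▸ hca))
  simp only [Finset.mem_coe] at hc2 hb
  have main : ∃ c1 ∈ C, ∃ c2 ∈ C, ∃ a, a ∉ C ∧ ∃ b, b ∉ C ∧ a ≠ b ∧ G.Adj c1 a ∧ G.Adj c2 b ∧
      (c1 ≠ c2 ∨ C = {c1} ∧ c1 = c2) := by
    by_cases h12 : c1 = c2
    · subst h12
      by_cases hC : ∃ c ∈ C, c ≠ c1
      · obtain ⟨c, hcC, hcc⟩ := hC
        obtain ⟨c3, z, hc3, hz, hc31, -, hadj⟩ := cut_edge G h2 c1 (C : Set V) (s := c) (t := t)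
          (by simpa using hcC) hcc (by simpa using htC) (fun h => htC (h ▸ hc1))
        simp only [Finset.mem_coe] at hc3 hz
        by_cases hza : z = a
        · subst hza
          exact ⟨c1, hc1, c3, hc3, b, hb, z, hz, hba, hcb, hadj, Or.inl hc31.symm⟩
        · exact ⟨c1, hc1, c3, hc3, a, ha, z, hz, Ne.symm hza, hca, hadj, Or.inl hc31.symm⟩
      · push Not at hC
        exact ⟨c1, hc1, c1, hc1, a, ha, b, hb, hba.symm, hca, hcb,
          Or.inr ⟨Finset.eq_singleton_iff_unique_mem.mpr ⟨hc1, hC⟩, rfl⟩⟩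
    · exact ⟨c1, hc1, c2, hc2, a, ha, b, hb, hba.symm, hca, hcb, Or.inl h12⟩
  clear hc1 hc2 ha hb hca hcb hba ht'a
  obtain ⟨c1, hc1, c2, hc2, a, ha, b, hb, hab, hca, hcb, h12⟩ := main
  -- an ordering of `C` from `c1` to `c2`
  obtain ⟨L, hLnd, hLmem, hLh, hLl⟩ : ∃ L : List V, L.Nodup ∧ (∀ x, x ∈ L ↔ x ∈ C) ∧
      L.head? = some c1 ∧ L.getLast? = some c2 := by
    rcases h12 with h12 | ⟨hC, rfl⟩
    · refine ⟨c1 :: (((C.erase c1).erase c2).toList ++ [c2]), ?_, ?_, ?_, ?_⟩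
      · simp [List.nodup_append, h12, Finset.nodup_toList]
        grind
      · intro x
        simp
        grind
      · simp
      · simp [List.getLast?_cons]
    · exact ⟨[c1], by simp, by simp [hC], by simp, by simp⟩
  have hLch : L.IsChain G.Adj := by
    apply List.Pairwise.isChain
    refine hLnd.imp_of_mem ?_
    intro x y hx hy hxy
    exact hclique x ((hLmem x).1 hx) y ((hLmem y).1 hy) hxy
  refine ⟨a :: (L ++ [b]), ?_, ?_, ?_, ?_, ?_, ?_⟩
  · simp [List.nodup_append, hLmem, ha, hab, hLnd]
    exact hb
  · rw [List.isChain_cons, List.isChain_append]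
    refine ⟨?_, hLch, by simp, ?_⟩
    · simp [List.head?_append, hLh]
      exact hca.symm
    · simp [hLl, hcb]
  · simp
    exact hheavy c1 hc1 a ha hca
  · simp [List.getLast?_cons]
    exact hheavy c2 hc2 b hb hcb
  · intro x hx
    simp [hLmem, hx]
  · intro x hx
    simp [hLmem] at hx
    rcases hx with rfl | hx | rfl
    · exact Or.inr ⟨hheavy c1 hc1 _ ha hca, c1, hc1, hca.symm⟩
    · exact Or.inl hx
    · exact Or.inr ⟨hheavy c2 hc2 _ hb hcb, c2, hc2, hcb.symm⟩

theorem light_adj {V : Type} [Fintype V] (G : SimpleGraph V) [DecidableRel G.Adj]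
    (h : ∀ u v : V, G.dist u v = 2 →
      Fintype.card V ≤ 2 * max (G.degree u) (G.degree v)) {x y z : V} (hxy : x ≠ y)
    (hx : 2 * G.degree x < Fintype.card V) (hy : 2 * G.degree y < Fintype.card V)
    (hxz : G.Adj x z) (hzy : G.Adj z y) : G.Adj x y := by
  by_contra hadj
  have hw : G.dist x y ≤ 2 := SimpleGraph.dist_le (Walk.cons hxz (Walk.cons hzy Walk.nil))
  have hr : G.Reachable x y := ⟨Walk.cons hxz (Walk.cons hzy Walk.nil)⟩
  have := hr.one_lt_dist_of_ne_of_not_adj hxy hadj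
  have := h x y (by omega)
  rcases max_choice (G.degree x) (G.degree y) with h | h <;> omega

theorem fan_hamiltonian {V : Type} [Fintype V] (G : SimpleGraph V) [DecidableRel G.Adj]
    (h2 : TwoConnected G)
    (h : ∀ u v : V, G.dist u v = 2 →
      Fintype.card V ≤ 2 * max (G.degree u) (G.degree v)) :
    IsHamiltonianGraph G := by
  classical
  by_contra hG
  obtain ⟨H, hGH, hH, hheavy⟩ := exists_maximal_nonham G h2.1 hG
  apply hH
  let P : List V → Prop := fun l => l.Nodup ∧ l.IsChain H.Adj ∧
      (∀ x ∈ l.head?, Fintype.card V ≤ 2 * G.degree x) ∧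
      (∀ x ∈ l.getLast?, Fintype.card V ≤ 2 * G.degree x) ∧
      (∀ x ∈ l, ∀ y, G.Adj x y → 2 * G.degree y < Fintype.card V → y ∈ l)
  have hP0 : P [] := by simp [P]
  -- appending two good disjoint lists
  have happ : ∀ l m, P l → m.Nodup → m.IsChain H.Adj →
      (∀ x ∈ m.head?, Fintype.card V ≤ 2 * G.degree x) →
      (∀ x ∈ m.getLast?, Fintype.card V ≤ 2 * G.degree x) →
      (∀ x ∈ m, ∀ y, G.Adj x y → 2 * G.degree y < Fintype.card V → y ∈ l ++ m) →
      (∀ x ∈ l, x ∉ m) → P (l ++ m) := by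
    rintro l m ⟨h1, h3, h4, h5, h6⟩ g1 g3 g4 g5 g6 hd
    refine ⟨List.nodup_append.mpr ⟨h1, g1, fun x hx y hy hxy => hd x hx (hxy ▸ hy)⟩,
      List.isChain_append.mpr ⟨h3, g3, ?_⟩, ?_, ?_, ?_⟩
    · intro x hx y hy
      refine hheavy x y ?_ (h5 x hx) (g4 y hy)
      rintro rfl
      exact hd x (List.mem_of_getLast? hx) (List.mem_of_head? hy)
    · intro x hx
      rw [List.head?_append] at hx
      rcases l with _ | ⟨a, l⟩
      · exact g4 x (by simpa using hx)
      · exact h4 x (by simpa using hx)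
    · intro x hx
      rw [List.getLast?_append] at hx
      rcases hm : m.getLast? with _ | a
      · exact h5 x (by simpa [hm] using hx)
      · exact g5 x (by simpa [hm] using hx)
    · intro x hx y hxy hy
      rcases List.mem_append.1 hx with hx | hx
      · exact List.mem_append_left _ (h6 x hx y hxy hy)
      · exact g6 x hx y hxy hy
  -- a good list of maximal length
  obtain ⟨l, hl, hmax⟩ : ∃ l, P l ∧ ∀ m, P m → m.length ≤ l.length := by
    have hb : ∀ m, P m → m.length ≤ Fintype.card V := fun m hm => hm.1.length_le_card
    have hex : ∃ k, ∃ l, P l ∧ l.length = k := ⟨0, [], hP0, rfl⟩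
    have hs := Nat.findGreatest_spec (P := fun k => ∃ l, P l ∧ l.length = k)
      (Nat.zero_le (Fintype.card V)) ⟨[], hP0, rfl⟩
    obtain ⟨l, hl, hlen⟩ := hs
    refine ⟨l, hl, fun m hm => ?_⟩
    rw [hlen]
    exact Nat.le_findGreatest (hb m hm) ⟨m, hm, rfl⟩
  have hlightmem : ∀ v, 2 * G.degree v < Fintype.card V → v ∈ l := by
    intro v hv
    by_contra hvl
    let C : Finset V := Finset.univ.filter
      (fun x => 2 * G.degree x < Fintype.card V ∧ (x = v ∨ G.Adj v x))
    have hC : ∀ x, x ∈ C ↔ 2 * G.degree x < Fintype.card V ∧ (x = v ∨ G.Adj v x) := by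
      simp [C]
    have hclosed : ∀ x ∈ C, ∀ y, G.Adj x y → 2 * G.degree y < Fintype.card V → y ∈ C := by
      intro x hx y hxy hy
      rw [hC] at hx ⊢
      refine ⟨hy, ?_⟩
      rcases hx with ⟨hx, rfl | hvx⟩
      · exact Or.inr hxy
      · by_cases hyv : y = v
        · exact Or.inl hyv
        · exact Or.inr (light_adj G h (Ne.symm hyv) hv hy hvx hxy)
    have hCl : ∀ x ∈ C, x ∉ l := by
      intro x hx hxl
      rw [hC] at hx
      rcases hx with ⟨hx, rfl | hvx⟩
      · exact hvl hxl
      · exact hvl (hl.2.2.2.2 x hxl v hvx.symm hv)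
    obtain ⟨m, m1, m2, m3, m4, m5, m6⟩ := exists_block G h2 v C ((hC v).2 ⟨hv, Or.inl rfl⟩)
      (fun x hx => ((hC x).1 hx).1) (by
        intro x hx y hy hxy
        rw [hC] at hx hy
        rcases hx with ⟨hx, rfl | hvx⟩ <;> rcases hy with ⟨hy, rfl | hvy⟩
        · exact absurd rfl hxy
        · exact hvy
        · exact hvx.symm
        · exact light_adj G h hxy hx hy hvx.symm hvy) hclosed
    have hPm : P (l ++ m) := by
      refine happ l m hl m1 (m2.imp (fun _ _ hab => hGH hab)) m3 m4 ?_ ?_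
      · intro x hx y hxy hy
        refine List.mem_append_right _ (m5 y ?_)
        rcases m6 x hx with hxC | ⟨-, c, hc, hxc⟩
        · exact hclosed x hxC y hxy hy
        · by_cases hyc : c = y
          · exact hyc ▸ hc
          · exact hclosed c hc y (light_adj G h hyc ((hC c).1 hc).1 hy hxc.symm hxy) hy
      · intro x hxl hxm
        rcases m6 x hxm with hxC | ⟨-, c, hc, hxc⟩
        · exact hCl x hxC hxl
        · exact hCl c hc (hl.2.2.2.2 x hxl c hxc ((hC c).1 hc).1)
    have hlen := hmax _ hPm
    have hvm : v ∈ m := m5 v ((hC v).2 ⟨hv, Or.inl rfl⟩)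
    have := List.length_pos_of_mem hvm
    simp at hlen
    subst hlen
    simp at this
  have hfull : ∀ v, v ∈ l := by
    intro v
    by_contra hvl
    have hv : Fintype.card V ≤ 2 * G.degree v := by
      by_contra hcon
      exact hvl (hlightmem v (by omega))
    have hPm : P (l ++ [v]) := by
      refine happ l [v] hl (by simp) (by simp) (by simpa using hv) (by simpa using hv) ?_ ?_
      · intro x hx y hxy hy
        exact List.mem_append_left _ (hlightmem y hy)
      · intro x hx hxv
        simp at hxv
        exact hvl (hxv ▸ hx)
    have hlen := hmax _ hPm
    simp at hlen
  refine ham_of_list H h2.1 l hl.1 hfull hl.2.1 ?_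
  intro x hx y hy
  refine hheavy x y ?_ (hl.2.2.2.1 x hx) (hl.2.2.1 y hy)
  rintro rfl
  have hn := h2.1
  have hlen : l.length = Fintype.card V := by
    rw [← List.toFinset_card_of_nodup hl.1, Finset.card_eq_iff_eq_univ]
    ext v; simp [hfull]
  have hnd := hl.1
  rcases l with _ | ⟨a, l⟩
  · simp at hy
  · simp at hy
    subst hy
    rcases l.eq_nil_or_concat with rfl | ⟨l', b, rfl⟩
    · simp at hlen; omega
    · simp [List.getLast?_cons] at hx
      subst hx
      simp at hnd
end
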